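/- Theorem 3 (fractional incomplete lumped formulation, radial case). Let a, λ, α, A > 0, ν > 0, 0 < β < 1/2, and let h : [0,∞) → ℝ be continuous and bounded with h(0) = 0. Define f₁(τ,s) = (2βτ/s^{2β+1})·M(τ/s^{2β}; 2β) and f₂(τ,z,s) = (β(z+ατ)/(a√π s^{2β+1}))·∫_0^∞ u^{-1/2} exp(−(z+ατ)²/(4a²u) − λ²u/(4a²))·M(u/s^{2β}; 2β) du for s > 0, let g₁(t,τ,z) = (f₁(τ,·) ⋆ h ⋆ f₂(τ,z,·))(t) be the double Laplace convolution, and set u(r,z,t) = (A/Γ(ν)) ∫_0^∞ τ^{−(ν+1)} (r/2)^{2ν} exp(−r²/(4τ))·exp(λ(z+ατ)/(2a²))·g₁(t,τ,z) dτ. Then u solves the radial fractional boundary value problem: (i) D_*^{2β}u(r,z,·)(t) = a² ∂²u/∂z²(r,z,t) − λ ∂u/∂z(r,z,t) for all r, z, t > 0; (ii) D_*^{2β}u(r,0,·)(t) = ∂²u/∂r²(r,0,t) + ((1−2ν)/r) ∂u/∂r(r,0,t) + α ∂u/∂z(r,0,t) for all r, t > 0; (iii) u(r,z,t) → A·h(t)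 as (r,z) → (0,0) for each t > 0; (iv) u(r,z,t) → 0 as r² + z² → ∞ for each t > 0; (v) u(r,z,t) → 0 as t → 0⁺ for all r, z > 0. -/

import Mathlib

open MeasureTheory Real Filter Set

/-- The Wright-type auxiliary function `M(y; δ)`. -/
noncomputable def Mwr (y δ : ℝ) : ℝ :=
  ∑' n : ℕ, (-y) ^ n / ((n.factorial : ℝ) * Real.Gamma (-δ * (n : ℝ) + 1 - δ))

/-- The Caputo fractional derivative of order `0 < δ < 1`. -/
noncomputable def caputo (δ : ℝ) (v : ℝ → ℝ) (t : ℝ) : ℝ :=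
  (1 / Real.Gamma (1 - δ)) * ∫ s in (0 : ℝ)..t, deriv v s * (t - s) ^ (-δ)

/-- The Laplace convolution `(f ⋆ g)(t) = ∫_0^t f(t−s) g(s) ds`. -/
noncomputable def lconv (f g : ℝ → ℝ) (t : ℝ) : ℝ :=
  ∫ s in (0 : ℝ)..t, f (t - s) * g s

namespace WrightRadial

section RotatedGamma

lemma integrableOn_cpow_mul_cexp {a r : ℂ} (ha : 0 < a.re) (hr : 0 < r.re) :
    IntegrableOn (fun x : ℝ => (x : ℂ) ^ (a - 1) * Complex.exp (-(r * x))) (Ioi 0) := by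
  have h := integrableOn_rpow_mul_exp_neg_mul_rpow (p := 1) (s := a.re - 1) (b := r.re)
    (by linarith) one_pos hr
  refine Integrable.mono' h ?_ ?_
  · refine ContinuousOn.aestronglyMeasurable ?_ measurableSet_Ioi
    intro x hx
    refine ContinuousAt.continuousWithinAt ?_
    have : ContinuousAt (fun x : ℝ => (x : ℂ) ^ (a - 1)) x :=
      (Complex.continuousAt_ofReal_cpow_const _ _ (Or.inr (ne_of_gt hx)))
    fun_prop
  · refine (ae_restrict_iff' measurableSet_Ioi).2 (Eventually.of_forall fun x hx => ?_)
    rw [norm_mul, Complex.norm_cpow_eq_rpow_re_of_pos hx, Complex.norm_exp]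
    simp

/-- The Gamma integral along a rotated ray. -/
lemma integral_cpow_mul_cexp_neg_mul {a r : ℂ} (ha : 0 < a.re) (hr : 0 < r.re) :
    ∫ x : ℝ in Ioi 0, (x : ℂ) ^ (a - 1) * Complex.exp (-(r * x)) =
      r ^ (-a) * Complex.Gamma a := by
  set U : Set ℂ := {r : ℂ | 0 < r.re} with hU
  have hUo : IsOpen U := isOpen_lt continuous_const Complex.continuous_re
  have hUc : IsPreconnected U := (convex_halfSpace_re_gt 0).isPreconnected
  set G : ℂ → ℂ := fun r => ∫ x : ℝ in Ioi 0, (x : ℂ) ^ (a - 1) * Complex.exp (-(r * x)) with hG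
  have ha1 : 0 < (a + 1).re := by simp; linarith
  have hder : ∀ r ∈ U, HasDerivAt G
      (-∫ x : ℝ in Ioi 0, (x : ℂ) ^ a * Complex.exp (-(r * x))) r := by
    intro r hr
    have hr' : 0 < r.re := hr
    have hs : {r' : ℂ | r.re / 2 < r'.re} ∈ nhds r :=
      (isOpen_lt continuous_const Complex.continuous_re).mem_nhds (by simp; linarith)
    have key := hasDerivAt_integral_of_dominated_loc_of_deriv_le
      (μ := volume.restrict (Ioi (0 : ℝ))) (𝕜 := ℂ)
      (F := fun r (x : ℝ) => (x : ℂ) ^ (a - 1) * Complex.exp (-(r * x)))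
      (F' := fun r (x : ℝ) => -((x : ℂ) ^ a * Complex.exp (-(r * x))))
      (bound := fun x => x ^ a.re * Real.exp (-(r.re / 2) * x ^ (1 : ℝ)))
      (x₀ := r) (s := {r' : ℂ | r.re / 2 < r'.re}) hs ?_ ?_ ?_ ?_ ?_ ?_
    · have := key.2
      rwa [integral_neg] at this
    · filter_upwards [hUo.mem_nhds hr] with r' hr'
      exact (integrableOn_cpow_mul_cexp ha hr').aestronglyMeasurable
    · exact integrableOn_cpow_mul_cexp ha hr'
    · have := (integrableOn_cpow_mul_cexp ha1 hr').aestronglyMeasurable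
      simp only [add_sub_cancel_right] at this
      exact this.fun_neg
    · refine (ae_restrict_iff' measurableSet_Ioi).2 (Eventually.of_forall fun x hx r' hr' => ?_)
      rw [norm_neg, norm_mul, Complex.norm_cpow_eq_rpow_re_of_pos hx, Complex.norm_exp]
      have hx0 : 0 < x := hx
      have : r.re / 2 < r'.re := hr'
      gcongr
      simp
      nlinarith
    · exact integrableOn_rpow_mul_exp_neg_mul_rpow (by linarith) one_pos (by linarith)
    · refine (ae_restrict_iff' measurableSet_Ioi).2 (Eventually.of_forall fun x hx r' hr' => ?_)
      have hx0 : (x : ℂ) ≠ 0 := by exact_mod_cast (ne_of_gt hx)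
      have h1 : HasDerivAt (fun r : ℂ => Complex.exp (-(r * x))) (Complex.exp (-(r' * x)) * (-(1 * x))) r' :=
        (((hasDerivAt_id r').mul_const (x : ℂ)).neg).cexp
      refine (h1.const_mul ((x : ℂ) ^ (a - 1))).congr_deriv ?_
      rw [Complex.cpow_sub _ _ hx0, Complex.cpow_one]
      field_simp
  have hibp : ∀ r ∈ U, r * (∫ x : ℝ in Ioi 0, (x : ℂ) ^ a * Complex.exp (-(r * x))) = a * G r := by
    intro r hr
    have i1 := (integrableOn_cpow_mul_cexp ha hr).const_mul a
    have i2 := (integrableOn_cpow_mul_cexp ha1 hr).const_mul r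
    simp only [add_sub_cancel_right] at i2
    have key := integral_Ioi_of_hasDerivAt_of_tendsto (a := (0 : ℝ)) (m := (0 : ℂ))
      (f := fun x : ℝ => (x : ℂ) ^ a * Complex.exp (-(r * x)))
      (f' := fun x : ℝ => a * ((x : ℂ) ^ (a - 1) * Complex.exp (-(r * x))) -
        r * ((x : ℂ) ^ a * Complex.exp (-(r * x)))) ?_ ?_ (i1.sub i2) ?_
    · rw [integral_sub i1 i2, integral_const_mul, integral_const_mul] at key
      simp only [Complex.ofReal_zero] at key
      rw [Complex.zero_cpow (by intro h; simp [h] at ha)] at key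
      simp at key
      rw [sub_eq_zero] at key
      rw [← key]
    · refine ContinuousAt.continuousWithinAt ?_
      have : ContinuousAt (fun x : ℝ => (x : ℂ) ^ a) 0 :=
        Complex.continuousAt_ofReal_cpow_const _ _ (Or.inl ha)
      fun_prop
    · intro x hx
      have hx0 : x ≠ 0 := ne_of_gt hx
      have h1 : HasDerivAt (fun x : ℝ => (x : ℂ) ^ a) (a * (x : ℂ) ^ (a - 1)) x := by
        refine hasDerivAt_ofReal_cpow_const hx0 ?_
        rintro rfl
        simp at ha
      have h2 : HasDerivAt (fun x : ℝ => Complex.exp (-(r * x))) (Complex.exp (-(r * x)) * (-(r * 1))) x :=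
        ((Complex.ofRealCLM.hasDerivAt (x := x)).const_mul r).neg.cexp
      refine (h1.mul h2).congr_deriv ?_
      ring
    · have h0 : Tendsto (fun x : ℝ => x ^ a.re * Real.exp (-r.re * x)) atTop (nhds 0) :=
        tendsto_rpow_mul_exp_neg_mul_atTop_nhds_zero _ _ hr
      refine squeeze_zero_norm' ?_ h0
      filter_upwards [eventually_gt_atTop 0] with x hx
      rw [norm_mul, Complex.norm_cpow_eq_rpow_re_of_pos hx, Complex.norm_exp]
      simp
  have hslit : ∀ r ∈ U, r ∈ Complex.slitPlane := fun r hr => Or.inl hr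
  have hR : ∀ r ∈ U, HasDerivAt (fun r => r ^ a * G r) 0 r := by
    intro r hr
    have hr0 : r ≠ 0 := Complex.slitPlane_ne_zero (hslit r hr)
    have h1 : HasDerivAt (fun r : ℂ => r ^ a) (a * r ^ (a - 1) * 1) r :=
      (hasDerivAt_id r).cpow_const (hslit r hr)
    refine (h1.mul (hder r hr)).congr_deriv ?_
    have := hibp r hr
    rw [Complex.cpow_sub _ _ hr0, Complex.cpow_one]
    field_simp
    linear_combination -(r ^ a) * this
  have hone : (1 : ℂ) ∈ U := by simp [hU]
  have hconst : r ^ a * G r = 1 ^ a * G 1 :=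
    hUo.is_const_of_deriv_eq_zero hUc
      (fun r hr => (hR r hr).differentiableAt.differentiableWithinAt)
      (fun r hr => (hR r hr).deriv) (by exact hr) hone
  have hG1 : G 1 = Complex.Gamma a := by
    have := Complex.integral_cpow_mul_exp_neg_mul_Ioi (r := 1) ha one_pos
    simpa [hG] using this
  have hr0 : r ≠ 0 := Complex.slitPlane_ne_zero (hslit r hr)
  rw [Complex.one_cpow, one_mul, hG1] at hconst
  rw [Complex.cpow_neg, ← hconst, ← mul_assoc, inv_mul_cancel₀ , one_mul]
  simp [Complex.cpow_eq_zero_iff, hr0]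

/-- Polar form of the rotated Gamma integral. -/
lemma integral_cpow_mul_cexp_polar {a : ℂ} (ha : 0 < a.re) {b φ : ℝ} (hb : 0 < b)
    (hφ : |φ| < π / 2) :
    ∫ x : ℝ in Ioi 0, (x : ℂ) ^ (a - 1) * Complex.exp (-(b * Complex.exp (φ * Complex.I) * x)) =
      Complex.exp (-(a * φ * Complex.I)) * (b : ℂ) ^ (-a) * Complex.Gamma a := by
  have hre : 0 < (b * Complex.exp (φ * Complex.I)).re := by
    rw [Complex.re_ofReal_mul, Complex.exp_ofReal_mul_I_re]
    exact mul_pos hb (Real.cos_pos_of_mem_Ioo ⟨by linarith [neg_abs_le φ], by linarith [le_abs_self φ]⟩)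
  rw [integral_cpow_mul_cexp_neg_mul ha hre]
  congr 1
  have hpi := Real.pi_pos
  have hb0 : (b : ℂ) ≠ 0 := by exact_mod_cast hb.ne'
  rw [Complex.cpow_def_of_ne_zero (mul_ne_zero hb0 (Complex.exp_ne_zero _)),
    Complex.cpow_def_of_ne_zero hb0, Complex.log_ofReal_mul hb (Complex.exp_ne_zero _),
    Complex.log_exp (by simp; linarith [neg_abs_le φ]) (by simp; linarith [le_abs_self φ]),
    Complex.ofReal_log hb.le, ← Complex.exp_add]
  congr 1
  ring

end RotatedGamma

section Ray

/-- The integrand of the ray integral. -/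
noncomputable def rayKer (δ φ γ τ s ρ : ℝ) : ℂ :=
  ((ρ ^ (γ - 1) : ℝ) : ℂ) * Complex.exp (γ * φ * Complex.I +
    s * ρ * Complex.exp (φ * Complex.I) -
    τ * ((ρ ^ δ : ℝ) : ℂ) * Complex.exp ((δ * φ : ℝ) * Complex.I))

/-- The integral of `σ ^ (γ - 1) * exp (s * σ - τ * σ ^ δ)` along the ray of argument `φ`. -/
noncomputable def rayInt (δ φ γ τ s : ℝ) : ℂ := ∫ ρ in Ioi (0 : ℝ), rayKer δ φ γ τ s ρ

lemma norm_rayKer {δ φ γ τ s ρ : ℝ} (hρ : 0 < ρ) :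
    ‖rayKer δ φ γ τ s ρ‖ =
      ρ ^ (γ - 1) * Real.exp (s * ρ * Real.cos φ - τ * ρ ^ δ * Real.cos (δ * φ)) := by
  have h : ((γ : ℂ) * φ * Complex.I + s * ρ * Complex.exp (φ * Complex.I) -
      τ * ((ρ ^ δ : ℝ) : ℂ) * Complex.exp ((δ * φ : ℝ) * Complex.I)).re =
      s * ρ * Real.cos φ - τ * ρ ^ δ * Real.cos (δ * φ) := by
    rw [Complex.sub_re, Complex.add_re, ← Complex.ofReal_mul, ← Complex.ofReal_mul,
      ← Complex.ofReal_mul, Complex.re_ofReal_mul, Complex.re_ofReal_mul, Complex.re_ofReal_mul,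
      Complex.exp_ofReal_mul_I_re, Complex.exp_ofReal_mul_I_re]
    simp
  rw [rayKer, norm_mul, Complex.norm_exp, h, Complex.norm_real, Real.norm_eq_abs,
    abs_of_nonneg (rpow_nonneg hρ.le _)]

lemma measurable_rayKer (δ φ γ : ℝ) :
    Measurable (fun p : (ℝ × ℝ) × ℝ => rayKer δ φ γ p.1.1 p.1.2 p.2) := by
  unfold rayKer
  fun_prop

lemma measurable_rayInt (δ φ γ : ℝ) :
    Measurable (fun p : ℝ × ℝ => rayInt δ φ γ p.1 p.2) := by
  unfold rayInt
  exact ((measurable_rayKer δ φ γ).stronglyMeasurable.integral_prod_right'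
    (ν := volume.restrict (Ioi (0 : ℝ)))).measurable

lemma aesm_rayKer (δ φ γ τ s : ℝ) :
    AEStronglyMeasurable (rayKer δ φ γ τ s) (volume.restrict (Ioi 0)) := by
  have : Measurable (rayKer δ φ γ τ s) := by
    unfold rayKer
    fun_prop
  exact this.aestronglyMeasurable

variable {δ φ γ τ s : ℝ}

lemma norm_rayKer_le_of_s (h1 : Real.cos φ < 0) (h2 : 0 < Real.cos (δ * φ)) {s₀ : ℝ} (hs₀ : s₀ ≤ s)
    (hτ : 0 ≤ τ) {ρ : ℝ} (hρ : 0 < ρ) :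
    ‖rayKer δ φ γ τ s ρ‖ ≤ ρ ^ (γ - 1) * Real.exp (-(s₀ * -Real.cos φ) * ρ ^ (1 : ℝ)) := by
  rw [norm_rayKer hρ, rpow_one]
  have := rpow_pos_of_pos hρ δ
  have h3 : 0 ≤ τ * ρ ^ δ * Real.cos (δ * φ) := by positivity
  have h4 : 0 ≤ (s - s₀) * ρ * (-Real.cos φ) :=
    mul_nonneg (mul_nonneg (by linarith) hρ.le) (by linarith)
  gcongr
  nlinarith

lemma norm_rayKer_le_of_tau (h1 : Real.cos φ < 0) (h2 : 0 < Real.cos (δ * φ)) {τ₀ : ℝ}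
    (hτ₀ : τ₀ ≤ τ) (hs : 0 ≤ s) {ρ : ℝ} (hρ : 0 < ρ) :
    ‖rayKer δ φ γ τ s ρ‖ ≤ ρ ^ (γ - 1) * Real.exp (-(τ₀ * Real.cos (δ * φ)) * ρ ^ δ) := by
  rw [norm_rayKer hρ]
  have := rpow_pos_of_pos hρ δ
  have h3 : 0 ≤ (τ - τ₀) * ρ ^ δ * Real.cos (δ * φ) :=
    mul_nonneg (mul_nonneg (by linarith) this.le) h2.le
  have h4 : 0 ≤ s * ρ * (-Real.cos φ) :=
    mul_nonneg (mul_nonneg (by linarith) hρ.le) (by linarith)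
  gcongr
  nlinarith

lemma integrable_bound_s (h1 : Real.cos φ < 0) (hγ : 0 < γ) (hs : 0 < s) :
    IntegrableOn (fun ρ : ℝ => ρ ^ (γ - 1) * Real.exp (-(s * -Real.cos φ) * ρ ^ (1 : ℝ)))
      (Ioi 0) :=
  integrableOn_rpow_mul_exp_neg_mul_rpow (by linarith) one_pos (mul_pos hs (by linarith))

lemma integrable_bound_tau (hδ : 0 < δ) (h2 : 0 < Real.cos (δ * φ)) (hγ : 0 < γ) (hτ : 0 < τ) :
    IntegrableOn (fun ρ : ℝ => ρ ^ (γ - 1) * Real.exp (-(τ * Real.cos (δ * φ)) * ρ ^ δ))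
      (Ioi 0) :=
  integrableOn_rpow_mul_exp_neg_mul_rpow (by linarith) hδ (mul_pos hτ h2)

lemma integrable_rayKer_of_s (h1 : Real.cos φ < 0) (h2 : 0 < Real.cos (δ * φ)) (hγ : 0 < γ)
    (hs : 0 < s) (hτ : 0 ≤ τ) : IntegrableOn (rayKer δ φ γ τ s) (Ioi 0) :=
  Integrable.mono' (integrable_bound_s h1 hγ hs) (aesm_rayKer ..)
    ((ae_restrict_iff' measurableSet_Ioi).2 (Eventually.of_forall fun _ hx =>
      norm_rayKer_le_of_s h1 h2 le_rfl hτ hx))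

lemma integrable_rayKer_of_tau (hδ : 0 < δ) (h1 : Real.cos φ < 0) (h2 : 0 < Real.cos (δ * φ))
    (hγ : 0 < γ) (hs : 0 ≤ s) (hτ : 0 < τ) : IntegrableOn (rayKer δ φ γ τ s) (Ioi 0) :=
  Integrable.mono' (integrable_bound_tau hδ h2 hγ hτ) (aesm_rayKer ..)
    ((ae_restrict_iff' measurableSet_Ioi).2 (Eventually.of_forall fun _ hx =>
      norm_rayKer_le_of_tau h1 h2 le_rfl hs hx))

lemma exists_norm_rayInt_le_of_s (h1 : Real.cos φ < 0) (h2 : 0 < Real.cos (δ * φ)) (hγ : 0 < γ) :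
    ∃ C, 0 ≤ C ∧ ∀ τ s : ℝ, 0 ≤ τ → 0 < s → ‖rayInt δ φ γ τ s‖ ≤ C * s ^ (-γ) := by
  have hc : 0 < -Real.cos φ := by linarith
  refine ⟨(-Real.cos φ) ^ (-γ) * Real.Gamma γ, by have := Real.Gamma_pos_of_pos hγ; positivity, ?_⟩
  intro τ s hτ hs
  have h := norm_integral_le_of_norm_le (integrable_bound_s (φ := φ) h1 hγ hs)
    ((ae_restrict_iff' measurableSet_Ioi).2 (Eventually.of_forall fun x hx =>
      norm_rayKer_le_of_s (δ := δ) (γ := γ) h1 h2 le_rfl hτ hx))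
  rw [integral_rpow_mul_exp_neg_mul_rpow one_pos (by linarith) (mul_pos hs hc)] at h
  refine h.trans (le_of_eq ?_)
  rw [mul_rpow hs.le hc.le]
  norm_num
  ring

lemma exists_norm_rayInt_le_of_tau (hδ : 0 < δ) (h1 : Real.cos φ < 0) (h2 : 0 < Real.cos (δ * φ))
    (hγ : 0 < γ) :
    ∃ C, 0 ≤ C ∧ ∀ τ s : ℝ, 0 < τ → 0 ≤ s → ‖rayInt δ φ γ τ s‖ ≤ C * τ ^ (-γ / δ) := by
  refine ⟨(Real.cos (δ * φ)) ^ (-γ / δ) * (1 / δ) * Real.Gamma (γ / δ), by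
    have := Real.Gamma_pos_of_pos (div_pos hγ hδ); positivity, ?_⟩
  intro τ s hτ hs
  have h := norm_integral_le_of_norm_le (integrable_bound_tau hδ h2 hγ hτ)
    ((ae_restrict_iff' measurableSet_Ioi).2 (Eventually.of_forall fun x hx =>
      norm_rayKer_le_of_tau (δ := δ) (γ := γ) h1 h2 le_rfl hs hx))
  rw [integral_rpow_mul_exp_neg_mul_rpow hδ (by linarith) (mul_pos hτ h2)] at h
  refine h.trans (le_of_eq ?_)
  rw [mul_rpow hτ.le h2.le]
  norm_num
  ring

lemma hasDerivAt_rayKer_s {ρ : ℝ} (hρ : 0 < ρ) :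
    HasDerivAt (fun s => rayKer δ φ γ τ s ρ) (rayKer δ φ (γ + 1) τ s ρ) s := by
  unfold rayKer
  have h1 : HasDerivAt (fun s : ℝ => (s : ℂ)) 1 s := Complex.ofRealCLM.hasDerivAt
  refine ((((((h1.mul_const (ρ : ℂ)).mul_const (Complex.exp (φ * Complex.I))).const_add
    ((γ : ℂ) * φ * Complex.I)).sub_const _).cexp.const_mul _)).congr_deriv ?_
  have e : ρ ^ (γ + 1 - 1) = ρ ^ (γ - 1) * ρ := by
    rw [← rpow_add_one hρ.ne']
    congr 1; ring
  rw [e]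
  push_cast
  have : ((γ : ℂ) + 1) * φ * Complex.I + s * ρ * Complex.exp (φ * Complex.I) -
      τ * ((ρ ^ δ : ℝ) : ℂ) * Complex.exp (δ * φ * Complex.I) =
      (φ * Complex.I) + ((γ : ℂ) * φ * Complex.I + s * ρ * Complex.exp (φ * Complex.I) -
      τ * ((ρ ^ δ : ℝ) : ℂ) * Complex.exp (δ * φ * Complex.I)) := by ring
  rw [this, Complex.exp_add (φ * Complex.I)]
  ring

lemma hasDerivAt_rayKer_tau {ρ : ℝ} (hρ : 0 < ρ) :
    HasDerivAt (fun τ => rayKer δ φ γ τ s ρ) (-rayKer δ φ (γ + δ) τ s ρ) τ := by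
  unfold rayKer
  have h1 : HasDerivAt (fun s : ℝ => (s : ℂ)) 1 τ := Complex.ofRealCLM.hasDerivAt
  refine ((((h1.mul_const ((ρ ^ δ : ℝ) : ℂ)).mul_const
    (Complex.exp ((δ * φ : ℝ) * Complex.I))).const_sub
    ((γ : ℂ) * φ * Complex.I + s * ρ * Complex.exp (φ * Complex.I))).cexp.const_mul _).congr_deriv ?_
  have e : ρ ^ (γ + δ - 1) = ρ ^ (γ - 1) * ρ ^ δ := by
    rw [← rpow_add hρ]
    congr 1; ring
  rw [e]
  push_cast
  have : ((γ : ℂ) + δ) * φ * Complex.I + s * ρ * Complex.exp (φ * Complex.I) -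
      τ * ((ρ ^ δ : ℝ) : ℂ) * Complex.exp (δ * φ * Complex.I) =
      (δ * φ * Complex.I) + ((γ : ℂ) * φ * Complex.I + s * ρ * Complex.exp (φ * Complex.I) -
      τ * ((ρ ^ δ : ℝ) : ℂ) * Complex.exp (δ * φ * Complex.I)) := by ring
  rw [this, Complex.exp_add (δ * φ * Complex.I)]
  ring

lemma hasDerivAt_rayInt_s (h1 : Real.cos φ < 0) (h2 : 0 < Real.cos (δ * φ)) (hγ : 0 < γ)
    (hτ : 0 ≤ τ) (hs : 0 < s) :
    HasDerivAt (fun s => rayInt δ φ γ τ s) (rayInt δ φ (γ + 1) τ s) s := by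
  refine (hasDerivAt_integral_of_dominated_loc_of_deriv_le
    (μ := volume.restrict (Ioi (0 : ℝ))) (𝕜 := ℝ)
    (F := fun s ρ => rayKer δ φ γ τ s ρ) (F' := fun s ρ => rayKer δ φ (γ + 1) τ s ρ)
    (s := Ioi (s / 2)) (Ioi_mem_nhds (by linarith)) ?_ ?_ ?_ ?_
    (integrable_bound_s (γ := γ + 1) (s := s / 2) h1 (by linarith) (by linarith)) ?_).2
  · exact Eventually.of_forall fun _ => aesm_rayKer ..
  · exact integrable_rayKer_of_s h1 h2 hγ hs hτ
  · exact aesm_rayKer ..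
  · exact (ae_restrict_iff' measurableSet_Ioi).2 (Eventually.of_forall fun x hx s' hs' =>
      norm_rayKer_le_of_s h1 h2 (le_of_lt hs') hτ hx)
  · exact (ae_restrict_iff' measurableSet_Ioi).2 (Eventually.of_forall fun x hx s' hs' =>
      hasDerivAt_rayKer_s hx)

lemma hasDerivAt_rayInt_tau (hδ : 0 < δ) (h1 : Real.cos φ < 0) (h2 : 0 < Real.cos (δ * φ))
    (hγ : 0 < γ) (hτ : 0 < τ) (hs : 0 ≤ s) :
    HasDerivAt (fun τ => rayInt δ φ γ τ s) (-rayInt δ φ (γ + δ) τ s) τ := by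
  have key := (hasDerivAt_integral_of_dominated_loc_of_deriv_le
    (μ := volume.restrict (Ioi (0 : ℝ))) (𝕜 := ℝ)
    (F := fun τ ρ => rayKer δ φ γ τ s ρ) (F' := fun τ ρ => -rayKer δ φ (γ + δ) τ s ρ)
    (s := Ioi (τ / 2)) (x₀ := τ) (Ioi_mem_nhds (by linarith)) ?_ ?_ ?_ ?_
    (integrable_bound_tau (γ := γ + δ) (τ := τ / 2) hδ h2 (by linarith) (by linarith)) ?_).2
  · rwa [integral_neg] at key
  · exact Eventually.of_forall fun _ => aesm_rayKer ..
  · exact integrable_rayKer_of_tau hδ h1 h2 hγ hs hτ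
  · exact (aesm_rayKer ..).fun_neg
  · refine (ae_restrict_iff' measurableSet_Ioi).2 (Eventually.of_forall fun x hx s' hs' => ?_)
    rw [norm_neg]
    exact norm_rayKer_le_of_tau h1 h2 (le_of_lt hs') hs hx
  · exact (ae_restrict_iff' measurableSet_Ioi).2 (Eventually.of_forall fun x hx s' hs' =>
      hasDerivAt_rayKer_tau hx)

lemma continuousOn_rayInt_s (hδ : 0 < δ) (h1 : Real.cos φ < 0) (h2 : 0 < Real.cos (δ * φ))
    (hγ : 0 < γ) (hτ : 0 < τ) : ContinuousOn (fun s => rayInt δ φ γ τ s) (Ici 0) := by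
  refine continuousOn_of_dominated (fun _ _ => aesm_rayKer ..) (fun s' hs' =>
    (ae_restrict_iff' measurableSet_Ioi).2 (Eventually.of_forall fun x hx =>
      norm_rayKer_le_of_tau h1 h2 le_rfl hs' hx)) (integrable_bound_tau hδ h2 hγ hτ) ?_
  refine Eventually.of_forall fun x => ?_
  unfold rayKer
  fun_prop

lemma rayKer_scale {ρ : ℝ} (hs : 0 < s) (hρ : 0 < ρ) :
    rayKer δ φ γ τ s ρ =
      ((s ^ (1 - γ) : ℝ) : ℂ) * rayKer δ φ γ (τ / s ^ δ) 1 (s * ρ) := by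
  have hsδ : s ^ δ ≠ 0 := (rpow_pos_of_pos hs δ).ne'
  have e1 : ρ ^ (γ - 1) = s ^ (1 - γ) * (s * ρ) ^ (γ - 1) := by
    rw [mul_rpow hs.le hρ.le, ← mul_assoc, ← rpow_add hs]
    simp
  have e2 : τ * ρ ^ δ = τ / s ^ δ * (s * ρ) ^ δ := by
    rw [mul_rpow hs.le hρ.le]
    field_simp
  have e2' : (τ : ℂ) * ((ρ ^ δ : ℝ) : ℂ) = ((τ / s ^ δ : ℝ) : ℂ) * (((s * ρ) ^ δ : ℝ) : ℂ) := by
    exact_mod_cast e2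
  rw [rayKer, rayKer, e2', e1]
  push_cast
  rw [one_mul]
  ring

lemma rayInt_scale (hs : 0 < s) :
    rayInt δ φ γ τ s = ((s ^ (-γ) : ℝ) : ℂ) * rayInt δ φ γ (τ / s ^ δ) 1 := by
  unfold rayInt
  rw [setIntegral_congr_fun measurableSet_Ioi (fun ρ hρ => rayKer_scale hs hρ),
    integral_const_mul, integral_comp_mul_left_Ioi (fun ρ => rayKer δ φ γ (τ / s ^ δ) 1 ρ) 0 hs,
    mul_zero, Complex.real_smul, ← mul_assoc, ← Complex.ofReal_mul]
  congr 3
  rw [← rpow_neg_one, ← rpow_add hs]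
  congr 1
  ring

/-- Integrating the derivative of `exp (s * σ - τ * σ ^ δ)` along the ray. -/
lemma rayInt_ibp (hδ : 0 < δ) (h1 : Real.cos φ < 0) (h2 : 0 < Real.cos (δ * φ))
    (hτ : 0 < τ) (hs : 0 < s) :
    (s : ℂ) * rayInt δ φ 1 τ s - δ * τ * rayInt δ φ δ τ s = -1 := by
  have i1 := (integrable_rayKer_of_s (γ := 1) h1 h2 one_pos hs hτ.le).const_mul (s : ℂ)
  have i2 := (integrable_rayKer_of_s (γ := δ) h1 h2 hδ hs hτ.le).const_mul ((δ : ℂ) * τ)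
  unfold rayInt
  rw [← integral_const_mul, ← integral_const_mul, ← integral_sub i1 i2]
  have hc : Continuous (fun ρ : ℝ => ρ ^ δ) := continuous_id.rpow_const (fun _ => Or.inr hδ.le)
  refine (integral_Ioi_of_hasDerivAt_of_tendsto (a := (0 : ℝ)) (m := (0 : ℂ))
    (f := fun ρ : ℝ => Complex.exp (s * ρ * Complex.exp (φ * Complex.I) -
      τ * ((ρ ^ δ : ℝ) : ℂ) * Complex.exp ((δ * φ : ℝ) * Complex.I)))
    (f' := fun ρ => (s : ℂ) * rayKer δ φ 1 τ s ρ - δ * τ * rayKer δ φ δ τ s ρ)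
    ?_ ?_ (i1.sub i2) ?_).trans ?_
  · refine ContinuousAt.continuousWithinAt ?_
    fun_prop
  · intro ρ hρ
    have hρ0 : ρ ≠ 0 := ne_of_gt hρ
    have d1 : HasDerivAt (fun s : ℝ => (s : ℂ)) 1 ρ := Complex.ofRealCLM.hasDerivAt
    have d2 : HasDerivAt (fun ρ : ℝ => ((ρ ^ δ : ℝ) : ℂ)) ((δ * ρ ^ (δ - 1) : ℝ) : ℂ) ρ :=
      (Real.hasDerivAt_rpow_const (Or.inl hρ0)).ofReal_comp
    refine ((((d1.const_mul (s : ℂ)).mul_const (Complex.exp (φ * Complex.I))).sub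
      ((d2.const_mul (τ : ℂ)).mul_const (Complex.exp ((δ * φ : ℝ) * Complex.I)))).cexp).congr_deriv ?_
    simp only [rayKer, Pi.sub_apply, Complex.exp_sub, Complex.exp_add]
    push_cast
    simp
    ring
  · have h0 : Tendsto (fun ρ : ℝ => Real.exp (-((s * -Real.cos φ) * ρ))) atTop (nhds 0) :=
      Real.tendsto_exp_neg_atTop_nhds_zero.comp
        (tendsto_id.const_mul_atTop (mul_pos hs (by linarith)))
    refine squeeze_zero_norm' ?_ h0
    filter_upwards [eventually_gt_atTop 0] with ρ hρ
    have := norm_rayKer_le_of_s (δ := δ) (γ := 1) (s := s) (τ := τ) h1 h2 le_rfl hτ.le hρ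
    simp only [rayKer, sub_self, rpow_zero, rpow_one, one_mul, Complex.ofReal_one] at this
    rw [add_sub_assoc, Complex.exp_add, norm_mul,
      Complex.norm_exp_ofReal_mul_I, one_mul] at this
    simpa only [neg_mul] using this
  · simp [zero_rpow hδ.ne']

end Ray

/-- The argument of the rays used to represent the Wright density of order `δ`. -/
noncomputable def ang (δ : ℝ) : ℝ := π / (1 + δ)

lemma cos_ang_neg {δ : ℝ} (hδ : 0 < δ) (hδ1 : δ < 1) : Real.cos (ang δ) < 0 := by
  have hp := Real.pi_pos
  refine Real.cos_neg_of_pi_div_two_lt_of_lt ?_ ?_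
  · unfold ang
    exact div_lt_div_of_pos_left hp (by linarith) (by linarith)
  · have : ang δ < π := div_lt_self hp (by linarith)
    linarith

lemma mul_ang_pos {δ : ℝ} (hδ : 0 < δ) : 0 < δ * ang δ := by
  have hp := Real.pi_pos
  unfold ang
  positivity

lemma mul_ang_lt {δ : ℝ} (hδ : 0 < δ) (hδ1 : δ < 1) : δ * ang δ < π / 2 := by
  have hp := Real.pi_pos
  unfold ang
  rw [mul_div_assoc', div_lt_div_iff₀ (by linarith) (by norm_num)]
  nlinarith

lemma abs_ang_sub_pi_lt {δ : ℝ} (hδ : 0 < δ) (hδ1 : δ < 1) : |ang δ - π| < π / 2 := by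
  have hp := Real.pi_pos
  have h1 : π / 2 < ang δ := div_lt_div_of_pos_left hp (by linarith) (by linarith)
  have h2 : ang δ < π := div_lt_self hp (by linarith)
  rw [abs_lt]
  constructor <;> linarith

lemma cos_mul_ang_pos {δ : ℝ} (hδ : 0 < δ) (hδ1 : δ < 1) : 0 < Real.cos (δ * ang δ) :=
  Real.cos_pos_of_mem_Ioo ⟨by have := mul_ang_pos hδ; linarith [Real.pi_pos], mul_ang_lt hδ hδ1⟩

/-- The function whose Laplace transform in `s` is `p ^ (γ - 1) * exp (-τ * p ^ δ)`. -/
noncomputable def W (δ γ τ s : ℝ) : ℝ :=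
  if 0 < s then (rayInt δ (ang δ) γ τ s).im / π else 0

lemma W_of_pos {δ γ τ s : ℝ} (hs : 0 < s) : W δ γ τ s = (rayInt δ (ang δ) γ τ s).im / π :=
  if_pos hs

lemma W_of_nonpos {δ γ τ s : ℝ} (hs : s ≤ 0) : W δ γ τ s = 0 := if_neg hs.not_gt

lemma measurable_W (δ γ : ℝ) : Measurable (fun p : ℝ × ℝ => W δ γ p.1 p.2) := by
  unfold W
  refine Measurable.ite (measurableSet_lt measurable_const measurable_snd) ?_ measurable_const
  exact (Complex.measurable_im.comp (measurable_rayInt δ (ang δ) γ)).div_const π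

section
variable {δ γ τ s : ℝ} (hδ : 0 < δ) (hδ1 : δ < 1)
include hδ hδ1

lemma rayInt_zero_im (hγ : 0 < γ) (hτ : 0 < τ) : (rayInt δ (ang δ) γ τ 0).im = 0 := by
  set φ := ang δ
  have h := integral_cpow_mul_cexp_polar (a := ((γ / δ : ℝ) : ℂ)) (b := τ) (φ := δ * φ)
    (by simpa using div_pos hγ hδ) hτ (by rw [abs_of_pos (mul_ang_pos hδ)]; exact mul_ang_lt hδ hδ1)
  rw [← integral_comp_rpow_Ioi_of_pos hδ] at h
  have e : rayInt δ φ γ τ 0 = Complex.exp (γ * φ * Complex.I) * (1 / (δ : ℂ)) *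
      ∫ x in Ioi (0:ℝ), (δ * x ^ (δ - 1)) • (((x ^ δ : ℝ) : ℂ) ^ (((γ / δ : ℝ) : ℂ) - 1) *
        Complex.exp (-(τ * Complex.exp ((δ * φ : ℝ) * Complex.I) * ((x ^ δ : ℝ) : ℂ)))) := by
    unfold rayInt
    rw [← integral_const_mul]
    refine setIntegral_congr_fun measurableSet_Ioi fun x hx => ?_
    have hx0 : (0:ℝ) < x := hx
    have hδc : (δ : ℂ) ≠ 0 := by exact_mod_cast hδ.ne'
    have e1 : (((x ^ δ : ℝ) : ℂ) ^ (((γ / δ : ℝ) : ℂ) - 1)) = ((x ^ (γ - δ) : ℝ) : ℂ) := by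
      rw [show (((γ / δ : ℝ) : ℂ) - 1) = ((γ / δ - 1 : ℝ) : ℂ) by push_cast; ring,
        ← Complex.ofReal_cpow (rpow_nonneg hx0.le _), ← rpow_mul hx0.le]
      congr 2
      field_simp
    have e2 : x ^ (γ - 1) = x ^ (δ - 1) * x ^ (γ - δ) := by
      rw [← rpow_add hx0]; congr 1; ring
    simp only [rayKer]
    rw [e1, e2, Complex.real_smul, Complex.exp_sub, Complex.exp_add, Complex.exp_neg]
    push_cast
    simp only [zero_mul, Complex.exp_zero]
    field_simp
  rw [e, h]
  have e3 : (τ : ℂ) ^ (-((γ / δ : ℝ) : ℂ)) = ((τ ^ (-(γ / δ)) : ℝ) : ℂ) := by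
    rw [← Complex.ofReal_neg, ← Complex.ofReal_cpow hτ.le]
  have e4 : Complex.exp (γ * φ * Complex.I) *
      Complex.exp (-(((γ / δ : ℝ) : ℂ) * ((δ * φ : ℝ) : ℂ) * Complex.I)) = 1 := by
    rw [← Complex.exp_add]
    have hδc : (δ : ℂ) ≠ 0 := by exact_mod_cast hδ.ne'
    push_cast
    rw [show (γ : ℂ) * φ * Complex.I + -((γ / δ : ℂ) * (δ * φ) * Complex.I) = 0 by
      field_simp; ring]
    exact Complex.exp_zero
  rw [e3, Complex.Gamma_ofReal]
  have : Complex.exp (γ * φ * Complex.I) * (1 / (δ : ℂ)) *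
      (Complex.exp (-(((γ / δ : ℝ) : ℂ) * ((δ * φ : ℝ) : ℂ) * Complex.I)) *
        ((τ ^ (-(γ / δ)) : ℝ) : ℂ) * ((Real.Gamma (γ / δ) : ℝ) : ℂ)) =
      ((1 / δ * τ ^ (-(γ / δ)) * Real.Gamma (γ / δ) : ℝ) : ℂ) := by
    rw [show ∀ a b c d e : ℂ, a * b * (c * d * e) = (a * c) * (b * d * e) by intros; ring, e4]
    push_cast
    ring
  rw [this, Complex.ofReal_im]

lemma hasDerivAt_W_of_pos (hγ : 0 < γ) (hτ : 0 ≤ τ) (hs : 0 < s) :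
    HasDerivAt (W δ γ τ) (W δ (γ + 1) τ s) s := by
  have h := hasDerivAt_rayInt_s (cos_ang_neg hδ hδ1) (cos_mul_ang_pos hδ hδ1) hγ hτ hs
  have h2 := (Complex.imCLM.hasFDerivAt.comp_hasDerivAt s h).div_const π
  rw [W_of_pos hs]
  refine h2.congr_of_eventuallyEq ?_
  filter_upwards [Ioi_mem_nhds hs] with x hx
  exact W_of_pos hx

lemma hasDerivAt_W_tau (hγ : 0 < γ) (hτ : 0 < τ) :
    HasDerivAt (fun τ => W δ γ τ s) (-W δ (γ + δ) τ s) τ := by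
  by_cases hs : 0 < s
  · have h := hasDerivAt_rayInt_tau hδ (cos_ang_neg hδ hδ1) (cos_mul_ang_pos hδ hδ1) hγ hτ hs.le
    have h2 := (Complex.imCLM.hasFDerivAt.comp_hasDerivAt τ h).div_const π
    simp only [W_of_pos hs]
    exact h2.congr_deriv (by simp [neg_div])
  · simp only [W_of_nonpos (not_lt.1 hs), neg_zero]
    exact hasDerivAt_const _ _

lemma exists_abs_W_le_s (hγ : 0 < γ) :
    ∃ C, 0 ≤ C ∧ ∀ τ s : ℝ, 0 ≤ τ → 0 < s → |W δ γ τ s| ≤ C * s ^ (-γ) := by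
  obtain ⟨C, hC, h⟩ := exists_norm_rayInt_le_of_s (cos_ang_neg hδ hδ1) (cos_mul_ang_pos hδ hδ1) hγ
  refine ⟨C / π, by have := Real.pi_pos; positivity, fun τ s hτ hs => ?_⟩
  rw [W_of_pos hs, abs_div, abs_of_pos Real.pi_pos, div_mul_eq_mul_div]
  have := Real.pi_pos
  gcongr
  exact (Complex.abs_im_le_norm _).trans (h τ s hτ hs)

lemma exists_abs_im_rayInt_le_nat (N : ℕ) : ∀ γ : ℝ, 0 < γ →
    ∃ C, 0 ≤ C ∧ ∀ τ s : ℝ, 0 < τ → 0 ≤ s →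
      |(rayInt δ (ang δ) γ τ s).im| ≤ C * s ^ N * τ ^ (-(γ + N) / δ) := by
  induction N with
  | zero =>
    intro γ hγ
    obtain ⟨C, hC, h⟩ := exists_norm_rayInt_le_of_tau hδ (cos_ang_neg hδ hδ1)
      (cos_mul_ang_pos hδ hδ1) hγ
    refine ⟨C, hC, fun τ s hτ hs => ?_⟩
    simpa using (Complex.abs_im_le_norm _).trans (h τ s hτ hs)
  | succ N ih =>
    intro γ hγ
    obtain ⟨C, hC, h⟩ := ih (γ + 1) (by linarith)
    refine ⟨C, hC, fun τ s hτ hs => ?_⟩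
    have hc := continuousOn_rayInt_s hδ (cos_ang_neg hδ hδ1) (cos_mul_ang_pos hδ hδ1) hγ hτ
    rcases hs.eq_or_lt with rfl | hs
    · rw [rayInt_zero_im hδ hδ1 hγ hτ]
      simp
    obtain ⟨ξ, hξ, e⟩ := exists_hasDerivAt_eq_slope (fun s => (rayInt δ (ang δ) γ τ s).im)
      (fun s => (rayInt δ (ang δ) (γ + 1) τ s).im) hs
      (Complex.continuous_im.comp_continuousOn (hc.mono Icc_subset_Ici_self))
      (fun x hx => Complex.imCLM.hasFDerivAt.comp_hasDerivAt x (hasDerivAt_rayInt_s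
        (cos_ang_neg hδ hδ1) (cos_mul_ang_pos hδ hδ1) hγ hτ.le hx.1))
    rw [rayInt_zero_im hδ hδ1 hγ hτ, sub_zero, sub_zero, eq_div_iff hs.ne'] at e
    rw [← e, abs_mul, abs_of_pos hs]
    have h3 := h τ ξ hτ hξ.1.le
    have h4 : C * ξ ^ N * τ ^ (-(γ + 1 + N) / δ) ≤ C * s ^ N * τ ^ (-(γ + 1 + N) / δ) := by
      have := hξ.1.le
      have := hξ.2.le
      gcongr
    calc _ ≤ C * s ^ N * τ ^ (-(γ + 1 + N) / δ) * s := by gcongr; exact h3.trans h4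
      _ = _ := by
        rw [show -(γ + 1 + (N : ℝ)) = -(γ + ((N + 1 : ℕ) : ℝ)) by push_cast; ring]
        ring

lemma exists_abs_W_le (hγ : 0 < γ) {K : ℝ} (hK : 0 ≤ K) :
    ∃ C, 0 ≤ C ∧ ∀ τ s : ℝ, 0 < τ → 0 < s → |W δ γ τ s| ≤ C * s ^ (δ * K - γ) * τ ^ (-K) := by
  obtain ⟨C₁, hC₁, h₁⟩ := exists_abs_W_le_s hδ hδ1 hγ
  obtain ⟨N, hN⟩ := exists_nat_ge (δ * K)
  obtain ⟨C₂, hC₂, h₂⟩ := exists_abs_im_rayInt_le_nat hδ hδ1 N γ hγ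
  refine ⟨C₁ + C₂, by positivity, fun τ s hτ hs => ?_⟩
  have e : ∀ L : ℝ, (τ / s ^ δ) ^ (-L) = s ^ (δ * L) * τ ^ (-L) := by
    intro L
    rw [div_rpow hτ.le (rpow_nonneg hs.le _), ← rpow_mul hs.le, div_eq_mul_inv, ← rpow_neg hs.le]
    rw [mul_comm]; congr 2; ring
  have hy : 0 < τ / s ^ δ := by positivity
  have e0 : (C₁ + C₂) * s ^ (δ * K - γ) * τ ^ (-K) =
      (C₁ + C₂) * s ^ (-γ) * (τ / s ^ δ) ^ (-K) := by
    rw [e, sub_eq_add_neg, rpow_add hs]; ring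
  rw [e0]
  rcases le_total (τ / s ^ δ) 1 with hy1 | hy1
  · have h3 : 1 ≤ (τ / s ^ δ) ^ (-K) := one_le_rpow_of_pos_of_le_one_of_nonpos hy hy1 (by linarith)
    have hp : 0 ≤ (C₁ + C₂) * s ^ (-γ) := by positivity
    calc _ ≤ C₁ * s ^ (-γ) := h₁ τ s hτ.le hs
      _ ≤ (C₁ + C₂) * s ^ (-γ) := by
        have := rpow_nonneg hs.le (-γ); nlinarith
      _ ≤ _ := le_mul_of_one_le_right hp h3
  · have hle : K ≤ (γ + N) / δ := by
      rw [le_div_iff₀ hδ]; linarith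
    have h3 : (τ / s ^ δ) ^ (-((γ + N) / δ)) ≤ (τ / s ^ δ) ^ (-K) :=
      rpow_le_rpow_of_exponent_le hy1 (by linarith)
    have h4 := h₂ τ s hτ hs.le
    have e5 : C₂ * s ^ N * τ ^ (-(γ + N) / δ) =
        C₂ * s ^ (-γ) * (τ / s ^ δ) ^ (-((γ + N) / δ)) := by
      rw [e, mul_div_cancel₀ _ hδ.ne', rpow_add hs, rpow_natCast, ← neg_div]
      have : s ^ (-γ) * s ^ γ = 1 := by rw [← rpow_add hs]; simp
      linear_combination (-C₂ * s ^ N * τ ^ (-(γ + N) / δ)) * this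
    rw [W_of_pos hs, abs_div, abs_of_pos Real.pi_pos]
    calc _ ≤ |(rayInt δ (ang δ) γ τ s).im| :=
          div_le_self (abs_nonneg _) (by linarith [Real.two_le_pi])
      _ ≤ C₂ * s ^ (-γ) * (τ / s ^ δ) ^ (-((γ + N) / δ)) := h4.trans e5.le
      _ ≤ (C₁ + C₂) * s ^ (-γ) * (τ / s ^ δ) ^ (-K) := by
        gcongr
        linarith

lemma W_one_eq (hτ : 0 < τ) (hs : 0 < s) : W δ 1 τ s = δ * τ / s * W δ δ τ s := by
  have h := congrArg Complex.im
    (rayInt_ibp hδ (cos_ang_neg hδ hδ1) (cos_mul_ang_pos hδ hδ1) hτ hs)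
  rw [Complex.sub_im, ← Complex.ofReal_mul, Complex.im_ofReal_mul, Complex.im_ofReal_mul] at h
  simp only [Complex.neg_im, Complex.one_im, neg_zero] at h
  rw [W_of_pos hs, W_of_pos hs]
  have := Real.pi_pos
  field_simp
  linarith

lemma exists_abs_W_one_le {K : ℝ} (hK : -1 ≤ K) :
    ∃ C, 0 ≤ C ∧ ∀ τ s : ℝ, 0 < τ → 0 < s → |W δ 1 τ s| ≤ C * s ^ (δ * K - 1) * τ ^ (-K) := by
  obtain ⟨C, hC, h⟩ := exists_abs_W_le hδ hδ1 hδ (K := K + 1) (by linarith)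
  refine ⟨δ * C, by positivity, fun τ s hτ hs => ?_⟩
  rw [W_one_eq hδ hδ1 hτ hs, abs_mul, abs_of_pos (by positivity)]
  calc _ ≤ δ * τ / s * (C * s ^ (δ * (K + 1) - δ) * τ ^ (-(K + 1))) := by
        gcongr; exact h τ s hτ hs
    _ = _ := by
      rw [show δ * (K + 1) - δ = (δ * K - 1) + 1 by ring, rpow_add hs, rpow_one,
        show -(K + 1) = -K - 1 by ring, rpow_sub hτ, rpow_one]
      field_simp

omit hδ1 in
lemma W_scale (hτ : 0 < τ) :
    W δ γ τ s = (τ ^ (-1 / δ)) ^ γ * W δ γ 1 (τ ^ (-1 / δ) * s) := by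
  have hc : 0 < τ ^ (-1 / δ) := rpow_pos_of_pos hτ _
  rcases le_or_gt s 0 with hs | hs
  · rw [W_of_nonpos hs, W_of_nonpos (mul_nonpos_of_nonneg_of_nonpos hc.le hs), mul_zero]
  rw [W_of_pos hs, W_of_pos (mul_pos hc hs), rayInt_scale hs, rayInt_scale (mul_pos hc hs),
    Complex.im_ofReal_mul, Complex.im_ofReal_mul]
  have e : 1 / (τ ^ (-1 / δ) * s) ^ δ = τ / s ^ δ := by
    rw [mul_rpow hc.le hs.le, ← rpow_mul hτ.le, div_mul_cancel₀ _ hδ.ne', rpow_neg_one]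
    field_simp
  rw [e, mul_rpow hc.le hs.le]
  have : (τ ^ (-1 / δ)) ^ γ * (τ ^ (-1 / δ)) ^ (-γ) = 1 := by
    rw [← rpow_add hc]; simp
  linear_combination (-(s ^ (-γ) * (rayInt δ (ang δ) γ (τ / s ^ δ) 1).im / π)) * this

lemma hasDerivAt_W (hγ : 0 < γ) (hτ : 0 < τ) : HasDerivAt (W δ γ τ) (W δ (γ + 1) τ s) s := by
  rcases lt_trichotomy s 0 with hs | rfl | hs
  · rw [W_of_nonpos hs.le]
    refine (hasDerivAt_const s (0 : ℝ)).congr_of_eventuallyEq ?_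
    filter_upwards [Iio_mem_nhds hs] with x hx
    exact W_of_nonpos (le_of_lt hx)
  · obtain ⟨C, hC, h⟩ := exists_abs_W_le hδ hδ1 hγ (K := (γ + 2) / δ) (by positivity)
    rw [W_of_nonpos le_rfl, hasDerivAt_iff_isLittleO]
    simp only [sub_zero, W_of_nonpos (le_refl (0 : ℝ)), smul_zero]
    refine Asymptotics.IsBigO.trans_isLittleO (g := fun x : ℝ => x ^ 2) ?_ ?_
    · refine Asymptotics.IsBigO.of_bound (C * τ ^ (-((γ + 2) / δ))) (Eventually.of_forall fun x => ?_)
      rcases le_or_gt x 0 with hx | hx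
      · rw [W_of_nonpos hx]
        simp only [norm_zero]
        positivity
      · have := h τ x hτ hx
        rw [mul_div_cancel₀ _ hδ.ne', show γ + 2 - γ = ((2 : ℕ) : ℝ) by push_cast; ring,
          rpow_natCast] at this
        rw [Real.norm_eq_abs, Real.norm_of_nonneg (by positivity)]
        linarith
    · simpa using Asymptotics.isLittleO_pow_pow (𝕜 := ℝ) (one_lt_two)
  · exact hasDerivAt_W_of_pos hδ hδ1 hγ hτ.le hs

end

/-- The inverse-Gamma integral along a rotated ray. -/
lemma integral_ray_pow {φ : ℝ} (hφ : |φ - π| < π / 2) {w : ℂ} (hw : 0 < w.re) {s : ℝ}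
    (hs : 0 < s) :
    ∫ ρ in Ioi (0 : ℝ), (ρ : ℂ) ^ (w - 1) * Complex.exp (w * φ * Complex.I +
      s * ρ * Complex.exp (φ * Complex.I)) =
      Complex.exp (w * π * Complex.I) * (s : ℂ) ^ (-w) * Complex.Gamma w := by
  have h := integral_cpow_mul_cexp_polar hw hs hφ
  have e : ∀ ρ : ℝ, (ρ : ℂ) ^ (w - 1) * Complex.exp (w * φ * Complex.I +
      s * ρ * Complex.exp (φ * Complex.I)) = Complex.exp (w * φ * Complex.I) *
      ((ρ : ℂ) ^ (w - 1) *
        Complex.exp (-(s * Complex.exp (((φ - π : ℝ) : ℂ) * Complex.I) * ρ))) := by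
    intro ρ
    have : Complex.exp (((φ - π : ℝ) : ℂ) * Complex.I) = -Complex.exp (φ * Complex.I) := by
      push_cast
      rw [sub_mul, Complex.exp_sub, Complex.exp_pi_mul_I]
      ring
    rw [this, Complex.exp_add]
    ring_nf
  simp_rw [e]
  rw [integral_const_mul, h, ← mul_assoc, ← mul_assoc, ← Complex.exp_add]
  congr 3
  push_cast
  ring_nf

lemma exists_rpow_le_add {δ c : ℝ} (hδ : 0 < δ) (hδ1 : δ < 1) (hc : 0 < c) :
    ∃ M : ℝ, ∀ ρ : ℝ, 0 < ρ → ρ ^ δ ≤ M + c * ρ := by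
  set L : ℝ := c ^ (1 / (δ - 1))
  have hL : 0 < L := rpow_pos_of_pos hc _
  have hLc : L ^ (δ - 1) = c := by
    rw [← rpow_mul hc.le, one_div_mul_cancel (by linarith), rpow_one]
  refine ⟨L ^ δ, fun ρ hρ => ?_⟩
  rcases le_total ρ L with h | h
  · have := rpow_le_rpow hρ.le h hδ.le
    nlinarith [mul_pos hc hρ]
  · have h2 := rpow_le_rpow_of_nonpos hL h (by linarith : δ - 1 ≤ 0)
    rw [hLc] at h2
    have h3 : ρ ^ δ = ρ ^ (δ - 1) * ρ := by
      rw [← rpow_add_one hρ.ne']; congr 1; ring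
    have := rpow_nonneg hL.le δ
    rw [h3]
    nlinarith

lemma Gamma_mul_sin_div_pi {x : ℝ} (hx : 0 < x) :
    Real.Gamma x * Real.sin (π * x) / π = 1 / Real.Gamma (1 - x) := by
  have h := Real.Gamma_mul_Gamma_one_sub x
  have hG := Real.Gamma_pos_of_pos hx
  have hp := Real.pi_pos
  by_cases hs : Real.sin (π * x) = 0
  · rw [hs, div_zero] at h
    rw [(mul_eq_zero.1 h).resolve_left hG.ne', hs]
    simp
  · have h2 : Real.Gamma (1 - x) ≠ 0 := by
      intro h0
      rw [h0, mul_zero] at h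
      exact (div_ne_zero hp.ne' hs) h.symm
    rw [eq_div_iff hs] at h
    rw [div_eq_div_iff hp.ne' h2]
    linarith

lemma W_eq_Mwr {δ y : ℝ} (hδ : 0 < δ) (hδ1 : δ < 1) (hy : 0 ≤ y) : W δ δ y 1 = Mwr y δ := by
  set φ := ang δ with hφ
  set c := -Real.cos φ with hc
  have hc0 : 0 < c := by have := cos_ang_neg hδ hδ1; linarith
  let F : ℕ → ℝ → ℂ := fun n ρ => (((-y) ^ n / n.factorial : ℝ) : ℂ) *
    ((ρ : ℂ) ^ (((δ * (n + 1) : ℝ) : ℂ) - 1) *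
      Complex.exp (((δ * (n + 1) : ℝ) : ℂ) * φ * Complex.I +
      (1 : ℝ) * ρ * Complex.exp (φ * Complex.I)))
  let bound : ℕ → ℝ → ℝ := fun n ρ =>
    ρ ^ (δ - 1) * Real.exp (-c * ρ) * ((y * ρ ^ δ) ^ n / n.factorial)
  have hFm : ∀ n, AEStronglyMeasurable (F n) (volume.restrict (Ioi 0)) := by
    intro n
    have : Measurable (F n) := by
      unfold F
      fun_prop
    exact this.aestronglyMeasurable
  have hxn : ∀ (n : ℕ) (x : ℝ), 0 < x → (x : ℂ) ^ (((δ * (n + 1) : ℝ) : ℂ) - 1) =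
      ((x ^ (δ - 1) * (x ^ δ) ^ n : ℝ) : ℂ) := by
    intro n x hx
    rw [← Complex.ofReal_one, ← Complex.ofReal_sub, ← Complex.ofReal_cpow hx.le, ← rpow_natCast,
      ← rpow_mul hx.le, ← rpow_add hx]
    congr 2; ring
  have hbd : ∀ n, ∀ᵐ x ∂(volume.restrict (Ioi (0:ℝ))), ‖F n x‖ ≤ bound n x := by
    intro n
    refine (ae_restrict_iff' measurableSet_Ioi).2 (Eventually.of_forall fun x hx => ?_)
    have hx0 : (0:ℝ) < x := hx
    have := rpow_nonneg hx0.le δ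
    have := rpow_nonneg hx0.le (δ - 1)
    simp only [F, bound]
    rw [hxn n x hx0, norm_mul, norm_mul, Complex.norm_real, Complex.norm_real, Complex.norm_exp,
      Real.norm_eq_abs, Real.norm_of_nonneg (by positivity), abs_div, abs_pow, abs_neg,
      abs_of_nonneg hy, Nat.abs_cast, mul_pow]
    have e : (((δ * (n + 1) : ℝ) : ℂ) * φ * Complex.I +
      (1 : ℝ) * x * Complex.exp (φ * Complex.I)).re = -c * x := by
      rw [Complex.add_re, ← Complex.ofReal_mul, ← Complex.ofReal_mul, Complex.re_ofReal_mul,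
        Complex.re_ofReal_mul, Complex.exp_ofReal_mul_I_re, Complex.I_re]
      simp [hc]; ring
    rw [e]
    apply le_of_eq; ring
  have hsum : ∀ x : ℝ, HasSum (fun n => bound n x)
      (x ^ (δ - 1) * Real.exp (-c * x) * Real.exp (y * x ^ δ)) := by
    intro x
    refine HasSum.mul_left _ ?_
    rw [Real.exp_eq_exp_ℝ]
    exact NormedSpace.expSeries_div_hasSum_exp (y * x ^ δ)
  have hinteg : Integrable (fun x => ∑' n, bound n x) (volume.restrict (Ioi 0)) := by
    simp_rw [fun x => (hsum x).tsum_eq]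
    obtain ⟨M, hM⟩ := exists_rpow_le_add (c := c / (2 * (y + 1))) hδ hδ1 (by positivity)
    have h0 := (integrableOn_rpow_mul_exp_neg_mul_rpow (p := 1) (s := δ - 1) (b := c / 2)
      (by linarith) one_pos (by positivity)).const_mul (Real.exp (y * M))
    refine h0.mono' (by fun_prop)
      ((ae_restrict_iff' measurableSet_Ioi).2 (Eventually.of_forall fun x hx => ?_))
    have hx0 : (0:ℝ) < x := hx
    rw [Real.norm_of_nonneg (by positivity), rpow_one, mul_assoc, ← Real.exp_add,
      mul_left_comm, ← Real.exp_add]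
    refine mul_le_mul_of_nonneg_left (Real.exp_le_exp.2 ?_) (rpow_nonneg hx0.le _)
    have h1 := mul_le_mul_of_nonneg_left (hM x hx0) hy
    have h2 : y * (c / (2 * (y + 1)) * x) ≤ c / 2 * x := by
      have : y * (c / (2 * (y + 1)) * x) = (c / 2 * x) * (y / (y + 1)) := by field_simp
      rw [this]
      exact mul_le_of_le_one_right (by positivity) (by rw [div_le_one (by linarith)]; linarith)
    linarith
  have hlim : ∀ᵐ x ∂(volume.restrict (Ioi (0:ℝ))), HasSum (fun n => F n x) (rayKer δ φ δ y 1 x) := by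
    refine (ae_restrict_iff' measurableSet_Ioi).2 (Eventually.of_forall fun x hx => ?_)
    have hx0 : (0:ℝ) < x := hx
    simp only [F, rayKer]
    have h := (NormedSpace.expSeries_div_hasSum_exp
      (-(y * ((x ^ δ : ℝ) : ℂ) * Complex.exp ((δ * φ : ℝ) * Complex.I)))).mul_left
      (((x ^ (δ - 1) : ℝ) : ℂ) * Complex.exp (δ * φ * Complex.I +
        (1 : ℝ) * x * Complex.exp (φ * Complex.I)))
    rw [← Complex.exp_eq_exp_ℂ, mul_assoc (((x ^ (δ - 1) : ℝ) : ℂ)) _ (Complex.exp (-_)),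
      ← Complex.exp_add, ← sub_eq_add_neg] at h
    refine (congrArg (fun f => HasSum f _) (funext fun n => ?_)).mpr h
    rw [hxn n x hx0, neg_pow y, neg_pow (_ * _), mul_pow, mul_pow, ← Complex.exp_nat_mul, Complex.exp_add,
      Complex.exp_add, show ((δ * (n + 1) : ℝ) : ℂ) * φ * Complex.I = δ * φ * Complex.I +
        n * (((δ * φ : ℝ) : ℂ) * Complex.I) by push_cast; ring, Complex.exp_add]
    push_cast
    ring
  have key := hasSum_integral_of_dominated_convergence bound hFm hbd
    (Eventually.of_forall fun x => (hsum x).summable) hinteg hlim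
  have key2 := (Complex.hasSum_im key).div_const π
  rw [W_of_pos one_pos, Mwr]
  refine (key2.tsum_eq.symm.trans (tsum_congr fun n => ?_))
  have hpos : 0 < δ * ((n : ℝ) + 1) := by positivity
  simp only [F]
  rw [integral_const_mul, integral_ray_pow (abs_ang_sub_pi_lt hδ hδ1) (by simpa using hpos) one_pos]
  rw [Complex.im_ofReal_mul, Complex.ofReal_one, Complex.one_cpow, mul_one, Complex.Gamma_ofReal,
    Complex.im_mul_ofReal, ← Complex.ofReal_mul, Complex.exp_ofReal_mul_I_im,
    show -δ * (n : ℝ) + 1 - δ = 1 - δ * ((n : ℝ) + 1) by ring]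
  have := Gamma_mul_sin_div_pi hpos
  rw [← div_div, div_eq_mul_one_div _ (Real.Gamma _), ← this]
  rw [mul_comm π]
  ring

lemma rpow_mul_exp_neg_le {a x : ℝ} (ha : 0 < a) (hx : 0 < x) :
    Real.exp (-x) ≤ a ^ a * x ^ (-a) := by
  have h1 : x / a ≤ Real.exp (x / a) := by linarith [Real.add_one_le_exp (x / a)]
  have h2 := rpow_le_rpow (by positivity) h1 ha.le
  rw [← Real.exp_mul, div_mul_cancel₀ _ ha.ne', div_rpow hx.le ha.le] at h2
  rw [Real.exp_neg, rpow_neg hx.le]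
  have h3 := rpow_pos_of_pos hx a
  have h4 := rpow_pos_of_pos ha a
  rw [div_le_iff₀ h4] at h2
  rw [← div_eq_mul_inv, inv_eq_one_div, div_le_div_iff₀ (Real.exp_pos x) h3]
  linarith

/-- Product integrability on the quadrant from two power bounds in the first variable. -/
lemma integrable_quadrant_of_le_rpow {F : ℝ × ℝ → ℂ} (hF : Measurable F) {K K₁ K₂ : ℝ}
    (h₁ : K₁ < K) (h₂ : K < K₂) {g₁ g₂ : ℝ → ℝ} (hg₁ : IntegrableOn g₁ (Ioi 0))
    (hg₂ : IntegrableOn g₂ (Ioi 0))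
    (hb₁ : ∀ x y : ℝ, 0 < x → 0 < y → ‖F (x, y)‖ ≤ x ^ (K - 1 - K₁) * g₁ y)
    (hb₂ : ∀ x y : ℝ, 0 < x → 0 < y → ‖F (x, y)‖ ≤ x ^ (K - 1 - K₂) * g₂ y) :
    Integrable F ((volume.restrict (Ioi 0)).prod (volume.restrict (Ioi 0))) := by
  have i1 : Integrable ((Ioc (0:ℝ) 1).indicator (fun x : ℝ => x ^ (K - 1 - K₁)))
      (volume.restrict (Ioi 0)) := by
    rw [integrable_indicator_iff measurableSet_Ioc, IntegrableOn,
      Measure.restrict_restrict measurableSet_Ioc,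
      inter_eq_left.2 (show Ioc (0:ℝ) 1 ⊆ Ioi 0 from fun x hx => hx.1)]
    exact (intervalIntegrable_iff_integrableOn_Ioc_of_le zero_le_one).1
      (intervalIntegral.intervalIntegrable_rpow' (by linarith))
  have i2 : Integrable ((Ioi (1:ℝ)).indicator (fun x : ℝ => x ^ (K - 1 - K₂)))
      (volume.restrict (Ioi 0)) := by
    rw [integrable_indicator_iff measurableSet_Ioi, IntegrableOn,
      Measure.restrict_restrict measurableSet_Ioi,
      inter_eq_left.2 (show Ioi (1:ℝ) ⊆ Ioi 0 from Ioi_subset_Ioi zero_le_one)]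
    exact integrableOn_Ioi_rpow_of_lt (by linarith) one_pos
  have i := (i1.mul_prod hg₁).add (i2.mul_prod hg₂)
  refine i.mono' hF.aestronglyMeasurable ?_
  rw [Measure.prod_restrict]
  refine (ae_restrict_iff' (measurableSet_Ioi.prod measurableSet_Ioi)).2
    (Eventually.of_forall fun p hp => ?_)
  obtain ⟨x, y⟩ := p
  have hx : (0:ℝ) < x := hp.1
  have hy : (0:ℝ) < y := hp.2
  rcases le_or_gt x 1 with h | h
  · simp only [Pi.add_apply, indicator_of_mem (show x ∈ Ioc (0:ℝ) 1 from ⟨hx, h⟩),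
      indicator_of_notMem (show x ∉ Ioi (1:ℝ) from not_lt.2 h), zero_mul, add_zero]
    exact hb₁ x y hx hy
  · simp only [Pi.add_apply, indicator_of_mem (show x ∈ Ioi (1:ℝ) from h),
      indicator_of_notMem (show x ∉ Ioc (0:ℝ) 1 from fun h' => absurd h'.2 (not_le.2 h)),
      zero_mul, zero_add]
    exact hb₂ x y hx hy

lemma ofReal_cpow_eq_exp {x : ℝ} (hx : 0 < x) (w : ℂ) :
    (x : ℂ) ^ w = Complex.exp (Real.log x * w) := by
  rw [Complex.cpow_def_of_ne_zero (by exact_mod_cast hx.ne'), Complex.ofReal_log hx.le]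

lemma ofReal_rpow_cpow {x : ℝ} (hx : 0 < x) (δ : ℝ) (w : ℂ) :
    ((x ^ δ : ℝ) : ℂ) ^ w = (x : ℂ) ^ (δ * w) := by
  rw [ofReal_cpow_eq_exp hx, ofReal_cpow_eq_exp (rpow_pos_of_pos hx δ), Real.log_rpow hx]
  push_cast
  ring_nf

section
variable {δ γ : ℝ} (hδ : 0 < δ) (hδ1 : δ < 1)
include hδ hδ1

lemma integrable_cpow_mul_rayKer {z : ℂ} (hz : 0 < z.re) (hzγ : δ * z.re < γ) {s : ℝ}
    (hs : 0 < s) :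
    Integrable (fun p : ℝ × ℝ => (p.1 : ℂ) ^ (z - 1) * rayKer δ (ang δ) γ p.1 s p.2)
      ((volume.restrict (Ioi 0)).prod (volume.restrict (Ioi 0))) := by
  set φ := ang δ with hφ
  have hc1 : 0 < -Real.cos φ := by have := cos_ang_neg hδ hδ1; linarith
  have hc2 : 0 < Real.cos (δ * φ) := cos_mul_ang_pos hδ hδ1
  have hγ : 0 < γ := (mul_pos hδ hz).trans hzγ
  obtain ⟨K₂, hK₂, hK₂'⟩ : ∃ K₂, z.re < K₂ ∧ δ * K₂ < γ := by
    obtain ⟨K₂, h1, h2⟩ := exists_between ((lt_div_iff₀' hδ).2 hzγ)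
    exact ⟨K₂, h1, (lt_div_iff₀' hδ).1 h2⟩
  have hK0 : 0 < K₂ := hz.trans hK₂
  have hnorm : ∀ x y : ℝ, 0 < x → 0 < y → ‖(x : ℂ) ^ (z - 1) * rayKer δ φ γ x s y‖ =
      x ^ (z.re - 1) * (y ^ (γ - 1) *
        Real.exp (s * y * Real.cos φ - x * y ^ δ * Real.cos (δ * φ))) := by
    intro x y hx hy
    rw [norm_mul, norm_rayKer hy, Complex.norm_cpow_eq_rpow_re_of_pos hx]
    simp
  refine integrable_quadrant_of_le_rpow (K := z.re) (K₁ := 0) (K₂ := K₂) ?_ hz hK₂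
    (integrableOn_rpow_mul_exp_neg_mul_rpow (s := γ - 1) (p := 1) (b := s * -Real.cos φ)
      (by linarith) one_pos (mul_pos hs hc1))
    ((integrableOn_rpow_mul_exp_neg_mul_rpow (s := γ - 1 - δ * K₂) (p := 1) (b := s * -Real.cos φ)
      (by linarith) one_pos (mul_pos hs hc1)).const_mul
        (K₂ ^ K₂ * (Real.cos (δ * φ)) ^ (-K₂))) ?_ ?_
  · unfold rayKer
    fun_prop
  · intro x y hx hy
    rw [hnorm x y hx hy, sub_zero, rpow_one]
    have : 0 ≤ x * y ^ δ * Real.cos (δ * φ) := by positivity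
    gcongr
    nlinarith
  · intro x y hx hy
    have hyδ := rpow_pos_of_pos hy δ
    have h3 := rpow_mul_exp_neg_le hK0 (x := x * y ^ δ * Real.cos (δ * φ)) (by positivity)
    rw [hnorm x y hx hy, rpow_one, sub_eq_add_neg (s * y * _), Real.exp_add, rpow_sub hx (z.re - 1) K₂,
      rpow_sub hy (γ - 1)]
    rw [mul_rpow (by positivity) hc2.le, mul_rpow hx.le hyδ.le, ← rpow_mul hy.le,
      mul_neg δ, rpow_neg hx.le, rpow_neg hy.le] at h3
    have e : s * y * Real.cos φ = -(s * -Real.cos φ) * y := by ring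
    rw [e]
    calc _ ≤ x ^ (z.re - 1) * (y ^ (γ - 1) * (Real.exp (-(s * -Real.cos φ) * y) *
          (K₂ ^ K₂ * ((x ^ K₂)⁻¹ * (y ^ (δ * K₂))⁻¹ * Real.cos (δ * φ) ^ (-K₂))))) := by
          gcongr
      _ = _ := by
          field_simp

lemma integral_cpow_mul_rayInt {z : ℂ} (hz : 0 < z.re) (hzγ : δ * z.re < γ) {s : ℝ} (hs : 0 < s) :
    ∫ τ in Ioi (0:ℝ), (τ : ℂ) ^ (z - 1) * rayInt δ (ang δ) γ τ s =
      Complex.Gamma z * (Complex.exp ((γ - δ * z) * π * Complex.I) * (s : ℂ) ^ (-(γ - δ * z)) *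
        Complex.Gamma (γ - δ * z)) := by
  have hw : 0 < ((γ : ℂ) - δ * z).re := by
    rw [Complex.sub_re, Complex.ofReal_re, Complex.re_ofReal_mul]; linarith
  have hI := integrable_cpow_mul_rayKer hδ hδ1 hz hzγ hs
  set φ := ang δ with hφ
  have hswap := integral_integral_swap (f := fun (τ ρ : ℝ) => (τ : ℂ) ^ (z - 1) * rayKer δ φ γ τ s ρ) hI
  unfold rayInt
  simp_rw [← integral_const_mul]
  rw [hswap]
  rw [← integral_ray_pow (abs_ang_sub_pi_lt hδ hδ1) hw hs, ← integral_const_mul]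
  refine setIntegral_congr_fun measurableSet_Ioi fun ρ hρ => ?_
  have hρ0 : (0:ℝ) < ρ := hρ
  have h := integral_cpow_mul_cexp_polar (a := z) (b := ρ ^ δ) (φ := δ * φ) hz
    (rpow_pos_of_pos hρ0 δ) (by rw [abs_of_pos (mul_ang_pos hδ)]; exact mul_ang_lt hδ hδ1)
  have e : ∀ τ : ℝ, (τ : ℂ) ^ (z - 1) * rayKer δ φ γ τ s ρ =
      (((ρ ^ (γ - 1) : ℝ) : ℂ) * Complex.exp (γ * φ * Complex.I +
        s * ρ * Complex.exp (φ * Complex.I))) * ((τ : ℂ) ^ (z - 1) *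
        Complex.exp (-(((ρ ^ δ : ℝ) : ℂ) * Complex.exp ((δ * φ : ℝ) * Complex.I) * τ))) := by
    intro τ
    unfold rayKer
    rw [sub_eq_add_neg (_ + _), Complex.exp_add (_ + _)]
    ring_nf
  simp only [e]
  rw [integral_const_mul, h, ofReal_rpow_cpow hρ0, Complex.ofReal_cpow hρ0.le,
    ofReal_cpow_eq_exp hρ0, ofReal_cpow_eq_exp hρ0, ofReal_cpow_eq_exp hρ0]
  rw [show ∀ a b c d e : ℂ, (a * b) * (c * d * e) = e * ((a * b) * (c * d)) by intros; ring]
  simp only [← Complex.exp_add]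
  congr 2
  push_cast
  ring

lemma integral_cpow_mul_W {z : ℂ} (hz : 0 < z.re) (hzγ : δ * z.re < γ) {s : ℝ} (hs : 0 < s) :
    ∫ τ in Ioi (0:ℝ), (τ : ℂ) ^ (z - 1) * (W δ γ τ s : ℂ) =
      Complex.Gamma z * (Complex.Gamma (γ - δ * z) * Complex.sin (π * (γ - δ * z)) / π) *
        (s : ℂ) ^ (-(γ - δ * z)) := by
  have hI : ∀ z : ℂ, 0 < z.re → δ * z.re < γ → IntegrableOn (fun τ : ℝ =>
      (τ : ℂ) ^ (z - 1) * rayInt δ (ang δ) γ τ s) (Ioi 0) := by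
    intro z hz hzγ
    have := (integrable_cpow_mul_rayKer hδ hδ1 hz hzγ hs).integral_prod_left
    simp only [integral_const_mul] at this
    exact this
  set cj := starRingEnd ℂ
  have hz' : 0 < (cj z).re := by simpa [cj] using hz
  have hzγ' : δ * (cj z).re < γ := by simpa [cj] using hzγ
  have hcj : ∀ τ : ℝ, 0 < τ → (τ : ℂ) ^ (z - 1) * cj (rayInt δ (ang δ) γ τ s) =
      cj ((τ : ℂ) ^ (cj z - 1) * rayInt δ (ang δ) γ τ s) := by
    intro τ hτ
    rw [map_mul, ofReal_cpow_eq_exp hτ, ofReal_cpow_eq_exp hτ, ← Complex.exp_conj]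
    simp [cj]
  have h1 := integral_cpow_mul_rayInt hδ hδ1 hz hzγ hs
  have h2 := congrArg cj (integral_cpow_mul_rayInt hδ hδ1 hz' hzγ' hs)
  have i2 : IntegrableOn (fun τ : ℝ => (τ : ℂ) ^ (z - 1) * cj (rayInt δ (ang δ) γ τ s))
      (Ioi 0) := by
    refine IntegrableOn.congr_fun (f := fun τ : ℝ =>
      cj ((τ : ℂ) ^ (cj z - 1) * rayInt δ (ang δ) γ τ s)) ?_
      (fun τ hτ => (hcj τ hτ).symm) measurableSet_Ioi
    exact (Complex.conjLIE.integrable_comp_iff).2 (hI _ hz' hzγ')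
  rw [← integral_conj, ← setIntegral_congr_fun measurableSet_Ioi (fun τ hτ => hcj τ hτ)] at h2
  have hW : ∀ τ : ℝ, (τ : ℂ) ^ (z - 1) * (W δ γ τ s : ℂ) = (1 / (2 * π * Complex.I)) *
      ((τ : ℂ) ^ (z - 1) * rayInt δ (ang δ) γ τ s -
        (τ : ℂ) ^ (z - 1) * cj (rayInt δ (ang δ) γ τ s)) := by
    intro τ
    have hp : (π : ℂ) ≠ 0 := by exact_mod_cast Real.pi_ne_zero
    rw [W_of_pos hs, Complex.ofReal_div, ← mul_sub, Complex.sub_conj]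
    field_simp
    push_cast
    ring
  simp_rw [hW]
  rw [integral_const_mul, integral_sub (hI z hz hzγ) i2, h1, h2]
  have e1 : cj (Complex.Gamma (cj z)) = Complex.Gamma z := by
    rw [← Complex.Gamma_conj]; simp [cj]
  have e2 : cj (Complex.Gamma (γ - δ * cj z)) = Complex.Gamma (γ - δ * z) := by
    rw [← Complex.Gamma_conj]; simp [cj]
  have e3 : cj ((s : ℂ) ^ (-(γ - δ * cj z))) = (s : ℂ) ^ (-(γ - δ * z)) := by
    rw [ofReal_cpow_eq_exp hs, ofReal_cpow_eq_exp hs, ← Complex.exp_conj]; simp [cj]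
  have e4 : cj (Complex.exp ((γ - δ * cj z) * π * Complex.I)) =
      Complex.exp (-(π * (γ - δ * z)) * Complex.I) := by
    rw [← Complex.exp_conj]; simp [cj]; ring_nf
  rw [map_mul, map_mul, map_mul, e1, e2, e3, e4, Complex.sin,
    show (γ - δ * z) * π * Complex.I = (π * (γ - δ * z)) * Complex.I by ring]
  have hp : (π : ℂ) ≠ 0 := by exact_mod_cast Real.pi_ne_zero
  field_simp
  rw [Complex.I_sq]
  ring

end

section
variable {δ γ : ℝ} (hδ : 0 < δ) (hδ1 : δ < 1)
include hδ hδ1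

omit hδ hδ1 in
lemma measurable_W_right (δ γ τ : ℝ) : Measurable (W δ γ τ) :=
  (measurable_W δ γ).comp measurable_prodMk_left

lemma integrableOn_exp_mul_W (hγ : 0 < γ) {τ p : ℝ} (hτ : 0 < τ) (hp : 0 < p) :
    IntegrableOn (fun s => Real.exp (-(p * s)) * W δ γ τ s) (Ioi 0) := by
  obtain ⟨C, hC, h⟩ := exists_abs_W_le hδ hδ1 hγ (K := γ / δ) (by positivity)
  rw [mul_div_cancel₀ _ hδ.ne', sub_self] at h
  have h0 := (integrableOn_rpow_mul_exp_neg_mul_rpow (p := 1) (s := 0) (b := p)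
    (by linarith) one_pos hp).const_mul (C * τ ^ (-(γ / δ)))
  refine h0.mono' ?_ ((ae_restrict_iff' measurableSet_Ioi).2 (Eventually.of_forall fun s hs => ?_))
  · have := measurable_W_right δ γ τ
    exact Measurable.aestronglyMeasurable (by fun_prop)
  · have := h τ s hτ hs
    rw [norm_mul, Real.norm_of_nonneg (Real.exp_pos _).le, Real.norm_eq_abs, rpow_one, rpow_zero,
      neg_mul]
    rw [rpow_zero] at this
    calc _ ≤ Real.exp (-(p * s)) * (C * 1 * τ ^ (-(γ / δ))) := by gcongr
      _ = _ := by ring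

lemma continuousAt_laplace_W (hγ : 0 < γ) {τ p : ℝ} (hτ : 0 < τ) (hp : 0 < p) :
    ContinuousAt (fun τ => ∫ s in Ioi (0:ℝ), Real.exp (-(p * s)) * W δ γ τ s) τ := by
  obtain ⟨C, hC, h⟩ := exists_abs_W_le hδ hδ1 hγ (K := γ / δ) (by positivity)
  rw [mul_div_cancel₀ _ hδ.ne', sub_self] at h
  have h0 := (integrableOn_rpow_mul_exp_neg_mul_rpow (p := 1) (s := 0) (b := p)
    (by linarith) one_pos hp).const_mul (C * (τ / 2) ^ (-(γ / δ)))
  refine continuousAt_of_dominated (Eventually.of_forall fun τ' => ?_) ?_ h0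
    (Eventually.of_forall fun s => ?_)
  · have := measurable_W_right δ γ τ'
    exact Measurable.aestronglyMeasurable (by fun_prop)
  · filter_upwards [Ioi_mem_nhds (by linarith : τ / 2 < τ)] with τ' hτ'
    have hτ' : τ / 2 < τ' := hτ'
    refine (ae_restrict_iff' measurableSet_Ioi).2 (Eventually.of_forall fun s hs => ?_)
    have h1 := h τ' s (by linarith) hs
    have h2 : τ' ^ (-(γ / δ)) ≤ (τ / 2) ^ (-(γ / δ)) :=
      rpow_le_rpow_of_nonpos (by linarith) hτ'.le (by simp; positivity)
    rw [norm_mul, Real.norm_of_nonneg (Real.exp_pos _).le, Real.norm_eq_abs, rpow_one, rpow_zero,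
      neg_mul]
    rw [rpow_zero] at h1
    calc _ ≤ Real.exp (-(p * s)) * (C * 1 * (τ / 2) ^ (-(γ / δ))) := by
          gcongr
          exact h1.trans (by gcongr)
      _ = _ := by ring
  · exact continuousAt_const.mul (hasDerivAt_W_tau hδ hδ1 hγ hτ).continuousAt

/-- The Laplace transform of `W` in its last variable. -/
lemma laplace_W (hγ : 0 < γ) {τ p : ℝ} (hτ : 0 < τ) (hp : 0 < p) :
    ∫ s in Ioi (0:ℝ), Real.exp (-(p * s)) * W δ γ τ s =
      p ^ (γ - 1) * Real.exp (-(τ * p ^ δ)) := by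
  have hpδ : 0 < p ^ δ := rpow_pos_of_pos hp δ
  obtain ⟨K₁, K, K₂, h01, h1, h12, h23, h3⟩ : ∃ K₁ K K₂ : ℝ,
      0 < K₁ ∧ (γ - 1) / δ < K₁ ∧ K₁ < K ∧ K < K₂ ∧ K₂ < γ / δ := by
    have h : max 0 ((γ - 1) / δ) < γ / δ :=
      max_lt (by positivity) (by gcongr; linarith)
    obtain ⟨K, hK, hK'⟩ := exists_between h
    obtain ⟨K₁, a1, a2⟩ := exists_between hK
    obtain ⟨K₂, a3, a4⟩ := exists_between hK'
    exact ⟨K₁, K, K₂, (max_lt_iff.1 a1).1, (max_lt_iff.1 a1).2, a2, a3, a4⟩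
  rw [div_lt_iff₀' hδ] at h1
  rw [lt_div_iff₀' hδ] at h3
  have hK0 : 0 < K := h01.trans h12
  have hK1 : δ * K₁ < δ * K := by gcongr
  have hK2 : δ * K < δ * K₂ := by gcongr
  obtain ⟨C₁, hC₁, hb₁⟩ := exists_abs_W_le hδ hδ1 hγ h01.le
  obtain ⟨C₂, hC₂, hb₂⟩ := exists_abs_W_le hδ hδ1 hγ (hK0.trans h23).le
  have hI : ∀ z : ℂ, z.re = K → Integrable (fun q : ℝ × ℝ => (q.1 : ℂ) ^ (z - 1) *
      ((Real.exp (-(p * q.2)) * W δ γ q.1 q.2 : ℝ) : ℂ))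
      ((volume.restrict (Ioi 0)).prod (volume.restrict (Ioi 0))) := by
    intro z hz
    refine integrable_quadrant_of_le_rpow (K := K) ?_ h12 h23
      ((integrableOn_rpow_mul_exp_neg_mul_rpow (s := δ * K₁ - γ) (p := 1) (b := p)
        (by linarith) one_pos hp).const_mul C₁)
      ((integrableOn_rpow_mul_exp_neg_mul_rpow (s := δ * K₂ - γ) (p := 1) (b := p)
        (by linarith) one_pos hp).const_mul C₂) ?_ ?_
    · have := measurable_W δ γ
      fun_prop
    · intro x y hx hy
      rw [norm_mul, Complex.norm_real, Complex.norm_cpow_eq_rpow_re_of_pos hx, norm_mul,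
        Real.norm_of_nonneg (Real.exp_pos _).le, Real.norm_eq_abs, Complex.sub_re, Complex.one_re,
        hz, rpow_one, neg_mul, sub_eq_add_neg _ K₁, rpow_add hx]
      calc _ ≤ x ^ (K - 1) * (Real.exp (-(p * y)) * (C₁ * y ^ (δ * K₁ - γ) * x ^ (-K₁))) := by
            gcongr; exact hb₁ x y hx hy
        _ = _ := by ring
    · intro x y hx hy
      rw [norm_mul, Complex.norm_real, Complex.norm_cpow_eq_rpow_re_of_pos hx, norm_mul,
        Real.norm_of_nonneg (Real.exp_pos _).le, Real.norm_eq_abs, Complex.sub_re, Complex.one_re,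
        hz, rpow_one, neg_mul, sub_eq_add_neg _ K₂, rpow_add hx]
      calc _ ≤ x ^ (K - 1) * (Real.exp (-(p * y)) * (C₂ * y ^ (δ * K₂ - γ) * x ^ (-K₂))) := by
            gcongr; exact hb₂ x y hx hy
        _ = _ := by ring
  set F : ℝ → ℂ := fun τ => ((∫ s in Ioi (0:ℝ), Real.exp (-(p * s)) * W δ γ τ s : ℝ) : ℂ) with hF
  set E : ℝ → ℂ := fun τ => ((p ^ (γ - 1) * Real.exp (-(τ * p ^ δ)) : ℝ) : ℂ) with hE
  have hFeq : ∀ z : ℂ, ∀ τ : ℝ, (τ : ℂ) ^ (z - 1) * F τ = ∫ s in Ioi (0:ℝ), (τ : ℂ) ^ (z - 1) *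
      ((Real.exp (-(p * s)) * W δ γ τ s : ℝ) : ℂ) := by
    intro z τ
    rw [integral_const_mul, integral_complex_ofReal]
  have hFc : ∀ z : ℂ, z.re = K → IntegrableOn (fun τ : ℝ => (τ : ℂ) ^ (z - 1) * F τ) (Ioi 0) := by
    intro z hz
    have := (hI z hz).integral_prod_left
    simp only [hFeq]
    exact this
  have hEeq : ∀ τ : ℝ, E τ = (p : ℂ) ^ ((γ : ℂ) - 1) *
      Complex.exp (-(((p ^ δ : ℝ) : ℂ) * τ)) := by
    intro τ
    simp only [hE]
    push_cast
    rw [Complex.ofReal_cpow hp.le, Complex.ofReal_cpow hp.le]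
    push_cast
    ring_nf
  have hEc : ∀ z : ℂ, z.re = K → IntegrableOn (fun τ : ℝ => (τ : ℂ) ^ (z - 1) * E τ) (Ioi 0) := by
    intro z hz
    simp only [hEeq]
    have := (integrableOn_cpow_mul_cexp (a := z) (r := ((p ^ δ : ℝ) : ℂ)) (by rw [hz]; exact hK0)
      (by simpa using hpδ)).const_mul ((p : ℂ) ^ ((γ : ℂ) - 1))
    refine this.congr (Eventually.of_forall fun x => ?_)
    simp only []
    ring
  have hmellin : ∀ z : ℂ, z.re = K → mellin (fun τ => F τ - E τ) z = 0 := by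
    intro z hz
    unfold mellin
    simp only [smul_eq_mul, mul_sub]
    rw [integral_sub (hFc z hz) (hEc z hz), sub_eq_zero]
    have hz0 : 0 < z.re := by rw [hz]; exact hK0
    set w : ℂ := γ - δ * z with hw
    have hwre : w.re = γ - δ * K := by
      rw [hw, Complex.sub_re, Complex.ofReal_re, Complex.re_ofReal_mul, hz]
    simp_rw [hFeq]
    rw [integral_integral_swap (f := fun (τ s : ℝ) => (τ : ℂ) ^ (z - 1) *
      ((Real.exp (-(p * s)) * W δ γ τ s : ℝ) : ℂ)) (hI z hz)]
    have e1 : ∀ s ∈ Ioi (0:ℝ), ∫ τ in Ioi (0:ℝ), (τ : ℂ) ^ (z - 1) *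
        ((Real.exp (-(p * s)) * W δ γ τ s : ℝ) : ℂ) =
        (Complex.Gamma z * (Complex.Gamma w * Complex.sin (π * w) / π)) *
          ((s : ℂ) ^ ((1 - w) - 1) * Complex.exp (-((p : ℂ) * s))) := by
      intro s hs
      have := integral_cpow_mul_W hδ hδ1 hz0 (by rw [hz]; linarith) (γ := γ) hs
      rw [← hw] at this
      have e : ∀ τ : ℝ, (τ : ℂ) ^ (z - 1) * ((Real.exp (-(p * s)) * W δ γ τ s : ℝ) : ℂ) =
          Complex.exp (-((p : ℂ) * s)) * ((τ : ℂ) ^ (z - 1) * (W δ γ τ s : ℂ)) := by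
        intro τ; push_cast; ring
      simp_rw [e]
      rw [integral_const_mul, this, show (1 - w) - 1 = -w by ring]
      ring
    rw [setIntegral_congr_fun measurableSet_Ioi e1, integral_const_mul,
      integral_cpow_mul_cexp_neg_mul (a := 1 - w) (r := (p : ℂ))
        (by rw [Complex.sub_re, Complex.one_re, hwre]; linarith) (by simpa using hp)]
    simp_rw [hEeq]
    have e2 : ∀ τ : ℝ, (τ : ℂ) ^ (z - 1) * ((p : ℂ) ^ ((γ : ℂ) - 1) *
        Complex.exp (-(((p ^ δ : ℝ) : ℂ) * τ))) = (p : ℂ) ^ ((γ : ℂ) - 1) *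
        ((τ : ℂ) ^ (z - 1) * Complex.exp (-(((p ^ δ : ℝ) : ℂ) * τ))) := by
      intro τ; ring
    simp_rw [e2]
    rw [integral_const_mul, integral_cpow_mul_cexp_neg_mul hz0 (by simpa using hpδ),
      ofReal_rpow_cpow hp, ← mul_assoc ((p : ℂ) ^ ((γ : ℂ) - 1)),
      ← Complex.cpow_add _ _ (by exact_mod_cast hp.ne')]
    have hG := Complex.Gamma_mul_Gamma_one_sub w
    have hsin : Complex.sin (π * w) ≠ 0 := by
      intro h0
      rw [Complex.sin_eq_zero_iff] at h0
      obtain ⟨k, hk⟩ := h0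
      have hp' : (π : ℂ) ≠ 0 := by exact_mod_cast Real.pi_ne_zero
      rw [mul_comm] at hk
      have hk' := mul_right_cancel₀ hp' hk
      have : w.re = k := by rw [hk']; simp
      rw [hwre] at this
      have b1 : (0:ℝ) < k := by linarith
      have b2 : (k:ℝ) < 1 := by linarith
      norm_cast at b1 b2
      omega
    have hp' : (π : ℂ) ≠ 0 := by exact_mod_cast Real.pi_ne_zero
    rw [show -(1 - w) = (γ : ℂ) - 1 + δ * -z by rw [hw]; ring]
    rw [eq_div_iff hsin] at hG
    generalize (p : ℂ) ^ ((γ : ℂ) - 1 + δ * -z) = X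
    field_simp
    linear_combination (Complex.Gamma z * X) * hG
  have hinv := mellinInv_mellin_eq K (fun τ => F τ - E τ) hτ ?_ ?_ ?_
  · have : mellinInv K (mellin fun τ => F τ - E τ) τ = 0 := by
      unfold mellinInv
      simp_rw [fun y : ℝ => hmellin (K + y * Complex.I) (by simp)]
      simp
    rw [this] at hinv
    have h4 := sub_eq_zero.1 hinv.symm
    simp only [hF, hE] at h4
    exact_mod_cast h4
  · unfold MellinConvergent
    simp only [smul_eq_mul, mul_sub]
    exact (hFc K (by simp)).sub (hEc K (by simp))
  · unfold Complex.VerticalIntegrable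
    simp_rw [fun y : ℝ => hmellin (K + y * Complex.I) (by simp)]
    exact integrable_zero _ _ _
  · refine ContinuousAt.sub ?_ ?_
    · exact Complex.continuous_ofReal.continuousAt.comp
        (continuousAt_laplace_W hδ hδ1 hγ hτ hp)
    · simp only [hE]
      fun_prop

end

/-- A compactly supported function of `-log y` that vanishes at `0` is continuous. -/
lemma continuous_comp_neg_log {χ : ℝ → ℝ} (hχ : Continuous χ) (hs : HasCompactSupport χ)
    (h0 : χ 0 = 0) : Continuous fun y => χ (-Real.log y) := by
  rw [continuous_iff_continuousAt]
  intro y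
  rcases eq_or_ne y 0 with rfl | hy
  · rw [continuousAt_iff_punctured_nhds]
    simp only [Real.log_zero, neg_zero, h0]
    have h1 : Tendsto (fun y => -Real.log y) (nhdsWithin 0 {0}ᶜ) atTop :=
      tendsto_neg_atBot_atTop.comp Real.tendsto_log_nhdsNE_zero
    exact (hs.is_zero_at_infty.mono_left atTop_le_cocompact).comp h1
  · exact hχ.continuousAt.comp (Real.continuousAt_log hy).neg

/-- An integrable function on the half-line whose Laplace transform vanishes at all positive
integers is zero almost everywhere. -/
lemma ae_eq_zero_of_laplace_eq_zero {g : ℝ → ℝ} (hg : IntegrableOn g (Ioi 0))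
    (hL : ∀ n : ℕ, ∫ s in Ioi (0 : ℝ), Real.exp (-((n + 1 : ℝ) * s)) * g s = 0) :
    ∀ᵐ s, s ∈ Ioi (0 : ℝ) → g s = 0 := by
  refine isOpen_Ioi.ae_eq_zero_of_integral_contDiff_smul_eq_zero hg.locallyIntegrableOn ?_
  intro φ hφ hφc hφs
  have hφ0 : ∀ s ∉ Ioi (0 : ℝ), φ s = 0 := fun s hs =>
    image_eq_zero_of_notMem_tsupport fun h => hs (hφs h)
  have hinteg : Integrable g (volume.restrict (Ioi 0)) := hg
  have hexpint : ∀ b : ℝ → ℝ, Continuous b → (∀ s, 0 < s → |b s| ≤ 1) →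
      Integrable (fun s => b s * g s) (volume.restrict (Ioi 0)) := fun b hb hb1 =>
    hinteg.bdd_mul hb.aestronglyMeasurable
      ((ae_restrict_iff' measurableSet_Ioi).2 (Eventually.of_forall fun s hs => by
        simpa using hb1 s hs))
  have hpoly : ∀ P : Polynomial ℝ, Integrable
      (fun s => Real.exp (-s) * P.eval (Real.exp (-s)) * g s) (volume.restrict (Ioi 0)) ∧
      ∫ s in Ioi (0 : ℝ), Real.exp (-s) * P.eval (Real.exp (-s)) * g s = 0 := by
    intro P
    induction P using Polynomial.induction_on' with
    | add p q hp hq =>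
      have e : (fun s => Real.exp (-s) * (p + q).eval (Real.exp (-s)) * g s) = fun s =>
          Real.exp (-s) * p.eval (Real.exp (-s)) * g s +
          Real.exp (-s) * q.eval (Real.exp (-s)) * g s := by
        funext s; rw [Polynomial.eval_add]; ring
      rw [e]
      exact ⟨hp.1.add hq.1, by rw [integral_add hp.1 hq.1, hp.2, hq.2, add_zero]⟩
    | monomial n c =>
      have e : (fun s => Real.exp (-s) * (Polynomial.monomial n c).eval (Real.exp (-s)) * g s) =
          fun s => c * (Real.exp (-((n + 1 : ℝ) * s)) * g s) := by
        funext s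
        rw [Polynomial.eval_monomial, ← Real.exp_nat_mul,
          show -((n + 1 : ℝ) * s) = -s + n * -s by ring, Real.exp_add]
        ring
      rw [e]
      refine ⟨(hexpint _ (by fun_prop) fun s hs => ?_).const_mul c, by
        rw [integral_const_mul, hL, mul_zero]⟩
      rw [abs_of_pos (Real.exp_pos _), Real.exp_le_one_iff]
      have : 0 ≤ (n + 1 : ℝ) * s := by positivity
      linarith
  set χ : ℝ → ℝ := fun s => Real.exp s * φ s with hχ
  have hχc : Continuous χ := Real.continuous_exp.mul hφ.continuous
  have hψ := continuous_comp_neg_log hχc hφc.mul_left (by simp [hχ, hφ0 0 (by simp)])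
  have hbound : ∀ ε > 0, |∫ s, φ s • g s| ≤ ε * ∫ s in Ioi (0 : ℝ), |g s| := by
    intro ε hε
    obtain ⟨P, hP⟩ := exists_polynomial_near_of_continuousOn 0 1 _ hψ.continuousOn ε hε
    have hPs : ∀ s, 0 < s → |χ s - P.eval (Real.exp (-s))| ≤ ε := by
      intro s hs
      have := hP (Real.exp (-s)) ⟨(Real.exp_pos _).le, Real.exp_le_one_iff.2 (by linarith)⟩
      rw [Real.log_exp, neg_neg, abs_sub_comm] at this
      exact this.le
    have e1 : ∫ s, φ s • g s = ∫ s in Ioi (0 : ℝ), φ s * g s := by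
      rw [setIntegral_eq_integral_of_forall_compl_eq_zero]
      · rfl
      · intro s hs; rw [hφ0 s hs, zero_mul]
    obtain ⟨Cφ, hCφ⟩ := hφ.continuous.bounded_above_of_compact_support hφc
    have hφg : Integrable (fun s => φ s * g s) (volume.restrict (Ioi 0)) :=
      hinteg.bdd_mul hφ.continuous.aestronglyMeasurable (Eventually.of_forall hCφ)
    have e2 : ∫ s, φ s • g s = ∫ s in Ioi (0 : ℝ),
        (φ s * g s - Real.exp (-s) * P.eval (Real.exp (-s)) * g s) := by
      rw [integral_sub hφg (hpoly P).1, (hpoly P).2, sub_zero, e1]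
    rw [e2, ← integral_const_mul, ← Real.norm_eq_abs]
    refine norm_integral_le_of_norm_le (hinteg.abs.const_mul ε)
      ((ae_restrict_iff' measurableSet_Ioi).2 (Eventually.of_forall fun s hs => ?_))
    have e3 : φ s * g s - Real.exp (-s) * P.eval (Real.exp (-s)) * g s =
        Real.exp (-s) * (χ s - P.eval (Real.exp (-s))) * g s := by
      have : Real.exp (-s) * χ s = φ s := by
        simp only [hχ]; rw [← mul_assoc, ← Real.exp_add]; simp
      rw [mul_sub, this]; ring
    rw [e3, norm_mul, norm_mul, Real.norm_eq_abs, Real.norm_eq_abs, Real.norm_eq_abs]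
    gcongr
    have h1 : |Real.exp (-s)| ≤ 1 := by
      rw [abs_of_pos (Real.exp_pos _), Real.exp_le_one_iff]
      have : 0 < s := hs
      linarith
    nlinarith [hPs s hs, abs_nonneg (χ s - P.eval (Real.exp (-s)))]
  by_contra hne
  have hpos : 0 < |∫ s, φ s • g s| := abs_pos.2 hne
  set I := ∫ s in Ioi (0 : ℝ), |g s| with hI
  have hI0 : 0 ≤ I := integral_nonneg fun s => abs_nonneg _
  have := hbound (|∫ s, φ s • g s| / (2 * (I + 1))) (by positivity)
  have h2 : |∫ s, φ s • g s| / (2 * (I + 1)) * I < |∫ s, φ s • g s| := by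
    rw [div_mul_eq_mul_div, div_lt_iff₀ (by positivity)]
    nlinarith
  linarith

/-- The Laplace transform turns `lconv` into a product. -/
lemma laplace_lconv {f g : ℝ → ℝ} {p : ℝ}
    (hf : IntegrableOn (fun s => Real.exp (-(p * s)) * f s) (Ioi 0))
    (hg : IntegrableOn (fun s => Real.exp (-(p * s)) * g s) (Ioi 0)) :
    IntegrableOn (fun s => Real.exp (-(p * s)) * lconv f g s) (Ioi 0) ∧
    ∫ s in Ioi (0 : ℝ), Real.exp (-(p * s)) * lconv f g s =
      (∫ s in Ioi (0 : ℝ), Real.exp (-(p * s)) * f s) *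
        ∫ s in Ioi (0 : ℝ), Real.exp (-(p * s)) * g s := by
  have e : ∀ x : ℝ, Real.exp (-(p * x)) * lconv f g x =
      ∫ t in (0 : ℝ)..x, (ContinuousLinearMap.mul ℝ ℝ) (Real.exp (-(p * t)) * g t)
        (Real.exp (-(p * (x - t))) * f (x - t)) := by
    intro x
    unfold lconv
    rw [← intervalIntegral.integral_const_mul]
    refine intervalIntegral.integral_congr fun t _ => ?_
    simp only [ContinuousLinearMap.mul_apply']
    rw [show -(p * x) = -(p * t) + -(p * (x - t)) by ring, Real.exp_add]
    ring
  simp_rw [e]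
  constructor
  · have := integrable_posConvolution hg hf (ContinuousLinearMap.mul ℝ ℝ)
    unfold posConvolution at this
    rwa [integrable_indicator_iff measurableSet_Ioi] at this
  · rw [integral_posConvolution hg hf (ContinuousLinearMap.mul ℝ ℝ)]
    simp only [ContinuousLinearMap.mul_apply']
    ring

/-- Two functions continuous on the half-line with the same Laplace transform coincide. -/
lemma eqOn_of_laplace_eq {f g : ℝ → ℝ} (hfc : ContinuousOn f (Ioi 0))
    (hgc : ContinuousOn g (Ioi 0))
    (hf : ∀ p > 0, IntegrableOn (fun s => Real.exp (-(p * s)) * f s) (Ioi 0))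
    (hg : ∀ p > 0, IntegrableOn (fun s => Real.exp (-(p * s)) * g s) (Ioi 0))
    (hfg : ∀ p > 0, ∫ s in Ioi (0 : ℝ), Real.exp (-(p * s)) * f s =
      ∫ s in Ioi (0 : ℝ), Real.exp (-(p * s)) * g s) : EqOn f g (Ioi 0) := by
  have h1 := ae_eq_zero_of_laplace_eq_zero
    (g := fun s => Real.exp (-(1 * s)) * f s - Real.exp (-(1 * s)) * g s)
    ((hf 1 one_pos).sub (hg 1 one_pos)) (fun n => by
      have hp : (0 : ℝ) < n + 2 := by positivity
      have := hfg (n + 2) hp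
      rw [← sub_eq_zero, ← integral_sub (hf _ hp) (hg _ hp)] at this
      refine Eq.trans (integral_congr_ae (Eventually.of_forall fun s => ?_)) this
      simp only
      rw [show -(((n : ℝ) + 2) * s) = -((n + 1 : ℝ) * s) + -(1 * s) by ring, Real.exp_add]
      ring)
  refine Measure.eqOn_open_of_ae_eq (μ := volume) ?_ isOpen_Ioi hfc hgc
  rw [Filter.EventuallyEq, ae_restrict_iff' measurableSet_Ioi]
  filter_upwards [h1] with s hs hs0
  have := hs hs0
  rw [← mul_sub] at this
  exact sub_eq_zero.1 ((mul_eq_zero.1 this).resolve_left (Real.exp_pos _).ne')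

/-- The convolution integral may be extended to any interval beyond `t` when the second factor
vanishes on the negative half-line. -/
lemma lconv_eq_setIntegral {f g : ℝ → ℝ} (hg0 : ∀ s ≤ 0, g s = 0) {t T : ℝ} (ht : t ≤ T) :
    lconv g f t = ∫ s in Ioc 0 T, g (t - s) * f s := by
  unfold lconv
  rcases le_total 0 t with h | h
  · rw [intervalIntegral.integral_of_le h]
    refine (setIntegral_eq_of_subset_of_forall_sdiff_eq_zero measurableSet_Ioc
      (Ioc_subset_Ioc_right ht) fun s hs => ?_).symm
    have : t < s := by
      by_contra hc
      exact hs.2 ⟨hs.1.1, not_lt.1 hc⟩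
    rw [hg0 _ (by linarith), zero_mul]
  · rw [intervalIntegral.integral_of_ge h,
      setIntegral_eq_zero_of_forall_eq_zero (t := Ioc t 0),
      setIntegral_eq_zero_of_forall_eq_zero, neg_zero]
    · intro s hs; rw [hg0 _ (by linarith [hs.1]), zero_mul]
    · intro s hs; rw [hg0 _ (by linarith [hs.1]), zero_mul]

lemma continuous_lconv {f g : ℝ → ℝ} (hf : ∀ T, IntegrableOn f (Ioc 0 T))
    (hgc : Continuous g) (hg0 : ∀ s ≤ 0, g s = 0) : Continuous (lconv g f) := by
  rw [continuous_iff_continuousAt]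
  intro t₀
  set T := t₀ + 1
  obtain ⟨C, hC⟩ := (isCompact_Icc (a := (0 : ℝ)) (b := T)).exists_bound_of_continuousOn
    hgc.continuousOn
  have hgb : ∀ s ≤ T, |g s| ≤ max C 0 := by
    intro s hs
    rcases le_or_gt s 0 with h | h
    · rw [hg0 s h, abs_zero]; exact le_max_right _ _
    · exact (hC s ⟨h.le, hs⟩).trans (le_max_left _ _)
  have hev : ∀ᶠ t in nhds t₀, t < T := Iio_mem_nhds (by simp [T])
  have h1 : (fun t => ∫ s in Ioc 0 T, g (t - s) * f s) =ᶠ[nhds t₀] lconv g f := by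
    filter_upwards [hev] with t ht
    exact (lconv_eq_setIntegral hg0 ht.le).symm
  refine ContinuousAt.congr ?_ h1
  refine continuousAt_of_dominated (bound := fun s => max C 0 * |f s|)
    (Eventually.of_forall fun t => ?_) ?_ ((hf T).abs.const_mul _)
    (Eventually.of_forall fun s => by fun_prop)
  · exact ((hgc.comp (continuous_const.sub continuous_id)).aestronglyMeasurable).mul
      (hf T).aestronglyMeasurable
  · filter_upwards [hev] with t ht
    refine (ae_restrict_iff' measurableSet_Ioc).2 (Eventually.of_forall fun s hs => ?_)
    rw [norm_mul, Real.norm_eq_abs, Real.norm_eq_abs]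
    exact mul_le_mul_of_nonneg_right (hgb _ (by linarith [hs.1])) (abs_nonneg _)

section
variable {δ γ : ℝ} (hδ : 0 < δ) (hδ1 : δ < 1)
include hδ hδ1

lemma exists_abs_W_le_const (hγ : 0 < γ) :
    ∃ C, 0 ≤ C ∧ ∀ τ s : ℝ, 0 < τ → |W δ γ τ s| ≤ C * τ ^ (-(γ / δ)) := by
  obtain ⟨C, hC, h⟩ := exists_abs_W_le hδ hδ1 hγ (K := γ / δ) (by positivity)
  rw [mul_div_cancel₀ _ hδ.ne', sub_self] at h
  refine ⟨C, hC, fun τ s hτ => ?_⟩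
  rcases le_or_gt s 0 with hs | hs
  · rw [W_of_nonpos hs, abs_zero]; positivity
  · simpa using h τ s hτ hs

lemma continuous_W (hγ : 0 < γ) {τ : ℝ} (hτ : 0 < τ) : Continuous (W δ γ τ) :=
  continuous_iff_continuousAt.2 fun _ => (hasDerivAt_W hδ hδ1 hγ hτ).continuousAt

lemma integrableOn_W_one : IntegrableOn (W δ 1 1) (Ioi 0) := by
  rw [← Ioc_union_Ioi_eq_Ioi zero_le_one]
  refine IntegrableOn.union ?_ ?_
  · exact ((continuous_W hδ hδ1 one_pos one_pos).integrableOn_Icc).mono_set Ioc_subset_Icc_self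
  · obtain ⟨C, hC, h⟩ := exists_abs_W_one_le hδ hδ1 (K := -1) le_rfl
    refine ((integrableOn_Ioi_rpow_of_lt (a := δ * -1 - 1) (by linarith) one_pos).const_mul C).mono'
      (measurable_W_right δ 1 1).aestronglyMeasurable
      ((ae_restrict_iff' measurableSet_Ioi).2 (Eventually.of_forall fun s hs => ?_))
    have := h 1 s one_pos (zero_lt_one.trans hs)
    simpa using this

lemma integral_W_one : ∫ s in Ioi (0 : ℝ), W δ 1 1 s = 1 := by
  have hinteg := integrableOn_W_one hδ hδ1
  have h1 : Tendsto (fun p => ∫ s in Ioi (0 : ℝ), Real.exp (-(p * s)) * W δ 1 1 s)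
      (nhdsWithin 0 (Ioi 0)) (nhds (∫ s in Ioi (0 : ℝ), W δ 1 1 s)) := by
    refine tendsto_integral_filter_of_dominated_convergence (fun s => |W δ 1 1 s|)
      (Eventually.of_forall fun p => ?_) ?_ hinteg.abs (Eventually.of_forall fun s => ?_)
    · exact (Continuous.aestronglyMeasurable (by fun_prop)).mul
        (measurable_W_right δ 1 1).aestronglyMeasurable
    · filter_upwards [self_mem_nhdsWithin] with p hp
      refine (ae_restrict_iff' measurableSet_Ioi).2 (Eventually.of_forall fun s hs => ?_)
      rw [norm_mul, Real.norm_eq_abs, Real.norm_eq_abs, abs_of_pos (Real.exp_pos _)]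
      refine mul_le_of_le_one_left (abs_nonneg _) (Real.exp_le_one_iff.2 ?_)
      have := mul_pos (show 0 < p from hp) hs
      linarith
    · have : Continuous fun p => Real.exp (-(p * s)) * W δ 1 1 s := by fun_prop
      have := (this.tendsto 0).mono_left (nhdsWithin_le_nhds (s := Ioi 0))
      simpa using this
  have h2 : Tendsto (fun p : ℝ => Real.exp (-(p ^ δ))) (nhdsWithin 0 (Ioi 0)) (nhds 1) := by
    have : Continuous fun p : ℝ => Real.exp (-(p ^ δ)) :=
      Real.continuous_exp.comp (Real.continuous_rpow_const hδ.le).neg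
    have := (this.tendsto 0).mono_left (nhdsWithin_le_nhds (s := Ioi 0))
    simpa [Real.zero_rpow hδ.ne'] using this
  refine tendsto_nhds_unique (h1.congr' ?_) h2
  filter_upwards [self_mem_nhdsWithin] with p hp
  rw [laplace_W hδ hδ1 one_pos one_pos hp]
  simp

end

/-- The convolution of `W δ γ σ` with `H`, as a function of time. -/
noncomputable def Phi (δ γ : ℝ) (H : ℝ → ℝ) (σ t : ℝ) : ℝ := lconv (W δ γ σ) H t

section
variable {δ γ : ℝ} (hδ : 0 < δ) (hδ1 : δ < 1) {H : ℝ → ℝ} (hH : Continuous H)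
  (hH0 : ∀ s ≤ 0, H s = 0) {B : ℝ} (hHb : ∀ s, |H s| ≤ B)

include hH0 in
lemma lconv_eq_integral {g : ℝ → ℝ} (hg0 : ∀ s ≤ 0, g s = 0) (t : ℝ) :
    lconv g H t = ∫ s, g (t - s) * H s := by
  rw [lconv_eq_setIntegral hg0 (le_max_left t 0)]
  refine setIntegral_eq_integral_of_forall_compl_eq_zero fun s hs => ?_
  rcases le_or_gt s 0 with h | h
  · rw [hH0 s h, mul_zero]
  · have : max t 0 < s := by
      by_contra hc
      exact hs ⟨h, not_lt.1 hc⟩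
    rw [hg0 _ (by linarith [le_max_left t 0]), zero_mul]

lemma Phi_eq_setIntegral {σ t T : ℝ} (ht : t ≤ T) :
    Phi δ γ H σ t = ∫ s in Ioc 0 T, W δ γ σ (t - s) * H s :=
  lconv_eq_setIntegral (fun _ hs => W_of_nonpos hs) ht

lemma Phi_of_nonpos {σ t : ℝ} (ht : t ≤ 0) : Phi δ γ H σ t = 0 := by
  rw [Phi_eq_setIntegral ht]; simp

include hH hH0 in
lemma measurable_Phi : Measurable fun q : ℝ × ℝ => Phi δ γ H q.1 q.2 := by
  have e : (fun q : ℝ × ℝ => Phi δ γ H q.1 q.2) =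
      fun q : ℝ × ℝ => ∫ s, W δ γ q.1 (q.2 - s) * H s := by
    funext q
    exact lconv_eq_integral hH0 (fun _ hs => W_of_nonpos hs) q.2
  rw [e]
  have hm : Measurable fun x : (ℝ × ℝ) × ℝ => W δ γ x.1.1 (x.1.2 - x.2) * H x.2 :=
    ((measurable_W δ γ).comp (by fun_prop : Measurable fun x : (ℝ × ℝ) × ℝ =>
      (x.1.1, x.1.2 - x.2))).mul (hH.measurable.comp measurable_snd)
  exact (StronglyMeasurable.integral_prod_right' hm.stronglyMeasurable).measurable

include hδ hδ1 hHb in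
lemma exists_abs_Phi_le (hγ : 0 < γ) : ∃ C, 0 ≤ C ∧ ∀ σ t : ℝ, 0 < σ → 0 ≤ t →
    |Phi δ γ H σ t| ≤ C * t * σ ^ (-(γ / δ)) := by
  obtain ⟨C, hC, h⟩ := exists_abs_W_le_const hδ hδ1 hγ
  have hB : 0 ≤ B := (abs_nonneg _).trans (hHb 0)
  refine ⟨C * B, by positivity, fun σ t hσ ht => ?_⟩
  have := intervalIntegral.norm_integral_le_of_norm_le_const (a := 0) (b := t)
    (f := fun s => W δ γ σ (t - s) * H s) (C := C * σ ^ (-(γ / δ)) * B) fun s _ => by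
      rw [norm_mul, Real.norm_eq_abs, Real.norm_eq_abs]
      exact mul_le_mul (h σ _ hσ) (hHb s) (abs_nonneg _) (by positivity)
  rw [sub_zero, abs_of_nonneg ht, Real.norm_eq_abs] at this
  unfold Phi lconv
  linarith

include hδ hδ1 hH hHb in
lemma hasDerivAt_Phi_t (hγ : 0 < γ) {σ : ℝ} (hσ : 0 < σ) (t : ℝ) :
    HasDerivAt (Phi δ γ H σ) (Phi δ (γ + 1) H σ t) t := by
  obtain ⟨C, hC, h⟩ := exists_abs_W_le_const hδ hδ1 hγ
  obtain ⟨C', hC', h'⟩ := exists_abs_W_le_const hδ hδ1 (add_pos hγ one_pos)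
  have hB : 0 ≤ B := (abs_nonneg _).trans (hHb 0)
  have hm : ∀ γ t, AEStronglyMeasurable (fun s => W δ γ σ (t - s) * H s)
      (volume.restrict (Ioc 0 (t + 1))) := fun γ t =>
    (((measurable_W_right δ γ σ).comp (by fun_prop)).mul hH.measurable).aestronglyMeasurable
  have hm' : ∀ γ t t', AEStronglyMeasurable (fun s => W δ γ σ (t' - s) * H s)
      (volume.restrict (Ioc 0 (t + 1))) := fun γ t t' =>
    (((measurable_W_right δ γ σ).comp (by fun_prop)).mul hH.measurable).aestronglyMeasurable
  have key := hasDerivAt_integral_of_dominated_loc_of_deriv_le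
    (μ := volume.restrict (Ioc 0 (t + 1))) (x₀ := t)
    (F := fun t' s => W δ γ σ (t' - s) * H s) (F' := fun t' s => W δ (γ + 1) σ (t' - s) * H s)
    (bound := fun _ => C' * σ ^ (-((γ + 1) / δ)) * B) (Metric.ball_mem_nhds t one_pos)
    (Eventually.of_forall fun t' => hm' γ t t') ?_ (hm _ _)
    (Eventually.of_forall fun s t' _ => ?_) (integrable_const _)
    (Eventually.of_forall fun s t' _ => ?_)
  · have h2 := key.2
    rw [← Phi_eq_setIntegral (by linarith)] at h2
    refine h2.congr_of_eventuallyEq ?_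
    filter_upwards [Iio_mem_nhds (show t < t + 1 by linarith)] with t' ht'
    exact Phi_eq_setIntegral (le_of_lt ht')
  · refine Integrable.mono' (g := fun _ => C * σ ^ (-(γ / δ)) * B) (integrable_const _) (hm _ _)
      (Eventually.of_forall fun s => ?_)
    rw [norm_mul, Real.norm_eq_abs, Real.norm_eq_abs]
    exact mul_le_mul (h σ _ hσ) (hHb s) (abs_nonneg _) (by positivity)
  · rw [norm_mul, Real.norm_eq_abs, Real.norm_eq_abs]
    exact mul_le_mul (h' σ _ hσ) (hHb s) (abs_nonneg _) (by positivity)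
  · have h1 := (hasDerivAt_W hδ hδ1 (s := t' - s) hγ hσ).comp_sub_const t' s
    exact h1.mul_const _

include hδ hδ1 hH hHb in
lemma hasDerivAt_Phi_sigma (hγ : 0 < γ) {σ : ℝ} (hσ : 0 < σ) (t : ℝ) :
    HasDerivAt (fun σ => Phi δ γ H σ t) (-Phi δ (γ + δ) H σ t) σ := by
  obtain ⟨C, hC, h⟩ := exists_abs_W_le_const hδ hδ1 hγ
  obtain ⟨C', hC', h'⟩ := exists_abs_W_le_const hδ hδ1 (add_pos hγ hδ)
  have hB : 0 ≤ B := (abs_nonneg _).trans (hHb 0)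
  have hm : ∀ γ σ, AEStronglyMeasurable (fun s => W δ γ σ (t - s) * H s)
      (volume.restrict (Ioc 0 t)) := fun γ σ =>
    (((measurable_W_right δ γ σ).comp (by fun_prop)).mul hH.measurable).aestronglyMeasurable
  have key := hasDerivAt_integral_of_dominated_loc_of_deriv_le
    (μ := volume.restrict (Ioc 0 t)) (x₀ := σ)
    (F := fun σ s => W δ γ σ (t - s) * H s) (F' := fun σ s => -W δ (γ + δ) σ (t - s) * H s)
    (bound := fun _ => C' * (σ / 2) ^ (-((γ + δ) / δ)) * B)
    (Ioi_mem_nhds (show σ / 2 < σ by linarith))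
    (Eventually.of_forall fun t' => hm γ t') ?_ ?_
    (Eventually.of_forall fun s σ' hσ' => ?_) (integrable_const _)
    (Eventually.of_forall fun s σ' hσ' => ?_)
  · have h2 := key.2
    simp only [neg_mul] at h2
    rw [integral_neg, ← Phi_eq_setIntegral le_rfl] at h2
    refine h2.congr_of_eventuallyEq (Eventually.of_forall fun t' => ?_)
    exact Phi_eq_setIntegral le_rfl
  · refine Integrable.mono' (g := fun _ => C * σ ^ (-(γ / δ)) * B) (integrable_const _) (hm _ _)
      (Eventually.of_forall fun s => ?_)
    rw [norm_mul, Real.norm_eq_abs, Real.norm_eq_abs]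
    exact mul_le_mul (h σ _ hσ) (hHb s) (abs_nonneg _) (by positivity)
  · simp only [neg_mul]
    exact (hm (γ + δ) σ).neg
  · have hσ'' : σ / 2 < σ' := hσ'
    rw [norm_mul, norm_neg, Real.norm_eq_abs, Real.norm_eq_abs]
    refine mul_le_mul ((h' σ' _ (by linarith)).trans ?_) (hHb s) (abs_nonneg _) (by positivity)
    exact mul_le_mul_of_nonneg_left (rpow_le_rpow_of_nonpos (by linarith) hσ''.le
      (by rw [neg_nonpos]; positivity)) hC'
  · have hσ'' : σ / 2 < σ' := hσ'
    exact (hasDerivAt_W_tau hδ hδ1 hγ (by linarith)).mul_const _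

include hδ hH0 in
lemma Phi_one_eq {σ : ℝ} (hσ : 0 < σ) (t : ℝ) :
    Phi δ 1 H σ t = ∫ y in Ioi (0 : ℝ), W δ 1 1 y * H (t - σ ^ (1 / δ) * y) := by
  have hc : 0 < σ ^ (-1 / δ) := rpow_pos_of_pos hσ _
  have hcc : σ ^ (1 / δ) * σ ^ (-1 / δ) = 1 := by
    rw [← rpow_add hσ, show 1 / δ + -1 / δ = 0 by ring, rpow_zero]
  have e : ∫ y in Ioi (0 : ℝ), W δ 1 1 y * H (t - σ ^ (1 / δ) * y) =
      ∫ y, W δ 1 1 y * H (t - σ ^ (1 / δ) * y) :=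
    setIntegral_eq_integral_of_forall_compl_eq_zero fun y hy => by
      rw [W_of_nonpos (not_lt.1 hy), zero_mul]
  unfold Phi
  rw [lconv_eq_integral hH0 fun _ hs => W_of_nonpos hs, e,
    ← integral_sub_left_eq_self _ volume t]
  simp only [sub_sub_cancel]
  have h := Measure.integral_comp_mul_left (fun y => W δ 1 1 y * H (t - σ ^ (1 / δ) * y))
    (σ ^ (-1 / δ))
  rw [abs_of_pos (inv_pos.2 hc), smul_eq_mul] at h
  rw [← mul_inv_cancel_left₀ hc.ne' (∫ y, W δ 1 1 y * H (t - σ ^ (1 / δ) * y)), ← h,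
    ← integral_const_mul]
  congr 1 with s
  rw [W_scale hδ hσ (γ := 1) (s := s), rpow_one, ← mul_assoc (σ ^ (1 / δ)), hcc,
    one_mul, mul_assoc]

include hδ hH0 hδ1 in
lemma exists_abs_Phi_one_le : ∃ C, 0 ≤ C ∧ ∀ (σ t M : ℝ), 0 < σ → (∀ s ≤ t, |H s| ≤ M) →
    |Phi δ 1 H σ t| ≤ C * M := by
  refine ⟨∫ y in Ioi (0 : ℝ), |W δ 1 1 y|, integral_nonneg fun _ => abs_nonneg _,
    fun σ t M hσ hM => ?_⟩
  rw [Phi_one_eq hδ hH0 hσ, ← Real.norm_eq_abs, ← integral_mul_const]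
  refine norm_integral_le_of_norm_le ((integrableOn_W_one hδ hδ1).abs.mul_const M)
    ((ae_restrict_iff' measurableSet_Ioi).2 (Eventually.of_forall fun y hy => ?_))
  rw [norm_mul, Real.norm_eq_abs, Real.norm_eq_abs]
  refine mul_le_mul_of_nonneg_left (hM _ ?_) (abs_nonneg _)
  have : 0 ≤ σ ^ (1 / δ) * y := mul_nonneg (by positivity) (le_of_lt hy)
  linarith

include hδ hδ1 hH hH0 hHb in
lemma tendsto_Phi_one (t : ℝ) :
    Tendsto (fun σ => Phi δ 1 H σ t) (nhdsWithin 0 (Ioi 0)) (nhds (H t)) := by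
  have h1 : Tendsto (fun σ : ℝ => ∫ y in Ioi (0 : ℝ), W δ 1 1 y * H (t - σ ^ (1 / δ) * y))
      (nhdsWithin 0 (Ioi 0)) (nhds (∫ y in Ioi (0 : ℝ), W δ 1 1 y * H t)) := by
    refine tendsto_integral_filter_of_dominated_convergence (fun s => |W δ 1 1 s| * B)
      (Eventually.of_forall fun σ => ?_) (Eventually.of_forall fun σ => Eventually.of_forall
        fun y => ?_) ((integrableOn_W_one hδ hδ1).abs.mul_const B)
      (Eventually.of_forall fun y => ?_)
    · exact ((measurable_W_right δ 1 1).mul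
        (hH.measurable.comp (by fun_prop))).aestronglyMeasurable
    · rw [norm_mul, Real.norm_eq_abs, Real.norm_eq_abs]
      exact mul_le_mul_of_nonneg_left (hHb _) (abs_nonneg _)
    · have : Continuous fun σ : ℝ => W δ 1 1 y * H (t - σ ^ (1 / δ) * y) := by
        have := Real.continuous_rpow_const (q := 1 / δ) (by positivity)
        fun_prop
      have := (this.tendsto 0).mono_left (nhdsWithin_le_nhds (s := Ioi 0))
      simpa [Real.zero_rpow (inv_ne_zero hδ.ne')] using this
  rw [integral_mul_const, integral_W_one hδ hδ1, one_mul] at h1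
  refine h1.congr' ?_
  filter_upwards [self_mem_nhdsWithin] with σ hσ
  exact (Phi_one_eq hδ hH0 hσ t).symm

end

lemma lconv_comm (f g : ℝ → ℝ) (t : ℝ) : lconv f g t = lconv g f t := by
  unfold lconv
  have := intervalIntegral.integral_comp_sub_left (a := 0) (b := t)
    (fun s => f (t - s) * g s) t
  simp only [sub_sub_cancel, sub_self, sub_zero] at this
  rw [← this]
  simp only [mul_comm]

lemma integrableOn_exp_mul_of_bdd {f : ℝ → ℝ} (hf : Measurable f) {B : ℝ}
    (hb : ∀ s, |f s| ≤ B) {p : ℝ} (hp : 0 < p) :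
    IntegrableOn (fun s => Real.exp (-(p * s)) * f s) (Ioi 0) := by
  have h := exp_neg_integrableOn_Ioi 0 hp
  simp only [neg_mul] at h
  exact Integrable.mul_bdd (c := B) h hf.aestronglyMeasurable (Eventually.of_forall hb)

section
variable {δ γ : ℝ} (hδ : 0 < δ) (hδ1 : δ < 1) {H : ℝ → ℝ} (hH : Continuous H)
  (hH0 : ∀ s ≤ 0, H s = 0) {B : ℝ} (hHb : ∀ s, |H s| ≤ B)
include hδ hδ1 hH hHb

lemma laplace_Phi (hγ : 0 < γ) {σ p : ℝ} (hσ : 0 < σ) (hp : 0 < p) :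
    IntegrableOn (fun s => Real.exp (-(p * s)) * Phi δ γ H σ s) (Ioi 0) ∧
    ∫ s in Ioi (0 : ℝ), Real.exp (-(p * s)) * Phi δ γ H σ s =
      p ^ (γ - 1) * Real.exp (-(σ * p ^ δ)) * ∫ s in Ioi (0 : ℝ), Real.exp (-(p * s)) * H s := by
  have h := laplace_lconv (integrableOn_exp_mul_W hδ hδ1 hγ hσ hp)
    (integrableOn_exp_mul_of_bdd hH.measurable hHb hp)
  rw [laplace_W hδ hδ1 hγ hσ hp] at h
  exact h

lemma continuous_Phi (hγ : 0 < γ) {σ : ℝ} (hσ : 0 < σ) : Continuous (Phi δ γ H σ) :=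
  continuous_iff_continuousAt.2 fun t => (hasDerivAt_Phi_t hδ hδ1 hH hHb hγ hσ t).continuousAt

lemma lconv_Phi_W {τ w t : ℝ} (hτ : 0 < τ) (hw : 0 < w) (ht : 0 < t) :
    lconv (Phi δ 1 H τ) (W δ 1 w) t = Phi δ 1 H (τ + w) t := by
  have hL := fun p (hp : 0 < p) => laplace_lconv (laplace_Phi hδ hδ1 hH hHb one_pos hτ hp).1
    (integrableOn_exp_mul_W hδ hδ1 one_pos hw hp)
  refine eqOn_of_laplace_eq ?_
    (continuous_Phi hδ hδ1 hH hHb one_pos (add_pos hτ hw)).continuousOn (fun p hp => (hL p hp).1)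
    (fun p hp => (laplace_Phi hδ hδ1 hH hHb one_pos (add_pos hτ hw) hp).1) (fun p hp => ?_) ht
  · exact (continuous_lconv (fun T => ((continuous_W hδ hδ1 one_pos hw).integrableOn_Icc).mono_set
      Ioc_subset_Icc_self) (continuous_Phi hδ hδ1 hH hHb one_pos hτ)
      fun s hs => Phi_of_nonpos hs).continuousOn
  · rw [(hL p hp).2, (laplace_Phi hδ hδ1 hH hHb one_pos hτ hp).2,
      (laplace_Phi hδ hδ1 hH hHb one_pos (add_pos hτ hw) hp).2, laplace_W hδ hδ1 one_pos hw hp,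
      show -((τ + w) * p ^ δ) = -(τ * p ^ δ) + -(w * p ^ δ) by ring, Real.exp_add]
    simp only [sub_self, rpow_zero]
    ring

lemma caputo_Phi {σ t : ℝ} (hσ : 0 < σ) (ht : 0 < t) :
    (1 / Real.Gamma (1 - δ)) * ∫ s in (0 : ℝ)..t, Phi δ 2 H σ s * (t - s) ^ (-δ) =
      Phi δ (1 + δ) H σ t := by
  have hG : 0 < Real.Gamma (1 - δ) := Real.Gamma_pos_of_pos (by linarith)
  set c : ℝ → ℝ := fun s => (1 / Real.Gamma (1 - δ)) * s ^ (-δ) with hc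
  have e : (1 / Real.Gamma (1 - δ)) * ∫ s in (0 : ℝ)..t, Phi δ 2 H σ s * (t - s) ^ (-δ) =
      lconv (Phi δ 2 H σ) c t := by
    rw [lconv_comm, ← intervalIntegral.integral_const_mul]
    unfold lconv
    congr 1 with s
    simp only [hc]
    ring
  have hcint : ∀ p > 0, IntegrableOn (fun s => Real.exp (-(p * s)) * c s) (Ioi 0) := by
    intro p hp
    have := (integrableOn_rpow_mul_exp_neg_mul_rpow (p := 1) (s := -δ) (b := p)
      (by linarith) one_pos hp).const_mul (1 / Real.Gamma (1 - δ))
    refine IntegrableOn.congr_fun this (fun s _ => ?_) measurableSet_Ioi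
    simp only [hc, rpow_one, neg_mul]
    ring
  have hclap : ∀ p > 0, ∫ s in Ioi (0 : ℝ), Real.exp (-(p * s)) * c s = p ^ (δ - 1) := by
    intro p hp
    have := Real.integral_rpow_mul_exp_neg_mul_Ioi (a := 1 - δ) (r := p) (by linarith) hp
    have e2 : ∀ s : ℝ, Real.exp (-(p * s)) * c s =
        (1 / Real.Gamma (1 - δ)) * (s ^ (1 - δ - 1) * Real.exp (-(p * s))) := by
      intro s
      simp only [hc]
      rw [show 1 - δ - 1 = -δ by ring]
      ring
    simp_rw [e2]
    rw [integral_const_mul, this, one_div, one_div, inv_rpow hp.le, ← rpow_neg hp.le, neg_sub]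
    field_simp
  rw [e]
  have h2 : (0 : ℝ) < 2 := two_pos
  have h1δ : 0 < 1 + δ := by linarith
  have hL := fun p (hp : 0 < p) => laplace_lconv (laplace_Phi hδ hδ1 hH hHb h2 hσ hp).1
    (hcint p hp)
  refine eqOn_of_laplace_eq ?_
    (continuous_Phi hδ hδ1 hH hHb h1δ hσ).continuousOn (fun p hp => (hL p hp).1)
    (fun p hp => (laplace_Phi hδ hδ1 hH hHb h1δ hσ hp).1) (fun p hp => ?_) ht
  · refine (continuous_lconv (fun T => ?_) (continuous_Phi hδ hδ1 hH hHb h2 hσ)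
      fun s hs => Phi_of_nonpos hs).continuousOn
    rcases le_or_gt T 0 with hT | hT
    · simp [Ioc_eq_empty_of_le hT]
    · have := (intervalIntegral.intervalIntegrable_rpow' (a := 0) (b := T) (r := -δ)
        (by linarith)).const_mul (1 / Real.Gamma (1 - δ))
      exact (intervalIntegrable_iff_integrableOn_Ioc_of_le hT.le).1 this
  · rw [(hL p hp).2, (laplace_Phi hδ hδ1 hH hHb h2 hσ hp).2,
      (laplace_Phi hδ hδ1 hH hHb h1δ hσ hp).2, hclap p hp, show 1 + δ - 1 = (2 - 1) + (δ - 1) by ring,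
      rpow_add hp]
    ring

end

lemma integrableOn_rpow_mul_exp_neg_div {p c : ℝ} (hp : p < -1) (hc : 0 < c) :
    IntegrableOn (fun w => w ^ p * Real.exp (-(c / w))) (Ioi 0) := by
  have h := integrableOn_rpow_mul_exp_neg_mul_rpow (p := 1) (s := -p - 2) (b := c)
    (by linarith) one_pos hc
  rw [← integrableOn_Ioi_comp_rpow_iff' _ (show (-1 : ℝ) ≠ 0 by norm_num)] at h
  refine h.congr_fun (fun w hw => ?_) measurableSet_Ioi
  have hw : 0 < w := hw
  simp only [smul_eq_mul, rpow_one]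
  rw [← rpow_mul hw.le, ← mul_assoc, ← rpow_add hw, rpow_neg_one, neg_mul, div_eq_mul_inv]
  congr 2 <;> ring

/-- The first-passage density of drifted Brownian motion from `x`, divided by `x`. -/
noncomputable def fpKer (a lam x w : ℝ) : ℝ :=
  w ^ (-(3 / 2) : ℝ) * Real.exp (-((x - lam * w) ^ 2 / (4 * a ^ 2 * w))) / (2 * a * √π)

section
variable {a lam : ℝ} (ha : 0 < a) (hlam : 0 < lam)

lemma measurable_fpKer : Measurable fun q : ℝ × ℝ => fpKer a lam q.1 q.2 := by
  unfold fpKer; fun_prop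

lemma measurable_fpKer_right (x : ℝ) : Measurable (fpKer a lam x) := by
  unfold fpKer; fun_prop

include ha in
lemma fpKer_nonneg {x w : ℝ} (hw : 0 < w) : 0 ≤ fpKer a lam x w := by
  unfold fpKer; positivity

include ha hlam in
/-- A bound for the kernel that is uniform for `x` in a compact subset of the half-line. -/
lemma fpKer_le {x₁ x₂ x w : ℝ} (hx₁ : 0 < x₁) (h1 : x₁ ≤ x) (h2 : x ≤ x₂) (hw : 0 < w) :
    fpKer a lam x w ≤ Real.exp (lam * x₂ / (2 * a ^ 2)) / (2 * a * √π) *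
      (w ^ (-(3 / 2) : ℝ) * Real.exp (-(x₁ ^ 2 / (4 * a ^ 2) / w))) := by
  have e : -((x - lam * w) ^ 2 / (4 * a ^ 2 * w)) ≤
      lam * x₂ / (2 * a ^ 2) + -(x₁ ^ 2 / (4 * a ^ 2) / w) := by
    have e1 : -((x - lam * w) ^ 2 / (4 * a ^ 2 * w)) =
        lam * x / (2 * a ^ 2) + -(x ^ 2 / (4 * a ^ 2) / w) - lam ^ 2 * w / (4 * a ^ 2) := by
      field_simp; ring
    have e2 : lam * x / (2 * a ^ 2) ≤ lam * x₂ / (2 * a ^ 2) := by gcongr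
    have e3 : x₁ ^ 2 / (4 * a ^ 2) / w ≤ x ^ 2 / (4 * a ^ 2) / w := by gcongr
    have e4 : 0 ≤ lam ^ 2 * w / (4 * a ^ 2) := by positivity
    linarith
  calc fpKer a lam x w ≤ w ^ (-(3 / 2) : ℝ) * Real.exp (lam * x₂ / (2 * a ^ 2) +
        -(x₁ ^ 2 / (4 * a ^ 2) / w)) / (2 * a * √π) := by
        unfold fpKer; gcongr
    _ = _ := by rw [Real.exp_add]; ring

include ha in
/-- Change of variables `w = x² / y²`. -/
lemma integral_mul_fpKer {x : ℝ} (hx : 0 < x) (G : ℝ → ℝ) :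
    ∫ w in Ioi (0 : ℝ), x * fpKer a lam x w * G w =
      1 / (a * √π) * ∫ y in Ioi (0 : ℝ),
        Real.exp (-((y - lam * x / y) ^ 2 / (4 * a ^ 2))) * G (x ^ 2 / y ^ 2) := by
  have hx2 : 0 < x ^ 2 := by positivity
  have h1 := integral_comp_mul_left_Ioi (fun w => x * fpKer a lam x w * G w) 0 hx2
  rw [mul_zero, smul_eq_mul] at h1
  have h2 := integral_comp_rpow_Ioi (fun v => x * fpKer a lam x (x ^ 2 * v) * G (x ^ 2 * v))
    (show (-2 : ℝ) ≠ 0 by norm_num)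
  rw [h1] at h2
  rw [← mul_inv_cancel_left₀ hx2.ne' (∫ w in Ioi (0 : ℝ), x * fpKer a lam x w * G w), ← h2,
    ← integral_const_mul, ← integral_const_mul]
  refine setIntegral_congr_fun measurableSet_Ioi fun y hy => ?_
  have hy : 0 < y := hy
  have e0 : y ^ (-2 : ℝ) = 1 / y ^ 2 := by
    rw [rpow_neg hy.le, one_div]; norm_cast
  have e1 : x ^ 2 * y ^ (-2 : ℝ) = x ^ 2 / y ^ 2 := by rw [e0]; ring
  have e2 : (x ^ 2 / y ^ 2) ^ (-(3 / 2) : ℝ) = y ^ 3 / x ^ 3 := by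
    rw [← div_pow, ← rpow_natCast, ← rpow_mul (by positivity),
      show ((2 : ℕ) : ℝ) * (-(3 / 2)) = -((3 : ℕ) : ℝ) by norm_num, rpow_neg (by positivity),
      rpow_natCast, div_pow, inv_div]
  have e3 : y ^ ((-2 : ℝ) - 1) = 1 / y ^ 3 := by
    rw [show (-2 : ℝ) - 1 = -((3 : ℕ) : ℝ) by norm_num, rpow_neg hy.le, rpow_natCast, one_div]
  have e4 : (x - lam * (x ^ 2 / y ^ 2)) ^ 2 / (4 * a ^ 2 * (x ^ 2 / y ^ 2)) =
      (y - lam * x / y) ^ 2 / (4 * a ^ 2) := by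
    field_simp
  have hpi : √π ≠ 0 := by positivity
  simp only [smul_eq_mul]
  rw [e1, fpKer, e2, e3, e4, abs_neg, abs_two]
  field_simp

include ha hlam in
lemma integrableOn_rpow_mul_fpKer {x : ℝ} (hx : 0 < x) {p : ℝ} (hp : p < 1 / 2) :
    IntegrableOn (fun w => w ^ p * fpKer a lam x w) (Ioi 0) := by
  have h := (integrableOn_rpow_mul_exp_neg_div (p := p - 3 / 2) (c := x ^ 2 / (4 * a ^ 2))
    (by linarith) (by positivity)).const_mul (Real.exp (lam * x / (2 * a ^ 2)) / (2 * a * √π))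
  refine h.mono' (Measurable.aestronglyMeasurable
    ((measurable_id.pow_const p).mul (measurable_fpKer_right x)))
    ((ae_restrict_iff' measurableSet_Ioi).2 (Eventually.of_forall fun w hw => ?_))
  have hw : 0 < w := hw
  have hb := fpKer_le ha hlam hx le_rfl le_rfl hw
  rw [Real.norm_eq_abs, abs_of_nonneg (mul_nonneg (by positivity) (fpKer_nonneg ha hw))]
  refine (mul_le_mul_of_nonneg_left hb (by positivity)).trans_eq ?_
  rw [sub_eq_add_neg p, rpow_add hw]
  ring

lemma sq_sub_le_sq_sub_div {c y : ℝ} (hc : 0 ≤ c) (hy : 0 < y) :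
    (y - √c) ^ 2 ≤ (y - c / y) ^ 2 := by
  have hs : 0 ≤ √c := Real.sqrt_nonneg c
  have e : y - c / y = (y - √c) * ((y + √c) / y) := by
    field_simp
    nlinarith [Real.sq_sqrt hc]
  have h1 : 1 ≤ (y + √c) / y := by rw [one_le_div hy]; linarith
  rw [e, mul_pow]
  exact le_mul_of_one_le_right (sq_nonneg _) (one_le_pow₀ h1)

lemma integrable_pow_mul_exp_neg_sq_div {c : ℝ} (hc : 0 < c) (n : ℕ) :
    Integrable fun v : ℝ => v ^ n * Real.exp (-(v ^ 2 / c)) := by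
  have h := integrable_rpow_mul_exp_neg_mul_sq (b := 1 / c) (by positivity) (s := n)
    (by have : (0 : ℝ) ≤ n := Nat.cast_nonneg n; linarith)
  refine h.congr (Eventually.of_forall fun v => ?_)
  simp only [rpow_natCast]
  congr 2
  ring

include ha hlam in
lemma exists_integral_zpow_mul_fpKer_le (m : ℕ) : ∃ C, 0 ≤ C ∧ ∀ x : ℝ, 0 < x →
    ∫ w in Ioi (0 : ℝ), x * fpKer a lam x w * (w ^ m)⁻¹ ≤ C * (1 + x ^ m) / x ^ (2 * m) := by
  have hi := fun n => integrable_pow_mul_exp_neg_sq_div (c := 4 * a ^ 2) (by positivity) n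
  set I₀ := ∫ v : ℝ, v ^ 0 * Real.exp (-(v ^ 2 / (4 * a ^ 2))) with hI₀
  set I₁ := ∫ v : ℝ, v ^ (2 * m) * Real.exp (-(v ^ 2 / (4 * a ^ 2))) with hI₁
  have hI₀' : 0 ≤ I₀ := integral_nonneg fun v => by positivity
  have hI₁' : 0 ≤ I₁ := integral_nonneg fun v =>
    mul_nonneg (by rw [pow_mul]; positivity) (Real.exp_pos _).le
  refine ⟨1 / (a * √π) * 2 ^ (2 * m - 1) * (I₁ + lam ^ m * I₀), by positivity, fun x hx => ?_⟩
  have hc : 0 ≤ lam * x := by positivity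
  rw [integral_mul_fpKer ha hx]
  have hpt : ∀ v : ℝ, (v + √(lam * x)) ^ (2 * m) ≤
      2 ^ (2 * m - 1) * (v ^ (2 * m) + (lam * x) ^ m) := by
    intro v
    have h1 := add_pow_le (abs_nonneg v) (Real.sqrt_nonneg (lam * x)) (2 * m)
    have h2 : (v + √(lam * x)) ^ (2 * m) ≤ (|v| + √(lam * x)) ^ (2 * m) := by
      rw [pow_mul, pow_mul]
      refine pow_le_pow_left₀ (sq_nonneg _) (sq_le_sq.2 ?_) m
      rw [abs_of_nonneg (a := |v| + _) (by positivity)]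
      exact (abs_add_le _ _).trans (by rw [abs_of_nonneg (Real.sqrt_nonneg _)])
    refine h2.trans (h1.trans_eq ?_)
    rw [pow_mul |v|, sq_abs, ← pow_mul, pow_mul √(lam * x), Real.sq_sqrt hc]
  set D : ℝ → ℝ := fun v => 2 ^ (2 * m - 1) / x ^ (2 * m) *
    (v ^ (2 * m) * Real.exp (-(v ^ 2 / (4 * a ^ 2))) +
      (lam * x) ^ m * (v ^ 0 * Real.exp (-(v ^ 2 / (4 * a ^ 2))))) with hD
  have hDi : Integrable D := ((hi _).add ((hi 0).const_mul _)).const_mul _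
  have hD0 : ∀ v, 0 ≤ D v := fun v => by
    simp only [hD]
    rw [pow_mul v]
    positivity
  have hDint : ∫ v, D v = 2 ^ (2 * m - 1) / x ^ (2 * m) * (I₁ + (lam * x) ^ m * I₀) := by
    simp only [hD]
    rw [integral_const_mul, integral_add (hi _) ((hi 0).const_mul _), integral_const_mul]
  have hDs : Integrable fun y => D (y - √(lam * x)) := hDi.comp_sub_right _
  have h1 : ∫ y in Ioi (0 : ℝ), Real.exp (-((y - lam * x / y) ^ 2 / (4 * a ^ 2))) *
      ((x ^ 2 / y ^ 2) ^ m)⁻¹ ≤ ∫ v, D v := by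
    rw [← integral_sub_right_eq_self D √(lam * x)]
    refine le_trans (integral_mono_of_nonneg ?_ hDs.integrableOn ?_)
      (setIntegral_le_integral hDs (Eventually.of_forall fun y => hD0 _))
    · exact Eventually.of_forall fun y => by positivity
    · refine (ae_restrict_iff' measurableSet_Ioi).2 (Eventually.of_forall fun y hy => ?_)
      have hy : 0 < y := hy
      have hq := hpt (y - √(lam * x))
      rw [sub_add_cancel] at hq
      have he : Real.exp (-((y - lam * x / y) ^ 2 / (4 * a ^ 2))) ≤
          Real.exp (-((y - √(lam * x)) ^ 2 / (4 * a ^ 2))) := by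
        have := div_le_div_of_nonneg_right (sq_sub_le_sq_sub_div hc hy)
          (show 0 ≤ 4 * a ^ 2 by positivity)
        exact Real.exp_le_exp.2 (neg_le_neg this)
      have hr : ((x ^ 2 / y ^ 2) ^ m)⁻¹ = y ^ (2 * m) / x ^ (2 * m) := by
        rw [div_pow, inv_div, pow_mul, pow_mul]
      simp only [hr]
      calc _ ≤ Real.exp (-((y - √(lam * x)) ^ 2 / (4 * a ^ 2))) *
            (2 ^ (2 * m - 1) * ((y - √(lam * x)) ^ (2 * m) + (lam * x) ^ m) / x ^ (2 * m)) := by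
            gcongr
        _ = _ := by simp only [hD]; ring
  calc _ ≤ 1 / (a * √π) * (2 ^ (2 * m - 1) / x ^ (2 * m) * (I₁ + (lam * x) ^ m * I₀)) := by
        rw [← hDint]; gcongr
    _ = 1 / (a * √π) * 2 ^ (2 * m - 1) * (I₁ * 1 + lam ^ m * I₀ * x ^ m) / x ^ (2 * m) := by
        rw [mul_pow]; ring
    _ ≤ _ := by
        rw [mul_assoc _ (I₁ + lam ^ m * I₀)]
        gcongr
        have hxm : 0 ≤ x ^ m := by positivity
        have hlm : 0 ≤ lam ^ m * I₀ := by positivity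
        nlinarith

end

/-- The first-passage density of drifted Brownian motion from `x`. -/
noncomputable def fp (a lam x w : ℝ) : ℝ := x * fpKer a lam x w

/-- The logarithmic `x`-derivative of `fpKer`. -/
noncomputable def fpLog (a lam x w : ℝ) : ℝ := -((x - lam * w) / (2 * a ^ 2 * w))

/-- The first `x`-derivative of `fp`. -/
noncomputable def fpD (a lam x w : ℝ) : ℝ := (1 + x * fpLog a lam x w) * fpKer a lam x w

/-- The second `x`-derivative of `fp`. -/
noncomputable def fpDD (a lam x w : ℝ) : ℝ :=
  (2 * fpLog a lam x w + x * fpLog a lam x w ^ 2 - x / (2 * a ^ 2 * w)) * fpKer a lam x w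

section
variable {a lam : ℝ}

lemma measurable_fp : Measurable fun q : ℝ × ℝ => fp a lam q.1 q.2 :=
  measurable_fst.mul measurable_fpKer

lemma measurable_fpD : Measurable fun q : ℝ × ℝ => fpD a lam q.1 q.2 := by
  unfold fpD fpLog
  exact Measurable.mul (by fun_prop) measurable_fpKer

lemma measurable_fpDD : Measurable fun q : ℝ × ℝ => fpDD a lam q.1 q.2 := by
  unfold fpDD fpLog
  exact Measurable.mul (by fun_prop) measurable_fpKer

variable (ha : 0 < a) (hlam : 0 < lam)

include ha in
lemma hasDerivAt_fpKer {x w : ℝ} (hw : 0 < w) :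
    HasDerivAt (fun x => fpKer a lam x w) (fpLog a lam x w * fpKer a lam x w) x := by
  unfold fpKer fpLog
  have h1 : HasDerivAt (fun x => -((x - lam * w) ^ 2 / (4 * a ^ 2 * w)))
      (-((x - lam * w) / (2 * a ^ 2 * w))) x := by
    have h0 := ((((hasDerivAt_id x).sub_const (lam * w)).pow 2).div_const (4 * a ^ 2 * w)).neg
    refine h0.congr_deriv ?_
    simp only [id_eq, Nat.cast_ofNat]
    field_simp
    ring
  refine ((h1.exp.const_mul (w ^ (-(3 / 2) : ℝ))).div_const (2 * a * √π)).congr_deriv ?_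
  ring

include ha in
lemma hasDerivAt_fp {x w : ℝ} (hw : 0 < w) :
    HasDerivAt (fun x => fp a lam x w) (fpD a lam x w) x := by
  refine ((hasDerivAt_id x).mul (hasDerivAt_fpKer ha hw)).congr_deriv ?_
  simp only [id_eq, fpD]
  ring

include ha in
lemma hasDerivAt_fpD {x w : ℝ} (hw : 0 < w) :
    HasDerivAt (fun x => fpD a lam x w) (fpDD a lam x w) x := by
  have h1 : HasDerivAt (fun x => fpLog a lam x w) (-(1 / (2 * a ^ 2 * w))) x := by
    unfold fpLog
    exact (((hasDerivAt_id x).sub_const (lam * w)).div_const (2 * a ^ 2 * w)).neg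
  refine ((((hasDerivAt_id x).mul h1).const_add 1).mul (hasDerivAt_fpKer ha hw)).congr_deriv ?_
  simp only [id_eq, fpDD, Pi.mul_apply]
  ring

include ha in
lemma hasDerivAt_fp_w {x w : ℝ} (hw : 0 < w) :
    HasDerivAt (fun w => fp a lam x w) (a ^ 2 * fpDD a lam x w - lam * fpD a lam x w) w := by
  have h1 : HasDerivAt (fun w => -((x - lam * w) ^ 2 / (4 * a ^ 2 * w)))
      ((x - lam * w) * (x + lam * w) / (4 * a ^ 2 * w ^ 2)) w := by
    have h0 := (((((hasDerivAt_id w).const_mul lam).const_sub x).pow 2).div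
      ((hasDerivAt_id w).const_mul (4 * a ^ 2)) (by simp only [id_eq]; positivity)).neg
    refine h0.congr_deriv ?_
    simp only [id_eq, Nat.cast_ofNat, Pi.pow_apply]
    field_simp
    ring
  have h2 := ((((hasDerivAt_id w).rpow_const (p := -(3 / 2)) (Or.inl hw.ne')).mul
    h1.exp).div_const (2 * a * √π)).const_mul x
  refine h2.congr_deriv ?_
  have hpi : √π ≠ 0 := by positivity
  have e : w ^ (-(3 / 2) - 1 : ℝ) = w ^ (-(3 / 2) : ℝ) / w := by
    rw [rpow_sub hw, rpow_one]
  simp only [id_eq, one_mul]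
  rw [e]
  unfold fpDD fpD fpLog fpKer
  generalize w ^ (-(3 / 2) : ℝ) = X
  generalize Real.exp (-((x - lam * w) ^ 2 / (4 * a ^ 2 * w))) = Y
  field_simp
  ring

include ha hlam in
lemma abs_fpLog_le {x w : ℝ} (hx : 0 < x) (hw : 0 < w) :
    |fpLog a lam x w| ≤ x / (2 * a ^ 2 * w) + lam / (2 * a ^ 2) := by
  have e : fpLog a lam x w = lam / (2 * a ^ 2) - x / (2 * a ^ 2 * w) := by
    unfold fpLog; field_simp; ring
  have h1 : 0 ≤ x / (2 * a ^ 2 * w) := by positivity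
  have h2 : 0 ≤ lam / (2 * a ^ 2) := by positivity
  rw [e, abs_le]
  constructor <;> linarith

include ha hlam in
lemma exists_abs_fpD_le : ∃ C, 0 ≤ C ∧ ∀ x w : ℝ, 0 < x → 0 < w →
    |fpD a lam x w| ≤ C * ((1 + x + x ^ 2 / w) * fpKer a lam x w) ∧
    |fpDD a lam x w| ≤ C * ((1 + x + x / w + x ^ 3 / w ^ 2) * fpKer a lam x w) := by
  set b := 1 / (2 * a ^ 2) with hb
  have hb0 : 0 < b := by positivity
  refine ⟨1 + b + lam * b + 2 * b + b + 2 * lam * b + 2 * b ^ 2 + 2 * b ^ 2 * lam ^ 2,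
    by positivity, fun x w hx hw => ?_⟩
  set C := 1 + b + lam * b + 2 * b + b + 2 * lam * b + 2 * b ^ 2 + 2 * b ^ 2 * lam ^ 2 with hC
  have hE := fpKer_nonneg (lam := lam) ha (x := x) hw
  have hL := abs_fpLog_le ha hlam hx hw
  set L := fpLog a lam x w with hLdef
  have e1 : x / (2 * a ^ 2 * w) = b * (x / w) := by rw [hb]; field_simp
  have e2 : lam / (2 * a ^ 2) = lam * b := by rw [hb]; field_simp
  rw [e1, e2] at hL
  have hv : 0 < x / w := by positivity
  set v := x / w with hvdef
  have ev : x ^ 2 / w = x * v := by rw [hvdef]; ring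
  have ev' : x ^ 3 / w ^ 2 = x * v ^ 2 := by rw [hvdef]; ring
  have p1 : 0 < lam * b := by positivity
  have p2 : 0 < b ^ 2 := by positivity
  have p3 : 0 < b ^ 2 * lam ^ 2 := by positivity
  constructor
  · unfold fpD
    rw [abs_mul, abs_of_nonneg hE, ← mul_assoc, ev]
    refine mul_le_mul_of_nonneg_right ?_ hE
    calc |1 + x * L| ≤ 1 + x * |L| := by
          refine (abs_add_le _ _).trans ?_
          rw [abs_one, abs_mul, abs_of_pos hx]
      _ ≤ 1 + x * (b * v + lam * b) := by gcongr
      _ = 1 * 1 + (lam * b) * x + b * (x * v) := by ring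
      _ ≤ C * 1 + C * x + C * (x * v) := by
          gcongr <;> rw [hC] <;> linarith
      _ = _ := by ring
  · unfold fpDD
    rw [abs_mul, abs_of_nonneg hE, ← mul_assoc, ev', e1]
    refine mul_le_mul_of_nonneg_right ?_ hE
    calc |2 * L + x * L ^ 2 - b * v| ≤ 2 * |L| + x * |L| ^ 2 + b * v := by
          refine (abs_sub _ _).trans (add_le_add ((abs_add_le _ _).trans_eq ?_) ?_)
          · rw [abs_mul, abs_mul, abs_two, abs_of_pos hx, abs_pow]
          · rw [abs_of_pos (by positivity)]
      _ ≤ 2 * (b * v + lam * b) + x * (b * v + lam * b) ^ 2 + b * v := by gcongr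
      _ ≤ 2 * (b * v + lam * b) + x * (2 * (b * v) ^ 2 + 2 * (lam * b) ^ 2) + b * v := by
          gcongr
          nlinarith [sq_nonneg (b * v - lam * b)]
      _ = (2 * lam * b) * 1 + (2 * b ^ 2 * lam ^ 2) * x + (2 * b + b) * v +
          (2 * b ^ 2) * (x * v ^ 2) := by ring
      _ ≤ C * 1 + C * x + C * v + C * (x * v ^ 2) := by
          gcongr <;> rw [hC] <;> linarith
      _ = _ := by ring

include ha hlam in
/-- The kernel and its derivatives are dominated locally uniformly in `x`. -/
lemma exists_integrable_dom {x₁ x₂ : ℝ} (hx₁ : 0 < x₁) :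
    ∃ g : ℝ → ℝ, IntegrableOn g (Ioi 0) ∧ ∀ x w : ℝ, x₁ ≤ x → x ≤ x₂ → 0 < w →
      |fp a lam x w| ≤ g w ∧ |fpD a lam x w| ≤ g w ∧ |fpDD a lam x w| ≤ g w := by
  obtain ⟨C, hC, h⟩ := exists_abs_fpD_le ha hlam
  set c := x₁ ^ 2 / (4 * a ^ 2) with hc
  have hc0 : 0 < c := by positivity
  set D := Real.exp (lam * x₂ / (2 * a ^ 2)) / (2 * a * √π) with hD
  have hD0 : 0 < D := by positivity
  have hi : ∀ j : ℕ, IntegrableOn (fun w : ℝ => (w ^ j)⁻¹ *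
      (w ^ (-(3 / 2) : ℝ) * Real.exp (-(c / w)))) (Ioi 0) := by
    intro j
    have hj : (0 : ℝ) ≤ j := Nat.cast_nonneg j
    refine (integrableOn_rpow_mul_exp_neg_div (p := -(3 / 2) - j) (by linarith) hc0).congr_fun
      (fun w hw => ?_) measurableSet_Ioi
    simp only
    rw [rpow_sub hw, rpow_natCast]
    ring
  set S := C + 1 with hS
  set X := 1 + x₂ + x₂ ^ 2 + x₂ ^ 3 with hX
  refine ⟨fun w => S * X * D * ((w ^ 0)⁻¹ * (w ^ (-(3 / 2) : ℝ) * Real.exp (-(c / w))) +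
    (w ^ 1)⁻¹ * (w ^ (-(3 / 2) : ℝ) * Real.exp (-(c / w))) +
    (w ^ 2)⁻¹ * (w ^ (-(3 / 2) : ℝ) * Real.exp (-(c / w)))),
    (((hi 0).add (hi 1)).add (hi 2)).const_mul _, fun x w h1 h2 hw => ?_⟩
  have hx : 0 < x := hx₁.trans_le h1
  have hx2 : 0 < x₂ := hx.trans_le h2
  have q2 := pow_pos hx2 2
  have q3 := pow_pos hx2 3
  have hE := fpKer_nonneg (lam := lam) ha (x := x) hw
  have hle := fpKer_le ha hlam hx₁ h1 h2 hw
  have hw1 : (w ^ 0)⁻¹ = 1 := by simp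
  have hg : ∀ P : ℝ, P ≤ S * X * (1 + (w ^ 1)⁻¹ + (w ^ 2)⁻¹) → P * fpKer a lam x w ≤
      S * X * D * ((w ^ 0)⁻¹ * (w ^ (-(3 / 2) : ℝ) * Real.exp (-(c / w))) +
    (w ^ 1)⁻¹ * (w ^ (-(3 / 2) : ℝ) * Real.exp (-(c / w))) +
    (w ^ 2)⁻¹ * (w ^ (-(3 / 2) : ℝ) * Real.exp (-(c / w)))) := by
    intro P hP
    calc P * fpKer a lam x w ≤ S * X * (1 + (w ^ 1)⁻¹ + (w ^ 2)⁻¹) * (D *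
          (w ^ (-(3 / 2) : ℝ) * Real.exp (-(c / w)))) :=
          mul_le_mul hP hle hE (by positivity)
      _ = _ := by rw [hw1]; ring
  have hwi : 0 < w⁻¹ := inv_pos.2 hw
  have hX1 : 1 ≤ X := by rw [hX]; linarith
  refine ⟨?_, ?_, ?_⟩
  · unfold fp
    rw [abs_of_nonneg (mul_nonneg hx.le hE)]
    refine hg _ ?_
    calc x ≤ 1 * X * (1 + 0 + 0) := by rw [hX]; linarith
      _ ≤ S * X * (1 + (w ^ 1)⁻¹ + (w ^ 2)⁻¹) := by
        gcongr
        · rw [hS]; linarith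
        · positivity
        · positivity
  · refine (h x w hx hw).1.trans ?_
    rw [← mul_assoc]
    refine hg _ ?_
    calc C * (1 + x + x ^ 2 / w) ≤ C * (1 + x₂ + x₂ ^ 2 / w) := by gcongr
      _ ≤ S * (X + X * (w ^ 1)⁻¹ + X * (w ^ 2)⁻¹) := by
        refine mul_le_mul (by rw [hS]; linarith) ?_ (by positivity) (by positivity)
        have i1 : x₂ ^ 2 / w ≤ X * (w ^ 1)⁻¹ := by
          rw [pow_one, div_eq_mul_inv]
          gcongr
          rw [hX]; linarith
        have i2 : 0 ≤ X * (w ^ 2)⁻¹ := by positivity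
        have i3 : 1 + x₂ ≤ X := by rw [hX]; linarith
        linarith
      _ = _ := by ring
  · refine (h x w hx hw).2.trans ?_
    rw [← mul_assoc]
    refine hg _ ?_
    calc C * (1 + x + x / w + x ^ 3 / w ^ 2) ≤ C * (1 + x₂ + x₂ / w + x₂ ^ 3 / w ^ 2) := by
          gcongr
      _ ≤ S * (X + X * (w ^ 1)⁻¹ + X * (w ^ 2)⁻¹) := by
        refine mul_le_mul (by rw [hS]; linarith) ?_ (by positivity) (by positivity)
        have i1 : x₂ / w ≤ X * (w ^ 1)⁻¹ := by
          rw [pow_one, div_eq_mul_inv]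
          gcongr
          rw [hX]; linarith
        have i2 : x₂ ^ 3 / w ^ 2 ≤ X * (w ^ 2)⁻¹ := by
          rw [div_eq_mul_inv]
          gcongr
          rw [hX]; linarith
        have i3 : 1 + x₂ ≤ X := by rw [hX]; linarith
        linarith
      _ = _ := by ring

end

/-- Integration of the shifted function `w ↦ φ (τ + w)` against a kernel. -/
noncomputable def bInt (K : ℝ → ℝ → ℝ) (φ : ℝ → ℝ) (x τ : ℝ) : ℝ :=
  ∫ w in Ioi (0 : ℝ), K x w * φ (τ + w)

lemma measurable_bInt {K : ℝ → ℝ → ℝ} (hK : Measurable fun q : ℝ × ℝ => K q.1 q.2)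
    {φ : ℝ → ℝ} (hφ : Measurable φ) : Measurable fun q : ℝ × ℝ => bInt K φ q.1 q.2 := by
  have hm : Measurable fun p : (ℝ × ℝ) × ℝ => K p.1.1 p.2 * φ (p.1.2 + p.2) :=
    (hK.comp (by fun_prop : Measurable fun p : (ℝ × ℝ) × ℝ => (p.1.1, p.2))).mul
      (hφ.comp (by fun_prop))
  exact (StronglyMeasurable.integral_prod_right' hm.stronglyMeasurable).measurable

lemma abs_bInt_le {K : ℝ → ℝ → ℝ} {φ : ℝ → ℝ} {x τ M : ℝ} (hK : IntegrableOn (K x) (Ioi 0))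
    (hφ : ∀ w > 0, |φ (τ + w)| ≤ M) :
    |bInt K φ x τ| ≤ (∫ w in Ioi (0 : ℝ), |K x w|) * M := by
  rw [bInt, ← Real.norm_eq_abs, ← integral_mul_const]
  refine norm_integral_le_of_norm_le (hK.abs.mul_const M)
    ((ae_restrict_iff' measurableSet_Ioi).2 (Eventually.of_forall fun w hw => ?_))
  rw [norm_mul, Real.norm_eq_abs, Real.norm_eq_abs]
  exact mul_le_mul_of_nonneg_left (hφ w hw) (abs_nonneg _)

lemma integrableOn_mul_shift {K : ℝ → ℝ} {φ : ℝ → ℝ} (hφm : Measurable φ) {τ M : ℝ}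
    (hK : IntegrableOn K (Ioi 0)) (hφ : ∀ w > 0, |φ (τ + w)| ≤ M) :
    IntegrableOn (fun w => K w * φ (τ + w)) (Ioi 0) :=
  Integrable.mul_bdd (c := M) hK
    (hφm.comp (measurable_const.add measurable_id)).aestronglyMeasurable
    ((ae_restrict_iff' measurableSet_Ioi).2 (Eventually.of_forall fun w hw => hφ w hw))

section
variable {a lam : ℝ} (ha : 0 < a) (hlam : 0 < lam)
include ha hlam

lemma integrableOn_fp_mul_inv_pow {x : ℝ} (hx : 0 < x) (m : ℕ) :
    IntegrableOn (fun w => fp a lam x w * (w ^ m)⁻¹) (Ioi 0) := by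
  have hm : (0 : ℝ) ≤ m := Nat.cast_nonneg m
  have h := (integrableOn_rpow_mul_fpKer ha hlam hx (p := -m) (by linarith)).const_mul x
  refine IntegrableOn.congr_fun h (fun w hw => ?_) measurableSet_Ioi
  simp only [fp]
  rw [rpow_neg (le_of_lt hw), rpow_natCast]
  ring

lemma abs_fp_le_abs_fp_abs {x w : ℝ} (hw : 0 < w) : |fp a lam x w| ≤ |fp a lam |x| w| := by
  unfold fp
  rw [abs_mul, abs_mul, abs_abs]
  refine mul_le_mul_of_nonneg_left ?_ (abs_nonneg x)
  rw [abs_of_nonneg (fpKer_nonneg ha hw), abs_of_nonneg (fpKer_nonneg ha hw)]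
  have hsq : (|x| - lam * w) ^ 2 ≤ (x - lam * w) ^ 2 := by
    have h1 := le_abs_self x
    rw [← sub_nonneg, show (x - lam * w) ^ 2 - (|x| - lam * w) ^ 2 =
      2 * (lam * w) * (|x| - x) + (x ^ 2 - |x| ^ 2) by ring, sq_abs]
    have : 0 < lam * w := mul_pos hlam hw
    nlinarith
  unfold fpKer
  have := exp_le_exp.2 (neg_le_neg
    (div_le_div_of_nonneg_right hsq (by positivity : 0 ≤ 4 * a ^ 2 * w)))
  gcongr 2

lemma integrableOn_fp (x : ℝ) : IntegrableOn (fp a lam x) (Ioi 0) ∧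
    ∫ w in Ioi (0 : ℝ), |fp a lam x w| ≤ ∫ w in Ioi (0 : ℝ), |fp a lam |x| w| := by
  rcases eq_or_ne x 0 with rfl | hx
  · have : fp a lam 0 = 0 := by funext w; simp [fp]
    refine ⟨?_, by simp [this]⟩
    rw [this]
    exact integrable_zero _ _ _
  have hx' : 0 < |x| := abs_pos.2 hx
  have h : IntegrableOn (fp a lam |x|) (Ioi 0) := by
    simpa using integrableOn_fp_mul_inv_pow ha hlam hx' 0
  have hle : ∀ w > 0, |fp a lam x w| ≤ |fp a lam |x| w| := fun w hw =>
    abs_fp_le_abs_fp_abs ha hlam hw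
  have hi : IntegrableOn (fp a lam x) (Ioi 0) :=
    Integrable.mono h ((measurable_fpKer_right x).const_mul x).aestronglyMeasurable
      ((ae_restrict_iff' measurableSet_Ioi).2 (Eventually.of_forall fun w hw => hle w hw))
  exact ⟨hi, setIntegral_mono_on hi.abs h.abs measurableSet_Ioi hle⟩

lemma exists_integral_abs_fp_le : ∃ C, 0 ≤ C ∧ ∀ x : ℝ,
    ∫ w in Ioi (0 : ℝ), |fp a lam x w| ≤ C := by
  obtain ⟨C, hC, h⟩ := exists_integral_zpow_mul_fpKer_le ha hlam 0
  refine ⟨2 * C, by positivity, fun x => ?_⟩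
  rcases eq_or_ne x 0 with rfl | hx
  · simpa [fp] using hC
  have hx' : 0 < |x| := abs_pos.2 hx
  refine (integrableOn_fp ha hlam x).2.trans ?_
  have h1 := h |x| hx'
  have e : ∫ w in Ioi (0 : ℝ), |fp a lam |x| w| =
      ∫ w in Ioi (0 : ℝ), |x| * fpKer a lam |x| w * (w ^ 0)⁻¹ :=
    setIntegral_congr_fun measurableSet_Ioi fun w hw => by
      simp only [fp, pow_zero, inv_one, mul_one]
      exact abs_of_nonneg (mul_nonneg hx'.le (fpKer_nonneg ha hw))
  rw [e]
  norm_num at h1 ⊢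
  linarith

lemma exists_integral_abs_fpD_le : ∃ C, 0 ≤ C ∧ ∀ x : ℝ, 0 < x →
    (IntegrableOn (fpD a lam x) (Ioi 0) ∧
      ∫ w in Ioi (0 : ℝ), |fpD a lam x w| ≤ C * (1 + 1 / x)) ∧
    (IntegrableOn (fpDD a lam x) (Ioi 0) ∧
      ∫ w in Ioi (0 : ℝ), |fpDD a lam x w| ≤ C * (1 + 1 / x ^ 2)) := by
  obtain ⟨C, hC, hb⟩ := exists_abs_fpD_le ha hlam
  obtain ⟨C₀, hC₀, h₀⟩ := exists_integral_zpow_mul_fpKer_le ha hlam 0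
  obtain ⟨C₁, hC₁, h₁⟩ := exists_integral_zpow_mul_fpKer_le ha hlam 1
  obtain ⟨C₂, hC₂, h₂⟩ := exists_integral_zpow_mul_fpKer_le ha hlam 2
  set D := C * (4 * C₀ + 2 * C₁ + C₂) with hD
  refine ⟨D, by positivity, fun x hx => ?_⟩
  have i₀ := integrableOn_fp_mul_inv_pow ha hlam hx 0
  have i₁ := integrableOn_fp_mul_inv_pow ha hlam hx 1
  have i₂ := integrableOn_fp_mul_inv_pow ha hlam hx 2
  have h₀ := h₀ x hx
  have h₁ := h₁ x hx
  have h₂ := h₂ x hx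
  have hy : 0 < 1 / x := by positivity
  have hxy : x * (1 / x) = 1 := by field_simp
  have v₀ : C₀ * (1 + x ^ 0) / x ^ (2 * 0) = 2 * C₀ := by norm_num; ring
  have v₁ : C₁ * (1 + x ^ 1) / x ^ (2 * 1) = C₁ * ((1 / x) ^ 2 + 1 / x) := by
    field_simp
  have v₂ : C₂ * (1 + x ^ 2) / x ^ (2 * 2) = C₂ * ((1 / x) ^ 4 + (1 / x) ^ 2) := by
    field_simp
  rw [v₀] at h₀
  rw [v₁] at h₁
  rw [v₂] at h₂
  set y := 1 / x with hydef
  constructor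
  · have hdi := ((i₀.const_mul (y + 1)).add (i₁.const_mul x)).const_mul C
    have hpt : ∀ w > 0, |fpD a lam x w| ≤ C * ((y + 1) * (fp a lam x w * (w ^ 0)⁻¹) +
        x * (fp a lam x w * (w ^ 1)⁻¹)) := by
      intro w hw
      refine (hb x w hx hw).1.trans_eq ?_
      simp only [fp, hydef]
      field_simp
    have hi : IntegrableOn (fpD a lam x) (Ioi 0) := hdi.mono'
      (measurable_fpD.comp measurable_prodMk_left).aestronglyMeasurable
      ((ae_restrict_iff' measurableSet_Ioi).2 (Eventually.of_forall fun w hw => hpt w hw))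
    refine ⟨hi, (setIntegral_mono_on hi.abs hdi measurableSet_Ioi hpt).trans ?_⟩
    rw [integral_const_mul]
    simp only [Pi.add_apply]
    rw [integral_add (i₀.const_mul (y + 1)) (i₁.const_mul x), integral_const_mul,
      integral_const_mul, hD, mul_assoc C]
    refine mul_le_mul_of_nonneg_left ?_ hC
    calc _ ≤ (y + 1) * (2 * C₀) + x * (C₁ * (y ^ 2 + y)) := by
          gcongr <;> assumption
      _ = (y + 1) * (2 * C₀) + C₁ * (x * y) * (y + 1) := by ring
      _ ≤ _ := by rw [hxy]; nlinarith [mul_nonneg hC₀ hy.le, mul_nonneg hC₁ hy.le,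
          mul_nonneg hC₂ hy.le]
  · have hdi := (((i₀.const_mul (y + 1)).add (i₁.const_mul 1)).add
      (i₂.const_mul (x ^ 2))).const_mul C
    have hpt : ∀ w > 0, |fpDD a lam x w| ≤ C * ((y + 1) * (fp a lam x w * (w ^ 0)⁻¹) +
        1 * (fp a lam x w * (w ^ 1)⁻¹) + x ^ 2 * (fp a lam x w * (w ^ 2)⁻¹)) := by
      intro w hw
      refine (hb x w hx hw).2.trans_eq ?_
      simp only [fp, hydef]
      field_simp
    have hi : IntegrableOn (fpDD a lam x) (Ioi 0) := hdi.mono'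
      (measurable_fpDD.comp measurable_prodMk_left).aestronglyMeasurable
      ((ae_restrict_iff' measurableSet_Ioi).2 (Eventually.of_forall fun w hw => hpt w hw))
    refine ⟨hi, (setIntegral_mono_on hi.abs hdi measurableSet_Ioi hpt).trans ?_⟩
    rw [integral_const_mul]
    simp only [Pi.add_apply]
    have iadd : Integrable (fun w => (y + 1) * (fp a lam x w * (w ^ 0)⁻¹) +
        1 * (fp a lam x w * (w ^ 1)⁻¹)) (volume.restrict (Ioi 0)) :=
      (i₀.const_mul (y + 1)).add (i₁.const_mul 1)
    rw [integral_add iadd (i₂.const_mul (x ^ 2)),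
      integral_add (i₀.const_mul (y + 1)) (i₁.const_mul 1), integral_const_mul,
      integral_const_mul, integral_const_mul, hD, mul_assoc C]
    refine mul_le_mul_of_nonneg_left ?_ hC
    calc _ ≤ (y + 1) * (2 * C₀) + 1 * (C₁ * (y ^ 2 + y)) + x ^ 2 * (C₂ * (y ^ 4 + y ^ 2)) := by
          gcongr <;> assumption
      _ = (y + 1) * (2 * C₀) + C₁ * (y ^ 2 + y) + C₂ * (x * y) ^ 2 * (y ^ 2 + 1) := by ring
      _ ≤ (y ^ 2 + 1) * (4 * C₀) + C₁ * (2 * (y ^ 2 + 1)) + C₂ * 1 ^ 2 * (y ^ 2 + 1) := by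
          rw [hxy]
          have hq : y + 1 ≤ 2 * (y ^ 2 + 1) := by nlinarith [sq_nonneg (y - 1)]
          have hq' : y ^ 2 + y ≤ 2 * (y ^ 2 + 1) := by nlinarith [sq_nonneg (y - 1)]
          nlinarith [mul_le_mul_of_nonneg_left hq hC₀, mul_le_mul_of_nonneg_left hq' hC₁]
      _ = _ := by rw [hydef]; ring

end

lemma hasDerivAt_setIntegral_Ioi {F F' : ℝ → ℝ → ℝ} {x₀ : ℝ} {s : Set ℝ} {g : ℝ → ℝ}
    (hs : s ∈ nhds x₀) (hFm : ∀ x, Measurable (F x)) (hF : IntegrableOn (F x₀) (Ioi 0))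
    (hF'm : Measurable (F' x₀)) (hb : ∀ y > 0, ∀ x ∈ s, |F' x y| ≤ g y)
    (hg : IntegrableOn g (Ioi 0)) (hd : ∀ y > 0, ∀ x ∈ s, HasDerivAt (F · y) (F' x y) x) :
    HasDerivAt (fun x => ∫ y in Ioi (0 : ℝ), F x y) (∫ y in Ioi (0 : ℝ), F' x₀ y) x₀ :=
  (hasDerivAt_integral_of_dominated_loc_of_deriv_le (μ := volume.restrict (Ioi 0)) hs
    (Eventually.of_forall fun x => (hFm x).aestronglyMeasurable) hF
    hF'm.aestronglyMeasurable
    ((ae_restrict_iff' measurableSet_Ioi).2 (Eventually.of_forall hb)) hg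
    ((ae_restrict_iff' measurableSet_Ioi).2 (Eventually.of_forall hd))).2

lemma integral_Ioi_mul_deriv_eq_neg {u v u' v' : ℝ → ℝ}
    (hu : ∀ x > 0, HasDerivAt u (u' x) x) (hv : ∀ x > 0, HasDerivAt v (v' x) x)
    (huv : IntegrableOn (fun x => u x * v x) (Ioi 0))
    (huv' : IntegrableOn (fun x => u x * v' x) (Ioi 0))
    (hu'v : IntegrableOn (fun x => u' x * v x) (Ioi 0))
    (h0 : Tendsto (fun x => u x * v x) (nhdsWithin 0 (Ioi 0)) (nhds 0)) :
    ∫ x in Ioi (0 : ℝ), u x * v' x = -∫ x in Ioi (0 : ℝ), u' x * v x := by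
  have hinf : Tendsto (fun x => u x * v x) atTop (nhds 0) :=
    tendsto_zero_of_hasDerivAt_of_integrableOn_Ioi (a := 0)
      (f' := fun x => u' x * v x + u x * v' x)
      (fun x hx => (hu x hx).mul (hv x hx)) (hu'v.add huv') huv
  have := integral_Ioi_mul_deriv_eq_deriv_mul (a := 0) hu hv huv' hu'v h0 hinf
  simpa using this

lemma tendsto_rpow_mul_exp_neg_div (p : ℝ) {c : ℝ} (hc : 0 < c) :
    Tendsto (fun w : ℝ => w ^ p * Real.exp (-(c / w))) (nhdsWithin 0 (Ioi 0)) (nhds 0) := by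
  refine ((tendsto_rpow_mul_exp_neg_mul_atTop_nhds_zero (-p) c hc).comp
    tendsto_inv_nhdsGT_zero).congr' ?_
  filter_upwards [self_mem_nhdsWithin] with w hw
  have hw' : 0 < w := hw
  simp only [Function.comp_apply]
  rw [inv_rpow hw'.le, rpow_neg hw'.le, inv_inv, neg_mul, div_eq_mul_inv]

/-- A bounded function on `(0, ∞)` whose derivative has at most a power singularity. -/
structure Profile (φ φ' : ℝ → ℝ) (C k : ℝ) : Prop where
  meas : Measurable φ
  meas' : Measurable φ'
  nonneg : 0 ≤ C
  exp_nonneg : 0 ≤ k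
  deriv : ∀ σ > 0, HasDerivAt φ (φ' σ) σ
  bound : ∀ σ > 0, |φ σ| ≤ C
  bound' : ∀ σ > 0, |φ' σ| ≤ C * σ ^ (-k)

lemma Profile.bound_shift {φ φ' : ℝ → ℝ} {C k : ℝ} (h : Profile φ φ' C k) {τ w : ℝ}
    (hτ : 0 < τ) (hw : 0 < w) : |φ (τ + w)| ≤ C := h.bound _ (by positivity)

lemma Profile.bound_shift' {φ φ' : ℝ → ℝ} {C k : ℝ} (h : Profile φ φ' C k) {τ τ₀ w : ℝ}
    (hτ₀ : 0 < τ₀) (hτ : τ₀ ≤ τ) (hw : 0 < w) : |φ' (τ + w)| ≤ C * τ₀ ^ (-k) :=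
  (h.bound' _ (by linarith)).trans (mul_le_mul_of_nonneg_left
    (rpow_le_rpow_of_nonpos hτ₀ (by linarith) (neg_nonpos.2 h.exp_nonneg)) h.nonneg)

section
variable {a lam : ℝ} (ha : 0 < a) (hlam : 0 < lam) {φ φ' : ℝ → ℝ} {C k : ℝ}
  (hφ : Profile φ φ' C k)
include ha hlam hφ

omit ha hlam in
lemma Profile.measurable_mul_shift {K : ℝ → ℝ → ℝ} (hK : Measurable fun q : ℝ × ℝ => K q.1 q.2)
    (x τ : ℝ) : Measurable fun w => K x w * φ (τ + w) :=
  (hK.comp measurable_prodMk_left).mul (hφ.meas.comp (by fun_prop))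

omit ha hlam in
lemma Profile.measurable_mul_shift' {K : ℝ → ℝ → ℝ} (hK : Measurable fun q : ℝ × ℝ => K q.1 q.2)
    (x τ : ℝ) : Measurable fun w => K x w * φ' (τ + w) :=
  (hK.comp measurable_prodMk_left).mul (hφ.meas'.comp (by fun_prop))

lemma hasDerivAt_bInt_x {x τ : ℝ} (hx : 0 < x) (hτ : 0 < τ) :
    HasDerivAt (fun x => bInt (fp a lam) φ x τ) (bInt (fpD a lam) φ x τ) x ∧
    HasDerivAt (fun x => bInt (fpD a lam) φ x τ) (bInt (fpDD a lam) φ x τ) x := by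
  obtain ⟨g, hg, hgb⟩ := exists_integrable_dom ha hlam (x₁ := x / 2) (x₂ := 2 * x) (by positivity)
  have hs : Icc (x / 2) (2 * x) ∈ nhds x := Icc_mem_nhds (by linarith) (by linarith)
  obtain ⟨C', -, hC'⟩ := exists_integral_abs_fpD_le ha hlam
  have hsh : ∀ w > 0, |φ (τ + w)| ≤ C := fun w hw => hφ.bound_shift hτ hw
  constructor
  · refine hasDerivAt_setIntegral_Ioi (g := fun w => g w * C) hs
      (fun x => hφ.measurable_mul_shift measurable_fp x τ)
      (integrableOn_mul_shift hφ.meas (integrableOn_fp ha hlam x).1 hsh)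
      (hφ.measurable_mul_shift measurable_fpD x τ) (fun w hw y hy => ?_) (hg.mul_const C)
      fun w hw y hy => (hasDerivAt_fp ha hw).mul_const _
    rw [abs_mul]
    have := (hgb y w hy.1 hy.2 hw).2.1
    exact mul_le_mul this (hsh w hw) (abs_nonneg _) ((abs_nonneg _).trans this)
  · refine hasDerivAt_setIntegral_Ioi (g := fun w => g w * C) hs
      (fun x => hφ.measurable_mul_shift measurable_fpD x τ)
      (integrableOn_mul_shift hφ.meas (hC' x hx).1.1 hsh)
      (hφ.measurable_mul_shift measurable_fpDD x τ) (fun w hw y hy => ?_) (hg.mul_const C)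
      fun w hw y hy => (hasDerivAt_fpD ha hw).mul_const _
    rw [abs_mul]
    have := (hgb y w hy.1 hy.2 hw).2.2
    exact mul_le_mul this (hsh w hw) (abs_nonneg _) ((abs_nonneg _).trans this)

omit hφ in
lemma tendsto_fp_zero {x : ℝ} (hx : 0 < x) :
    Tendsto (fun w => fp a lam x w) (nhdsWithin 0 (Ioi 0)) (nhds 0) := by
  have h := (tendsto_rpow_mul_exp_neg_div (-(3 / 2)) (c := x ^ 2 / (4 * a ^ 2))
    (by positivity)).const_mul (x * (Real.exp (lam * x / (2 * a ^ 2)) / (2 * a * √π)))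
  rw [mul_zero] at h
  refine squeeze_zero_norm' ?_ h
  filter_upwards [self_mem_nhdsWithin] with w hw
  rw [Real.norm_eq_abs, fp, abs_of_nonneg (mul_nonneg hx.le (fpKer_nonneg ha hw)), mul_assoc]
  exact mul_le_mul_of_nonneg_left (fpKer_le ha hlam hx le_rfl le_rfl hw) hx.le

/-- The kernel equation, transferred to the profile by integration by parts. -/
lemma bInt_fpDD_sub {x τ : ℝ} (hx : 0 < x) (hτ : 0 < τ) :
    a ^ 2 * bInt (fpDD a lam) φ x τ - lam * bInt (fpD a lam) φ x τ =
      -bInt (fp a lam) φ' x τ := by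
  obtain ⟨C', -, hC'⟩ := exists_integral_abs_fpD_le ha hlam
  have hsh : ∀ w > 0, |φ (τ + w)| ≤ C := fun w hw => hφ.bound_shift hτ hw
  have hsh' : ∀ w > 0, |φ' (τ + w)| ≤ C * τ ^ (-k) := fun w hw => hφ.bound_shift' hτ le_rfl hw
  have i0 := integrableOn_mul_shift hφ.meas (integrableOn_fp ha hlam x).1 hsh
  have i1 := integrableOn_mul_shift hφ.meas (hC' x hx).1.1 hsh
  have i2 := integrableOn_mul_shift hφ.meas (hC' x hx).2.1 hsh
  have i3 := integrableOn_mul_shift hφ.meas' (integrableOn_fp ha hlam x).1 hsh'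
  have e : ∀ w, (a ^ 2 * fpDD a lam x w - lam * fpD a lam x w) * φ (τ + w) =
      a ^ 2 * (fpDD a lam x w * φ (τ + w)) - lam * (fpD a lam x w * φ (τ + w)) := by
    intro w; ring
  have h := integral_Ioi_mul_deriv_eq_neg (u := fun w => fp a lam x w) (v := fun w => φ (τ + w))
    (u' := fun w => a ^ 2 * fpDD a lam x w - lam * fpD a lam x w) (v' := fun w => φ' (τ + w))
    (fun w hw => hasDerivAt_fp_w ha hw)
    (fun w hw => (hφ.deriv (τ + w) (add_pos hτ hw)).comp_const_add τ w) i0 i3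
    (by simp only [e]; exact (i2.const_mul _).sub (i1.const_mul _)) ?_
  · simp only [e] at h
    rw [integral_sub (i2.const_mul _) (i1.const_mul _), integral_const_mul,
      integral_const_mul] at h
    unfold bInt
    linarith
  · refine bdd_le_mul_tendsto_zero' C ?_ (tendsto_fp_zero ha hlam hx) |>.congr fun w => mul_comm _ _
    filter_upwards [self_mem_nhdsWithin] with w hw using hsh w hw

lemma hasDerivAt_bInt_diag {α τ : ℝ} (hα : 0 < α) (hτ : 0 < τ) :
    HasDerivAt (fun τ => bInt (fp a lam) φ (α * τ) τ)
      (α * bInt (fpD a lam) φ (α * τ) τ + bInt (fp a lam) φ' (α * τ) τ) τ := by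
  obtain ⟨g, hg, hgb⟩ := exists_integrable_dom ha hlam (x₁ := α * (τ / 2)) (x₂ := α * (2 * τ))
    (by positivity)
  have hs : Icc (τ / 2) (2 * τ) ∈ nhds τ := Icc_mem_nhds (by linarith) (by linarith)
  obtain ⟨C', -, hC'⟩ := exists_integral_abs_fpD_le ha hlam
  have hsh : ∀ w > 0, |φ (τ + w)| ≤ C := fun w hw => hφ.bound_shift hτ hw
  have hsh' : ∀ w > 0, |φ' (τ + w)| ≤ C * τ ^ (-k) := fun w hw => hφ.bound_shift' hτ le_rfl hw
  have hx : 0 < α * τ := by positivity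
  have i1 := integrableOn_mul_shift hφ.meas (hC' _ hx).1.1 hsh
  have i3 := integrableOn_mul_shift hφ.meas' (integrableOn_fp ha hlam (α * τ)).1 hsh'
  have key := hasDerivAt_setIntegral_Ioi (x₀ := τ)
    (F := fun τ w => fp a lam (α * τ) w * φ (τ + w))
    (F' := fun τ w => α * (fpD a lam (α * τ) w * φ (τ + w)) + fp a lam (α * τ) w * φ' (τ + w))
    (g := fun w => g w * (α * C + C * (τ / 2) ^ (-k))) hs
      (fun τ => hφ.measurable_mul_shift measurable_fp _ τ)
      (integrableOn_mul_shift hφ.meas (integrableOn_fp ha hlam _).1 hsh)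
      (((hφ.measurable_mul_shift measurable_fpD _ τ).const_mul α).add
        (hφ.measurable_mul_shift' measurable_fp _ τ))
      (fun w hw y hy => ?_) (hg.mul_const _) fun w hw y hy => ?_
  · refine key.congr_deriv ?_
    rw [integral_add (i1.const_mul α) i3, integral_const_mul]
    rfl
  · have hy0 : 0 < y := by linarith [hy.1]
    obtain ⟨b0, b1, -⟩ := hgb (α * y) w (mul_le_mul_of_nonneg_left hy.1 hα.le)
      (mul_le_mul_of_nonneg_left hy.2 hα.le) hw
    refine (abs_add_le _ _).trans ?_
    rw [abs_mul, abs_mul, abs_mul, abs_of_pos hα]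
    have h1 := mul_le_mul b1 (hφ.bound_shift hy0 hw) (abs_nonneg _) ((abs_nonneg _).trans b1)
    have h2 := mul_le_mul b0 (hφ.bound_shift' (by linarith) hy.1 hw) (abs_nonneg _)
      ((abs_nonneg _).trans b0)
    nlinarith [mul_le_mul_of_nonneg_left h1 hα.le]
  · have hy0 : 0 < y := by linarith [hy.1]
    have h1 := (hasDerivAt_fp (lam := lam) (x := α * y) ha hw).comp y
      ((hasDerivAt_id y).const_mul α)
    have h2 := (hφ.deriv (y + w) (add_pos hy0 hw)).comp_add_const y w
    refine (h1.mul h2).congr_deriv ?_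
    simp only [Function.comp_apply, mul_one]
    ring

end

/-- The radial subordination kernel. -/
noncomputable def rKer (ν r τ : ℝ) : ℝ :=
  τ ^ (-(ν + 1)) * (r / 2) ^ (2 * ν) * Real.exp (-r ^ 2 / (4 * τ))

/-- The first `r`-derivative of `rKer`. -/
noncomputable def rKerD (ν r τ : ℝ) : ℝ := (2 * ν / r - r / (2 * τ)) * rKer ν r τ

/-- The second `r`-derivative of `rKer`. -/
noncomputable def rKerDD (ν r τ : ℝ) : ℝ :=
  ((2 * ν / r - r / (2 * τ)) ^ 2 - 2 * ν / r ^ 2 - 1 / (2 * τ)) * rKer ν r τ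

/-- The `τ`-derivative of `rKer`. -/
noncomputable def rKerT (ν r τ : ℝ) : ℝ :=
  (-(ν + 1) / τ + r ^ 2 / (4 * τ ^ 2)) * rKer ν r τ

lemma measurable_rKer (ν r : ℝ) : Measurable (rKer ν r) := by
  unfold rKer; fun_prop

lemma measurable_rKerD (ν r : ℝ) : Measurable (rKerD ν r) := by
  unfold rKerD; exact Measurable.mul (by fun_prop) (measurable_rKer ν r)

lemma measurable_rKerDD (ν r : ℝ) : Measurable (rKerDD ν r) := by
  unfold rKerDD; exact Measurable.mul (by fun_prop) (measurable_rKer ν r)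

section
variable {ν : ℝ} (hν : 0 < ν)

lemma rKer_nonneg {r τ : ℝ} (hr : 0 < r) (hτ : 0 < τ) : 0 ≤ rKer ν r τ := by
  unfold rKer; positivity

lemma hasDerivAt_rKer {r τ : ℝ} (hr : 0 < r) (hτ : 0 < τ) :
    HasDerivAt (fun r => rKer ν r τ) (rKerD ν r τ) r := by
  unfold rKerD rKer
  have h1 : HasDerivAt (fun r : ℝ => (r / 2) ^ (2 * ν)) (2 * ν / r * (r / 2) ^ (2 * ν)) r := by
    refine (((hasDerivAt_id r).div_const 2).rpow_const (p := 2 * ν)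
      (Or.inl (by simp only [id_eq]; positivity))).congr_deriv ?_
    simp only [id_eq]
    rw [rpow_sub (by positivity), rpow_one]
    generalize (r / 2) ^ (2 * ν) = y
    field_simp
  have h2 : HasDerivAt (fun r : ℝ => Real.exp (-r ^ 2 / (4 * τ)))
      (-(r / (2 * τ)) * Real.exp (-r ^ 2 / (4 * τ))) r := by
    refine (((((hasDerivAt_id r).pow 2).neg).div_const (4 * τ)).exp).congr_deriv ?_
    simp only [id_eq, Pi.pow_apply, Pi.neg_apply]
    generalize Real.exp _ = y
    push_cast
    field_simp
    ring
  refine ((h1.const_mul (τ ^ (-(ν + 1)))).mul h2).congr_deriv ?_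
  ring

lemma hasDerivAt_rKerD {r τ : ℝ} (hr : 0 < r) (hτ : 0 < τ) :
    HasDerivAt (fun r => rKerD ν r τ) (rKerDD ν r τ) r := by
  unfold rKerDD
  have h1 : HasDerivAt (fun r : ℝ => 2 * ν / r - r / (2 * τ))
      (-(2 * ν / r ^ 2) - 1 / (2 * τ)) r := by
    refine (((hasDerivAt_inv hr.ne').const_mul (2 * ν)).sub
      ((hasDerivAt_id r).div_const (2 * τ))).congr_deriv ?_
    field_simp
  refine (h1.mul (hasDerivAt_rKer hr hτ)).congr_deriv ?_
  simp only [rKerD]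
  ring

lemma hasDerivAt_rKer_tau {r τ : ℝ} (hτ : 0 < τ) :
    HasDerivAt (fun τ => rKer ν r τ) (rKerT ν r τ) τ := by
  unfold rKerT rKer
  have h1 : HasDerivAt (fun τ : ℝ => τ ^ (-(ν + 1))) (-(ν + 1) / τ * τ ^ (-(ν + 1))) τ := by
    refine (hasDerivAt_rpow_const (p := -(ν + 1)) (Or.inl hτ.ne')).congr_deriv ?_
    rw [rpow_sub hτ, rpow_one]
    ring
  have h2 : HasDerivAt (fun τ : ℝ => Real.exp (-r ^ 2 / (4 * τ)))
      (r ^ 2 / (4 * τ ^ 2) * Real.exp (-r ^ 2 / (4 * τ))) τ := by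
    refine (((hasDerivAt_const τ (-r ^ 2)).div ((hasDerivAt_id τ).const_mul 4)
      (by simp only [id_eq]; positivity)).exp).congr_deriv ?_
    simp only [id_eq, Pi.div_apply]
    generalize Real.exp _ = y
    field_simp
    ring
  refine ((h1.mul_const ((r / 2) ^ (2 * ν))).mul h2).congr_deriv ?_
  ring

lemma rKerDD_add {r τ : ℝ} (hr : 0 < r) (hτ : 0 < τ) :
    rKerDD ν r τ + (1 - 2 * ν) / r * rKerD ν r τ = rKerT ν r τ := by
  unfold rKerDD rKerD rKerT
  generalize rKer ν r τ = y
  field_simp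
  ring

include hν

lemma integrableOn_rpow_exp_inv_pow {c : ℝ} (hc : 0 < c) {q : ℝ} (hq : 0 ≤ q) :
    IntegrableOn (fun τ : ℝ => τ ^ (-(ν + 1)) * Real.exp (-(c / τ)) * τ ^ (-q)) (Ioi 0) := by
  refine IntegrableOn.congr_fun (integrableOn_rpow_mul_exp_neg_div (p := -(ν + 1) + -q)
    (by linarith) hc) (fun τ hτ => ?_) measurableSet_Ioi
  simp only [rpow_add hτ]
  ring

lemma integrableOn_rKer_mul_rpow {r q : ℝ} (hr : 0 < r) (hq : 0 ≤ q) :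
    IntegrableOn (fun τ => rKer ν r τ * τ ^ (-q)) (Ioi 0) := by
  refine IntegrableOn.congr_fun ((integrableOn_rpow_exp_inv_pow hν
    (c := r ^ 2 / 4) (by positivity) hq).const_mul ((r / 2) ^ (2 * ν)))
    (fun τ hτ => ?_) measurableSet_Ioi
  have hτ' : 0 < τ := hτ
  simp only [rKer]
  rw [show -r ^ 2 / (4 * τ) = -(r ^ 2 / 4 / τ) by field_simp]
  ring

lemma integrableOn_rKer {r : ℝ} (hr : 0 < r) : IntegrableOn (rKer ν r) (Ioi 0) := by
  simpa using integrableOn_rKer_mul_rpow hν hr le_rfl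

lemma integrableOn_rKer_mul_inv {r : ℝ} (hr : 0 < r) :
    IntegrableOn (fun τ => rKer ν r τ * τ⁻¹) (Ioi 0) := by
  simpa [rpow_neg_one] using integrableOn_rKer_mul_rpow hν hr zero_le_one

lemma integrableOn_rKer_mul {r : ℝ} (hr : 0 < r) {b : ℝ → ℝ} (hb : Measurable b) {M q : ℝ}
    (hq : 0 ≤ q) (hbM : ∀ τ > 0, |b τ| ≤ M * (1 + τ⁻¹ + τ ^ (-q))) :
    IntegrableOn (fun τ => rKer ν r τ * b τ) (Ioi 0) := by
  have h := (((integrableOn_rKer hν hr).add (integrableOn_rKer_mul_inv hν hr)).add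
    (integrableOn_rKer_mul_rpow hν hr hq)).const_mul M
  refine h.mono' ((measurable_rKer ν r).mul hb).aestronglyMeasurable
    ((ae_restrict_iff' measurableSet_Ioi).2 (Eventually.of_forall fun τ hτ => ?_))
  rw [norm_mul, Real.norm_eq_abs, Real.norm_eq_abs, abs_of_nonneg (rKer_nonneg hr hτ)]
  refine (mul_le_mul_of_nonneg_left (hbM τ hτ) (rKer_nonneg hr hτ)).trans_eq ?_
  simp only [Pi.add_apply]
  ring

lemma exists_rKer_dom {r : ℝ} (hr : 0 < r) : ∃ g : ℝ → ℝ, IntegrableOn g (Ioi 0) ∧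
    ∀ r' τ, r / 2 ≤ r' → r' ≤ 2 * r → 0 < τ →
      |rKerD ν r' τ| ≤ g τ ∧ |rKerDD ν r' τ| ≤ g τ := by
  have hc : 0 < r ^ 2 / 16 := by positivity
  have hi := fun q (hq : (0 : ℝ) ≤ q) => integrableOn_rpow_exp_inv_pow hν hc hq
  set K := 4 * ν / r + r + 32 * ν ^ 2 / r ^ 2 + 8 * ν / r ^ 2 + 1 / 2 + 2 * r ^ 2 with hK
  refine ⟨_, (((hi 0 le_rfl).add (hi 1 zero_le_one)).add (hi 2 zero_le_two)).const_mul
    (r ^ (2 * ν) * K), fun r' τ h1 h2 hτ => ?_⟩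
  have hr' : 0 < r' := by linarith
  simp only [Pi.add_apply]
  set E := τ ^ (-(ν + 1)) * Real.exp (-(r ^ 2 / 16 / τ)) with hE
  have hE0 : 0 ≤ E := by positivity
  have hker : rKer ν r' τ ≤ r ^ (2 * ν) * E := by
    rw [hE, rKer]
    have e1 : (r' / 2) ^ (2 * ν) ≤ r ^ (2 * ν) :=
      rpow_le_rpow (by positivity) (by linarith) (by positivity)
    have e2 : Real.exp (-r' ^ 2 / (4 * τ)) ≤ Real.exp (-(r ^ 2 / 16 / τ)) := by
      apply Real.exp_le_exp.2
      rw [neg_div, neg_le_neg_iff, div_div, div_le_div_iff₀ (by positivity) (by positivity)]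
      have : r ^ 2 ≤ 4 * r' ^ 2 := by nlinarith
      nlinarith
    calc _ ≤ τ ^ (-(ν + 1)) * r ^ (2 * ν) * Real.exp (-(r ^ 2 / 16 / τ)) := by gcongr
      _ = _ := by ring
  have hker0 := rKer_nonneg (ν := ν) hr' hτ
  set y := τ⁻¹ with hy
  have hy0 : 0 < y := inv_pos.2 hτ
  have hs : E * τ ^ (-0 : ℝ) + E * τ ^ (-1 : ℝ) + E * τ ^ (-2 : ℝ) = E * (1 + y + y ^ 2) := by
    rw [neg_zero, rpow_zero, rpow_neg_one, rpow_neg hτ.le, rpow_two, hy, inv_pow]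
    ring
  rw [hs]
  have q1 : |2 * ν / r'| ≤ 4 * ν / r := by
    rw [abs_of_pos (by positivity), div_le_div_iff₀ hr' hr]
    nlinarith
  have q2 : |r' / (2 * τ)| ≤ r * y := by
    rw [abs_of_pos (by positivity), hy, ← div_eq_mul_inv, div_le_div_iff₀ (by positivity) hτ]
    nlinarith
  have q3 : 2 * ν / r' ^ 2 ≤ 8 * ν / r ^ 2 := by
    rw [div_le_div_iff₀ (by positivity) (by positivity)]
    have : r ^ 2 ≤ 4 * r' ^ 2 := by nlinarith
    nlinarith
  have q3' : 0 < 2 * ν / r' ^ 2 := by positivity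
  have q4 : 1 / (2 * τ) = 1 / 2 * y := by rw [hy]; field_simp
  have q5 : |2 * ν / r' - r' / (2 * τ)| ≤ 4 * ν / r + r * y :=
    (abs_sub _ _).trans (add_le_add q1 q2)
  have p1 : 0 < 4 * ν / r := by positivity
  have p2 : 0 < 32 * ν ^ 2 / r ^ 2 := by positivity
  have p3 : 0 < 8 * ν / r ^ 2 := by positivity
  have hK0 : 0 < K := by positivity
  have fin : ∀ c, |c| ≤ K * (1 + y + y ^ 2) →
      |c * rKer ν r' τ| ≤ r ^ (2 * ν) * K * (E * (1 + y + y ^ 2)) := by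
    intro c hcb
    rw [abs_mul, abs_of_nonneg hker0]
    calc _ ≤ K * (1 + y + y ^ 2) * (r ^ (2 * ν) * E) := by gcongr
      _ = _ := by ring
  constructor
  · refine fin _ (q5.trans ?_)
    rw [hK]
    nlinarith [mul_pos p1 hy0, mul_pos p2 hy0, mul_pos p3 hy0, mul_pos hr hy0, sq_nonneg y,
      mul_nonneg hK0.le (sq_nonneg y), mul_pos (mul_pos hr hr) hy0]
  · refine fin _ ?_
    have s1 : (2 * ν / r' - r' / (2 * τ)) ^ 2 ≤ 32 * ν ^ 2 / r ^ 2 + 2 * r ^ 2 * y ^ 2 := by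
      rw [← sq_abs]
      calc _ ≤ (4 * ν / r + r * y) ^ 2 := by gcongr
        _ ≤ 2 * (4 * ν / r) ^ 2 + 2 * (r * y) ^ 2 := by nlinarith [sq_nonneg (4 * ν / r - r * y)]
        _ = _ := by ring
    rw [q4, abs_le]
    have s0 := sq_nonneg (2 * ν / r' - r' / (2 * τ))
    have hr2 : 0 < r ^ 2 := by positivity
    have t1 : 32 * ν ^ 2 / r ^ 2 + 2 * r ^ 2 * y ^ 2 + 8 * ν / r ^ 2 + 1 / 2 * y ≤
        K * (1 + y + y ^ 2) := by
      rw [hK]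
      have := mul_pos p1 hy0
      have := mul_pos p2 hy0
      have := mul_pos p3 hy0
      have := mul_pos hr hy0
      have := mul_pos hr2 hy0
      have := mul_nonneg p1.le (sq_nonneg y)
      have := mul_nonneg p2.le (sq_nonneg y)
      have := mul_nonneg p3.le (sq_nonneg y)
      have := mul_nonneg hr.le (sq_nonneg y)
      have := sq_nonneg y
      linarith
    constructor <;> linarith

lemma hasDerivAt_integral_rKer {r : ℝ} (hr : 0 < r) {b : ℝ → ℝ} (hb : Measurable b) {M : ℝ}
    (hbM : ∀ τ > 0, |b τ| ≤ M) :
    HasDerivAt (fun r => ∫ τ in Ioi (0 : ℝ), rKer ν r τ * b τ)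
      (∫ τ in Ioi (0 : ℝ), rKerD ν r τ * b τ) r ∧
    HasDerivAt (fun r => ∫ τ in Ioi (0 : ℝ), rKerD ν r τ * b τ)
      (∫ τ in Ioi (0 : ℝ), rKerDD ν r τ * b τ) r ∧
    IntegrableOn (fun τ => rKerD ν r τ * b τ) (Ioi 0) ∧
    IntegrableOn (fun τ => rKerDD ν r τ * b τ) (Ioi 0) := by
  obtain ⟨g, hg, hgb⟩ := exists_rKer_dom hν hr
  have hs : Icc (r / 2) (2 * r) ∈ nhds r := Icc_mem_nhds (by linarith) (by linarith)
  have hbd : ∀ x y τ : ℝ, 0 < τ → |x| ≤ y → |x * b τ| ≤ y * M := fun x y τ hτ hxy => by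
    rw [abs_mul]
    exact mul_le_mul hxy (hbM τ hτ) (abs_nonneg _) ((abs_nonneg _).trans hxy)
  have hbae : ∀ᵐ τ ∂volume.restrict (Ioi (0 : ℝ)), ‖b τ‖ ≤ M :=
    (ae_restrict_iff' measurableSet_Ioi).2 (Eventually.of_forall hbM)
  have i0 : IntegrableOn (fun τ => rKer ν r τ * b τ) (Ioi 0) :=
    Integrable.mul_bdd (c := M) (integrableOn_rKer hν hr) hb.aestronglyMeasurable hbae
  have i1 : IntegrableOn (fun τ => rKerD ν r τ * b τ) (Ioi 0) :=
    Integrable.mono' (hg.mul_const M) ((measurable_rKerD ν r).mul hb).aestronglyMeasurable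
      ((ae_restrict_iff' measurableSet_Ioi).2 (Eventually.of_forall fun τ hτ =>
        hbd _ _ τ hτ (hgb r τ (by linarith) (by linarith) hτ).1))
  have i2 : IntegrableOn (fun τ => rKerDD ν r τ * b τ) (Ioi 0) :=
    Integrable.mono' (hg.mul_const M) ((measurable_rKerDD ν r).mul hb).aestronglyMeasurable
      ((ae_restrict_iff' measurableSet_Ioi).2 (Eventually.of_forall fun τ hτ =>
        hbd _ _ τ hτ (hgb r τ (by linarith) (by linarith) hτ).2))
  refine ⟨?_, ?_, i1, i2⟩
  · exact hasDerivAt_setIntegral_Ioi hs (fun r => (measurable_rKer ν r).mul hb) i0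
      ((measurable_rKerD ν r).mul hb)
      (fun τ hτ y hy => hbd _ _ τ hτ (hgb y τ hy.1 hy.2 hτ).1) (hg.mul_const M)
      fun τ hτ y hy => (hasDerivAt_rKer (by linarith [hy.1]) hτ).mul_const _
  · exact hasDerivAt_setIntegral_Ioi hs (fun r => (measurable_rKerD ν r).mul hb) i1
      ((measurable_rKerDD ν r).mul hb)
      (fun τ hτ y hy => hbd _ _ τ hτ (hgb y τ hy.1 hy.2 hτ).2) (hg.mul_const M)
      fun τ hτ y hy => (hasDerivAt_rKerD (by linarith [hy.1]) hτ).mul_const _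

/-- The Bessel operator in `r` falls on the weight as minus a `τ`-derivative. -/
lemma bessel_integral_rKer {r : ℝ} (hr : 0 < r) {b b' : ℝ → ℝ} (hb : Measurable b)
    (hb' : Measurable b') (hd : ∀ τ > 0, HasDerivAt b (b' τ) τ) {M q : ℝ} (hq : 0 ≤ q)
    (hbM : ∀ τ > 0, |b τ| ≤ M) (hbM' : ∀ τ > 0, |b' τ| ≤ M * (1 + τ⁻¹ + τ ^ (-q))) :
    (∫ τ in Ioi (0 : ℝ), rKerDD ν r τ * b τ) +
      (1 - 2 * ν) / r * ∫ τ in Ioi (0 : ℝ), rKerD ν r τ * b τ =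
    -∫ τ in Ioi (0 : ℝ), rKer ν r τ * b' τ := by
  obtain ⟨-, -, i1, i2⟩ := hasDerivAt_integral_rKer hν hr hb hbM
  have e : ∀ τ > 0, rKerT ν r τ * b τ =
      rKerDD ν r τ * b τ + (1 - 2 * ν) / r * (rKerD ν r τ * b τ) := by
    intro τ hτ
    rw [← rKerDD_add hr hτ]
    ring
  have iT : IntegrableOn (fun τ => rKerT ν r τ * b τ) (Ioi 0) :=
    IntegrableOn.congr_fun (i2.add (i1.const_mul ((1 - 2 * ν) / r)))
      (fun τ hτ => (e τ hτ).symm) measurableSet_Ioi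
  have i0 : IntegrableOn (fun τ => rKer ν r τ * b τ) (Ioi 0) :=
    Integrable.mul_bdd (c := M) (integrableOn_rKer hν hr) hb.aestronglyMeasurable
      ((ae_restrict_iff' measurableSet_Ioi).2 (Eventually.of_forall hbM))
  have key := integral_Ioi_mul_deriv_eq_neg (u := rKer ν r) (u' := rKerT ν r) (v := b) (v' := b')
    (fun τ hτ => hasDerivAt_rKer_tau hτ) hd i0 (integrableOn_rKer_mul hν hr hb' hq hbM') iT ?_
  · rw [key, neg_neg, setIntegral_congr_fun measurableSet_Ioi e,
      integral_add i2 (i1.const_mul _), integral_const_mul]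
  · have h := (tendsto_rpow_mul_exp_neg_div (-(ν + 1)) (c := r ^ 2 / 4)
      (by positivity)).const_mul ((r / 2) ^ (2 * ν))
    rw [mul_zero] at h
    have h0 : Tendsto (rKer ν r) (nhdsWithin 0 (Ioi 0)) (nhds 0) := by
      refine h.congr' ?_
      filter_upwards [self_mem_nhdsWithin] with τ hτ
      have hτ' : 0 < τ := hτ
      simp only [rKer]
      rw [show -r ^ 2 / (4 * τ) = -(r ^ 2 / 4 / τ) by field_simp]
      ring
    refine bdd_le_mul_tendsto_zero' M ?_ h0 |>.congr fun w => mul_comm _ _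
    filter_upwards [self_mem_nhdsWithin] with w hw using hbM w hw

end

lemma hasDerivAt_setIntegral_Ioi_of_lip {F : ℝ → ℝ → ℝ} {F' : ℝ → ℝ} {x₀ : ℝ} {g : ℝ → ℝ}
    (hFm : ∀ x, Measurable (F x)) (hF : IntegrableOn (F x₀) (Ioi 0))
    (hF'm : Measurable F') (hb : ∀ y > 0, ∀ x, |F x y - F x₀ y| ≤ g y * |x - x₀|)
    (hg : IntegrableOn g (Ioi 0)) (hd : ∀ y > 0, HasDerivAt (F · y) (F' y) x₀) :
    HasDerivAt (fun x => ∫ y in Ioi (0 : ℝ), F x y) (∫ y in Ioi (0 : ℝ), F' y) x₀ := by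
  have key := hasFDerivAt_integral_of_dominated_loc_of_lip' (𝕜 := ℝ)
    (μ := volume.restrict (Ioi 0)) (F := F)
    (F' := fun y => (F' y) • (ContinuousLinearMap.id ℝ ℝ)) (bound := g) (x₀ := x₀) univ_mem
    (fun x _ => (hFm x).aestronglyMeasurable) hF
    (hF'm.aestronglyMeasurable.smul_const _)
    ((ae_restrict_iff' measurableSet_Ioi).2 (Eventually.of_forall fun y hy x _ => hb y hy x)) hg
    ((ae_restrict_iff' measurableSet_Ioi).2 (Eventually.of_forall fun y hy => by
      refine (hd y hy).hasFDerivAt.congr_fderiv ?_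
      ext
      simp))
  refine key.2.hasDerivAt.congr_deriv ?_
  rw [integral_smul_const]
  simp

/-- The subordination integral against both kernels. -/
noncomputable def subord (ν a lam α : ℝ) (φ : ℝ → ℝ) (r z : ℝ) : ℝ :=
  ∫ τ in Ioi (0 : ℝ), rKer ν r τ * bInt (fp a lam) φ (z + α * τ) τ

section
variable {a lam : ℝ} (ha : 0 < a) (hlam : 0 < lam) {φ φ' : ℝ → ℝ} {C k : ℝ}

lemma measurable_bInt_line {K : ℝ → ℝ → ℝ} (hK : Measurable fun q : ℝ × ℝ => K q.1 q.2)
    (hφ : Measurable φ) (z α : ℝ) : Measurable fun τ => bInt K φ (z + α * τ) τ :=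
  (measurable_bInt hK hφ).comp (by fun_prop : Measurable fun τ : ℝ => (z + α * τ, τ))

include ha hlam in
lemma exists_abs_bInt_le : ∃ M, 0 ≤ M ∧ ∀ (φ : ℝ → ℝ) (x τ D : ℝ),
    (∀ w > 0, |φ (τ + w)| ≤ D) → |bInt (fp a lam) φ x τ| ≤ M * D := by
  obtain ⟨M, hM, h⟩ := exists_integral_abs_fp_le ha hlam
  refine ⟨M, hM, fun φ x τ D hD => ?_⟩
  exact (abs_bInt_le (integrableOn_fp ha hlam x).1 hD).trans (mul_le_mul_of_nonneg_right (h x)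
    ((abs_nonneg _).trans (hD 1 one_pos)))

variable (hφ : Profile φ φ' C k)
include ha hlam hφ

lemma exists_bInt_bounds : ∃ M, 0 ≤ M ∧ (∀ x τ, 0 < τ → |bInt (fp a lam) φ x τ| ≤ M) ∧
    (∀ x τ, 0 < τ → |bInt (fp a lam) φ' x τ| ≤ M * τ ^ (-k)) ∧
    (∀ x τ, 0 < x → 0 < τ → |bInt (fpD a lam) φ x τ| ≤ M * (1 + 1 / x)) ∧
    (∀ x τ, 0 < x → 0 < τ → |bInt (fpDD a lam) φ x τ| ≤ M * (1 + 1 / x ^ 2)) := by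
  obtain ⟨M₁, hM₁, h₁⟩ := exists_abs_bInt_le ha hlam
  obtain ⟨M₂, hM₂, h₂⟩ := exists_integral_abs_fpD_le ha hlam
  have hC := hφ.nonneg
  refine ⟨M₁ * C + M₂ * C, by positivity, fun x τ hτ => ?_, fun x τ hτ => ?_,
    fun x τ hx hτ => ?_, fun x τ hx hτ => ?_⟩
  · have := h₁ φ x τ C fun w hw => hφ.bound_shift hτ hw
    nlinarith
  · have := h₁ φ' x τ _ fun w hw => hφ.bound_shift' hτ le_rfl hw
    have h0 : 0 ≤ M₂ * C * τ ^ (-k) := by positivity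
    nlinarith
  · have := abs_bInt_le (h₂ x hx).1.1 fun w hw => hφ.bound_shift hτ hw
    have h0 : 0 ≤ M₁ * C * (1 + 1 / x) := by positivity
    nlinarith [mul_le_mul_of_nonneg_right (h₂ x hx).1.2 hC]
  · have := abs_bInt_le (h₂ x hx).2.1 fun w hw => hφ.bound_shift hτ hw
    have h0 : 0 ≤ M₁ * C * (1 + 1 / x ^ 2) := by positivity
    nlinarith [mul_le_mul_of_nonneg_right (h₂ x hx).2.2 hC]

variable {ν α : ℝ} (hν : 0 < ν) (hα : 0 < α)
include hν hα

lemma integrableOn_subord_D {r z : ℝ} (hr : 0 < r) (hz : 0 ≤ z) :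
    IntegrableOn (fun τ => rKer ν r τ * bInt (fpD a lam) φ (z + α * τ) τ) (Ioi 0) := by
  obtain ⟨M, hM, h1, -, h3, -⟩ := exists_bInt_bounds ha hlam hφ
  refine integrableOn_rKer_mul hν hr (measurable_bInt_line measurable_fpD hφ.meas z α)
    (M := M * (1 + 1 / α)) (q := 0) le_rfl fun τ hτ => ?_
  refine (h3 _ τ (by positivity) hτ).trans ?_
  have : 1 / (z + α * τ) ≤ 1 / α * τ⁻¹ := by
    rw [one_div, one_div, ← mul_inv]
    exact inv_anti₀ (by positivity) (by linarith)
  rw [neg_zero, rpow_zero, mul_assoc]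
  refine mul_le_mul_of_nonneg_left ?_ hM
  have h4 : 0 < τ⁻¹ := inv_pos.2 hτ
  have h5 : 0 < 1 / α := by positivity
  nlinarith

omit hα in
lemma integrableOn_subord {r : ℝ} (hr : 0 < r) (z : ℝ) :
    IntegrableOn (fun τ => rKer ν r τ * bInt (fp a lam) φ (z + α * τ) τ) (Ioi 0) := by
  obtain ⟨M, hM, h1, -, h3, -⟩ := exists_bInt_bounds ha hlam hφ
  exact Integrable.mul_bdd (c := M) (integrableOn_rKer hν hr)
    (measurable_bInt_line measurable_fp hφ.meas z α).aestronglyMeasurable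
    ((ae_restrict_iff' measurableSet_Ioi).2 (Eventually.of_forall fun τ hτ => h1 _ τ hτ))

lemma hasDerivAt_subord_z {r z : ℝ} (hr : 0 < r) (hz : 0 ≤ z) :
    HasDerivAt (fun z => subord ν a lam α φ r z)
      (∫ τ in Ioi (0 : ℝ), rKer ν r τ * bInt (fpD a lam) φ (z + α * τ) τ) z := by
  obtain ⟨M, hM, h1, -, h3, -⟩ := exists_bInt_bounds ha hlam hφ
  have hg := ((integrableOn_rKer hν hr).add
    ((integrableOn_rKer_mul_inv hν hr).const_mul (6 / α))).const_mul M
  refine hasDerivAt_setIntegral_Ioi_of_lip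
    (fun z => (measurable_rKer ν r).mul (measurable_bInt_line measurable_fp hφ.meas z α))
    (integrableOn_subord ha hlam hφ hν hr z)
    ((measurable_rKer ν r).mul (measurable_bInt_line measurable_fpD hφ.meas z α))
    (fun τ hτ z' => ?_) hg fun τ hτ => ?_
  · have hτ' : 0 < τ := hτ
    rw [← mul_sub, abs_mul, abs_of_nonneg (rKer_nonneg hr hτ)]
    simp only [Pi.add_apply]
    have hd : |bInt (fp a lam) φ (z' + α * τ) τ - bInt (fp a lam) φ (z + α * τ) τ| ≤
        M * (1 + 6 / α * τ⁻¹) * |z' - z| := by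
      rcases le_or_gt (|z' - z|) (α * τ / 2) with hc | hc
      · have hmv := (convex_Ici (α * τ / 2)).norm_image_sub_le_of_norm_hasDerivWithin_le
          (f := fun x => bInt (fp a lam) φ x τ) (f' := fun x => bInt (fpD a lam) φ x τ)
          (C := M * (1 + 6 / α * τ⁻¹)) (x := z + α * τ) (y := z' + α * τ)
          (fun x hx => ((hasDerivAt_bInt_x ha hlam hφ
            (lt_of_lt_of_le (by positivity : 0 < α * τ / 2) hx) hτ).1).hasDerivWithinAt)
          (fun x hx => ?_) ?_ ?_
        · simpa [Real.norm_eq_abs] using hmv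
        · have hx0 : 0 < x := lt_of_lt_of_le (by positivity : 0 < α * τ / 2) hx
          refine (h3 x τ hx0 hτ).trans (mul_le_mul_of_nonneg_left ?_ hM)
          have : 1 / x ≤ 1 / (α * τ / 2) := one_div_le_one_div_of_le (by positivity) hx
          have e : 1 / (α * τ / 2) = 2 / α * τ⁻¹ := by field_simp
          have e2 : 2 / α * τ⁻¹ ≤ 6 / α * τ⁻¹ := by gcongr; norm_num
          linarith
        · show α * τ / 2 ≤ z + α * τ
          nlinarith [mul_pos hα hτ']
        · show α * τ / 2 ≤ z' + α * τ
          nlinarith [mul_pos hα hτ', neg_abs_le (z' - z)]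
      · have h4 := (abs_sub _ _).trans (add_le_add (h1 (z' + α * τ) τ hτ) (h1 (z + α * τ) τ hτ))
        refine h4.trans ?_
        have e : 2 ≤ 6 / α * τ⁻¹ * |z' - z| := by
          have : 6 / α * τ⁻¹ * (α * τ / 2) = 3 := by field_simp; norm_num
          have : 6 / α * τ⁻¹ * (α * τ / 2) ≤ 6 / α * τ⁻¹ * |z' - z| := by gcongr
          linarith
        calc M + M = M * 2 := by ring
          _ ≤ M * (6 / α * τ⁻¹ * |z' - z|) := by gcongr
          _ ≤ M * ((1 + 6 / α * τ⁻¹) * |z' - z|) := by gcongr; linarith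
          _ = _ := by ring
    refine (mul_le_mul_of_nonneg_left hd (rKer_nonneg hr hτ)).trans_eq ?_
    ring
  · have hx : 0 < z + α * τ := by have := mul_pos hα hτ; linarith
    exact (((hasDerivAt_bInt_x ha hlam hφ hx hτ).1).comp_add_const z (α * τ)).const_mul _

lemma hasDerivAt_subord_zz {r z : ℝ} (hr : 0 < r) (hz : 0 < z) :
    HasDerivAt (fun z => ∫ τ in Ioi (0 : ℝ), rKer ν r τ * bInt (fpD a lam) φ (z + α * τ) τ)
      (∫ τ in Ioi (0 : ℝ), rKer ν r τ * bInt (fpDD a lam) φ (z + α * τ) τ) z ∧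
    IntegrableOn (fun τ => rKer ν r τ * bInt (fpDD a lam) φ (z + α * τ) τ) (Ioi 0) := by
  obtain ⟨M, hM, -, -, -, h4⟩ := exists_bInt_bounds ha hlam hφ
  have hg := (integrableOn_rKer hν hr).mul_const (M * (1 + 1 / (z / 2) ^ 2))
  have hbd : ∀ τ > 0, ∀ y ∈ Ioi (z / 2), |rKer ν r τ * bInt (fpDD a lam) φ (y + α * τ) τ| ≤
      rKer ν r τ * (M * (1 + 1 / (z / 2) ^ 2)) := by
    intro τ hτ y hy
    have hτ' : 0 < τ := hτ
    have hy' : z / 2 < y := hy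
    have hx : z / 2 ≤ y + α * τ := by have := mul_pos hα hτ; linarith
    rw [abs_mul, abs_of_nonneg (rKer_nonneg hr hτ)]
    refine mul_le_mul_of_nonneg_left ((h4 _ τ (by linarith) hτ).trans ?_) (rKer_nonneg hr hτ)
    gcongr
  refine ⟨?_, hg.mono' ((measurable_rKer ν r).mul
    (measurable_bInt_line measurable_fpDD hφ.meas z α)).aestronglyMeasurable
    ((ae_restrict_iff' measurableSet_Ioi).2 (Eventually.of_forall fun τ hτ =>
      hbd τ hτ z (half_lt_self hz)))⟩
  refine hasDerivAt_setIntegral_Ioi (s := Ioi (z / 2))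
    (F' := fun z τ => rKer ν r τ * bInt (fpDD a lam) φ (z + α * τ) τ)
    (Ioi_mem_nhds (half_lt_self hz))
    (fun z => (measurable_rKer ν r).mul (measurable_bInt_line measurable_fpD hφ.meas z α))
    (integrableOn_subord_D ha hlam hφ hν hα hr hz.le)
    ((measurable_rKer ν r).mul (measurable_bInt_line measurable_fpDD hφ.meas z α))
    hbd hg fun τ hτ y hy => ?_
  have hy' : z / 2 < y := hy
  have hx : 0 < y + α * τ := by have := mul_pos hα hτ; linarith
  exact (((hasDerivAt_bInt_x ha hlam hφ hx hτ).2).comp_add_const y (α * τ)).const_mul _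

omit hα in
lemma integrableOn_subord' {r : ℝ} (hr : 0 < r) (z : ℝ) :
    IntegrableOn (fun τ => rKer ν r τ * bInt (fp a lam) φ' (z + α * τ) τ) (Ioi 0) := by
  obtain ⟨M, hM, -, h2, -⟩ := exists_bInt_bounds ha hlam hφ
  refine integrableOn_rKer_mul hν hr (measurable_bInt_line measurable_fp hφ.meas' z α)
    (M := M) (q := k) hφ.exp_nonneg fun τ hτ => (h2 _ τ hτ).trans ?_
  refine mul_le_mul_of_nonneg_left ?_ hM
  have h4 : 0 < τ⁻¹ := inv_pos.2 hτ
  linarith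

/-- The heat equation satisfied by the subordination integral. -/
lemma heat_subord {r z : ℝ} (hr : 0 < r) (hz : 0 < z) :
    a ^ 2 * iteratedDeriv 2 (fun z => subord ν a lam α φ r z) z -
      lam * deriv (fun z => subord ν a lam α φ r z) z = -subord ν a lam α φ' r z := by
  have hd : iteratedDeriv 2 (fun z => subord ν a lam α φ r z) z =
      ∫ τ in Ioi (0 : ℝ), rKer ν r τ * bInt (fpDD a lam) φ (z + α * τ) τ := by
    rw [iteratedDeriv_succ, iteratedDeriv_one]
    refine HasDerivAt.deriv ((hasDerivAt_subord_zz ha hlam hφ hν hα hr hz).1.congr_of_eventuallyEq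
      ?_)
    filter_upwards [Ioi_mem_nhds hz] with y hy
    exact (hasDerivAt_subord_z ha hlam hφ hν hα hr (le_of_lt hy)).deriv
  rw [hd, (hasDerivAt_subord_z ha hlam hφ hν hα hr hz.le).deriv, ← integral_const_mul,
    ← integral_const_mul, ← integral_sub
      ((hasDerivAt_subord_zz ha hlam hφ hν hα hr hz).2.const_mul _)
      ((integrableOn_subord_D ha hlam hφ hν hα hr hz.le).const_mul _), subord, ← integral_neg]
  refine setIntegral_congr_fun measurableSet_Ioi fun τ hτ => ?_
  have hx : 0 < z + α * τ := by have := mul_pos hα hτ; linarith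
  have := bInt_fpDD_sub ha hlam hφ hx hτ
  linear_combination rKer ν r τ * this

/-- The dynamic boundary condition satisfied by the subordination integral. -/
lemma boundary_subord {r : ℝ} (hr : 0 < r) :
    iteratedDeriv 2 (fun r => subord ν a lam α φ r 0) r +
      (1 - 2 * ν) / r * deriv (fun r => subord ν a lam α φ r 0) r +
      α * deriv (fun z => subord ν a lam α φ r z) 0 = -subord ν a lam α φ' r 0 := by
  obtain ⟨M, hM, h1, h2, h3, -⟩ := exists_bInt_bounds ha hlam hφ
  have hbm := measurable_bInt_line (φ := φ) (measurable_fp (a := a) (lam := lam)) hφ.meas 0 α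
  have hder := fun r (hr : 0 < r) => hasDerivAt_integral_rKer hν hr hbm fun τ hτ => h1 _ τ hτ
  have hd : iteratedDeriv 2 (fun r => subord ν a lam α φ r 0) r =
      ∫ τ in Ioi (0 : ℝ), rKerDD ν r τ * bInt (fp a lam) φ (0 + α * τ) τ := by
    rw [iteratedDeriv_succ, iteratedDeriv_one]
    refine HasDerivAt.deriv ((hder r hr).2.1.congr_of_eventuallyEq ?_)
    filter_upwards [Ioi_mem_nhds hr] with y hy
    exact (hder y hy).1.deriv
  have hd1 : deriv (fun r => subord ν a lam α φ r 0) r =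
      ∫ τ in Ioi (0 : ℝ), rKerD ν r τ * bInt (fp a lam) φ (0 + α * τ) τ := (hder r hr).1.deriv
  have iD := integrableOn_subord_D ha hlam hφ hν hα hr le_rfl
  have i' := integrableOn_subord' (α := α) ha hlam hφ hν hr 0
  rw [hd, hd1, (hasDerivAt_subord_z ha hlam hφ hν hα hr le_rfl).deriv,
    bessel_integral_rKer hν hr hbm
      (b' := fun τ => α * bInt (fpD a lam) φ (0 + α * τ) τ + bInt (fp a lam) φ' (0 + α * τ) τ)
      (((measurable_bInt_line measurable_fpD hφ.meas 0 α).const_mul α).add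
        (measurable_bInt_line measurable_fp hφ.meas' 0 α))
      (fun τ hτ => ?_) (q := k) (M := M * (2 + α)) hφ.exp_nonneg (fun τ hτ => ?_) fun τ hτ => ?_]
  · have e : ∀ τ, rKer ν r τ * (α * bInt (fpD a lam) φ (0 + α * τ) τ +
        bInt (fp a lam) φ' (0 + α * τ) τ) = α * (rKer ν r τ * bInt (fpD a lam) φ (0 + α * τ) τ) +
        rKer ν r τ * bInt (fp a lam) φ' (0 + α * τ) τ := fun τ => by ring
    simp only [e]
    rw [integral_add (iD.const_mul α) i', integral_const_mul, subord]
    ring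
  · simpa using hasDerivAt_bInt_diag ha hlam hφ hα hτ
  · refine (h1 _ τ hτ).trans ?_
    nlinarith
  · have hτ' : 0 < τ := hτ
    refine (abs_add_le _ _).trans ?_
    rw [abs_mul, abs_of_pos hα]
    have hx : 0 < 0 + α * τ := by have := mul_pos hα hτ; linarith
    have q1 := mul_le_mul_of_nonneg_left (h3 _ τ hx hτ) hα.le
    have q2 := h2 (0 + α * τ) τ hτ
    have e : α * (M * (1 + 1 / (0 + α * τ))) = M * (α + τ⁻¹) := by field_simp; ring
    rw [e] at q1
    have p1 : 0 < τ⁻¹ := inv_pos.2 hτ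
    have p2 : 0 < τ ^ (-k) := rpow_pos_of_pos hτ _
    calc _ ≤ M * (α + τ⁻¹) + M * τ ^ (-k) := add_le_add q1 q2
      _ = M * (α + τ⁻¹ + τ ^ (-k)) := by ring
      _ ≤ M * ((2 + α) * (1 + τ⁻¹ + τ ^ (-k))) := by
          gcongr
          nlinarith [mul_pos hα p1, mul_pos hα p2]
      _ = _ := by ring

end

lemma integral_mul_rpow_swap {δ t : ℝ} (hδ1 : δ < 1) (ht : 0 < t) {K m : ℝ → ℝ} {Ψ : ℝ → ℝ → ℝ}
    (hK : Measurable K) (hΨ : Measurable fun q : ℝ × ℝ => Ψ q.1 q.2)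
    (hb : ∀ τ > 0, ∀ s ∈ Ioc 0 t, |K τ * Ψ τ s| ≤ m τ) (hm : IntegrableOn m (Ioi 0)) :
    ∫ s in (0 : ℝ)..t, (∫ τ in Ioi (0 : ℝ), K τ * Ψ τ s) * (t - s) ^ (-δ) =
      ∫ τ in Ioi (0 : ℝ), K τ * ∫ s in (0 : ℝ)..t, Ψ τ s * (t - s) ^ (-δ) := by
  have hr : IntegrableOn (fun s => (t - s) ^ (-δ)) (Ioc 0 t) := by
    have := (intervalIntegral.intervalIntegrable_rpow' (a := 0) (b := t) (r := -δ)
      (by linarith)).comp_sub_left t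
    rw [sub_zero, sub_self] at this
    exact (intervalIntegrable_iff_integrableOn_Ioc_of_le ht.le).1 this.symm
  have hinteg : Integrable (fun q : ℝ × ℝ => K q.2 * Ψ q.2 q.1 * (t - q.1) ^ (-δ))
      ((volume.restrict (Ioc 0 t)).prod (volume.restrict (Ioi 0))) := by
    refine (hr.mul_prod hm).mono' ?_ ?_
    · refine Measurable.aestronglyMeasurable ?_
      exact ((hK.comp measurable_snd).mul (hΨ.comp measurable_swap)).mul (by fun_prop)
    · rw [Measure.prod_restrict]
      refine (ae_restrict_iff' (measurableSet_Ioc.prod measurableSet_Ioi)).2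
        (Eventually.of_forall fun q hq => ?_)
      have h1 : 0 ≤ (t - q.1) ^ (-δ) := rpow_nonneg (by linarith [hq.1.2]) _
      rw [norm_mul, Real.norm_eq_abs, Real.norm_eq_abs, abs_of_nonneg h1, mul_comm]
      exact mul_le_mul_of_nonneg_left (hb _ hq.2 _ hq.1) h1
  rw [intervalIntegral.integral_of_le ht.le]
  simp only [← integral_mul_const]
  rw [integral_integral_swap hinteg]
  refine integral_congr_ae (Eventually.of_forall fun τ => ?_)
  simp only []
  rw [intervalIntegral.integral_of_le ht.le, ← integral_const_mul]
  simp only [mul_assoc]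

section
variable {δ : ℝ} (hδ : 0 < δ) (hδ1 : δ < 1) {H : ℝ → ℝ} {B : ℝ} (hH : Continuous H)
  (hH0 : ∀ s ≤ 0, H s = 0) (hHb : ∀ s, |H s| ≤ B) {a lam : ℝ} (ha : 0 < a) (hlam : 0 < lam)
  {ν α : ℝ} (hν : 0 < ν)

include hH hH0 in
lemma measurable_Phi_left (δ γ t : ℝ) : Measurable fun σ => Phi δ γ H σ t := by
  have h := (measurable_Phi (δ := δ) (γ := γ) hH hH0).comp
    (by fun_prop : Measurable fun σ : ℝ => (σ, t))
  exact h

include hH hH0 in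
lemma measurable_bInt_Phi (δ γ z α : ℝ) : Measurable fun q : ℝ × ℝ =>
    bInt (fp a lam) (fun σ => Phi δ γ H σ q.2) (z + α * q.1) q.1 := by
  have hP := (measurable_Phi (δ := δ) (γ := γ) hH hH0).comp
    (by fun_prop : Measurable fun p : (ℝ × ℝ) × ℝ => (p.1.1 + p.2, p.1.2))
  have hm : Measurable fun p : (ℝ × ℝ) × ℝ =>
      fp a lam (z + α * p.1.1) p.2 * Phi δ γ H (p.1.1 + p.2) p.1.2 :=
    (measurable_fp.comp (by fun_prop : Measurable fun p : (ℝ × ℝ) × ℝ => (z + α * p.1.1, p.2))).mul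
      hP
  exact (StronglyMeasurable.integral_prod_right' hm.stronglyMeasurable).measurable

include hδ hδ1 hHb in
lemma exists_abs_Phi_shift_le {γ : ℝ} (hγ : 0 < γ) : ∃ C, 0 ≤ C ∧ ∀ τ w t T, 0 < τ → 0 < w →
    0 ≤ t → t ≤ T → |Phi δ γ H (τ + w) t| ≤ C * T * τ ^ (-(γ / δ)) := by
  obtain ⟨C, hC, h⟩ := exists_abs_Phi_le hδ hδ1 hHb hγ
  refine ⟨C, hC, fun τ w t T hτ hw ht hT => (h _ t (add_pos hτ hw) ht).trans ?_⟩
  have : (τ + w) ^ (-(γ / δ)) ≤ τ ^ (-(γ / δ)) :=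
    rpow_le_rpow_of_nonpos hτ (by linarith) (neg_nonpos.2 (by positivity))
  have hT0 : 0 ≤ T := ht.trans hT
  gcongr

include hδ hδ1 hH hH0 hHb ha hlam in
lemma hasDerivAt_bInt_Phi {x τ t : ℝ} (hτ : 0 < τ) (ht : 0 < t) :
    HasDerivAt (fun t => bInt (fp a lam) (fun σ => Phi δ 1 H σ t) x τ)
      (bInt (fp a lam) (fun σ => Phi δ 2 H σ t) x τ) t := by
  obtain ⟨C₁, hC₁, h₁⟩ := exists_abs_Phi_shift_le hδ hδ1 hHb one_pos
  obtain ⟨C₂, hC₂, h₂⟩ := exists_abs_Phi_shift_le hδ hδ1 hHb two_pos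
  have hm : ∀ γ t, Measurable fun w => fp a lam x w * Phi δ γ H (τ + w) t := fun γ t =>
    (measurable_fp.comp measurable_prodMk_left).mul
      ((measurable_Phi_left hH hH0 δ γ t).comp (by fun_prop))
  have hi := (integrableOn_fp ha hlam x).1
  refine hasDerivAt_setIntegral_Ioi (s := Ioo 0 (2 * t))
    (F' := fun t w => fp a lam x w * Phi δ 2 H (τ + w) t)
    (g := fun w => |fp a lam x w| * (C₂ * (2 * t) * τ ^ (-(2 / δ))))
    (Ioo_mem_nhds ht (by linarith)) (hm 1)
    (integrableOn_mul_shift (measurable_Phi_left hH hH0 δ 1 t) hi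
      fun w hw => h₁ τ w t t hτ hw ht.le le_rfl)
    (hm 2 t) (fun w hw s hs => ?_) (hi.abs.mul_const _) fun w hw s hs => ?_
  · rw [abs_mul]
    exact mul_le_mul_of_nonneg_left (h₂ τ w s _ hτ hw hs.1.le hs.2.le) (abs_nonneg _)
  · have := hasDerivAt_Phi_t hδ hδ1 hH hHb one_pos (add_pos hτ hw) s
    rw [one_add_one_eq_two] at this
    exact this.const_mul _

include hδ hδ1 hHb ha hlam in
lemma exists_abs_bInt_Phi_le {γ : ℝ} (hγ : 0 < γ) : ∃ C, 0 ≤ C ∧ ∀ x τ t T, 0 < τ →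
    0 ≤ t → t ≤ T → |bInt (fp a lam) (fun σ => Phi δ γ H σ t) x τ| ≤
      C * T * τ ^ (-(γ / δ)) := by
  obtain ⟨C, hC, h⟩ := exists_abs_Phi_shift_le hδ hδ1 hHb hγ
  obtain ⟨M, hM, hb⟩ := exists_abs_bInt_le ha hlam
  refine ⟨M * C, by positivity, fun x τ t T hτ ht hT => ?_⟩
  exact (hb _ x τ _ fun w hw => h τ w t T hτ hw ht hT).trans_eq (by ring)

include hδ hδ1 hH hH0 hHb ha hlam hν in
lemma hasDerivAt_subord_Phi {r z t : ℝ} (hr : 0 < r) (ht : 0 < t) :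
    HasDerivAt (fun t => subord ν a lam α (fun σ => Phi δ 1 H σ t) r z)
      (subord ν a lam α (fun σ => Phi δ 2 H σ t) r z) t := by
  obtain ⟨C₁, hC₁, h₁⟩ := exists_abs_bInt_Phi_le hδ hδ1 hHb ha hlam one_pos
  obtain ⟨C₂, hC₂, h₂⟩ := exists_abs_bInt_Phi_le hδ hδ1 hHb ha hlam two_pos
  have hm : ∀ γ t, Measurable fun τ =>
      rKer ν r τ * bInt (fp a lam) (fun σ => Phi δ γ H σ t) (z + α * τ) τ := fun γ t =>
    (measurable_rKer ν r).mul ((measurable_bInt_Phi hH hH0 δ γ z α).comp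
      (by fun_prop : Measurable fun τ : ℝ => (τ, t)))
  have hi := fun γ (hγ : 0 < γ) => integrableOn_rKer_mul_rpow hν hr (q := γ / δ) (by positivity)
  refine hasDerivAt_setIntegral_Ioi (s := Ioo 0 (2 * t))
    (F' := fun t τ => rKer ν r τ * bInt (fp a lam) (fun σ => Phi δ 2 H σ t) (z + α * τ) τ)
    (g := fun τ => C₂ * (2 * t) * (rKer ν r τ * τ ^ (-(2 / δ))))
    (Ioo_mem_nhds ht (by linarith)) (hm 1)
    (((hi 1 one_pos).const_mul (C₁ * t)).mono' (hm 1 t).aestronglyMeasurable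
      ((ae_restrict_iff' measurableSet_Ioi).2 (Eventually.of_forall fun τ hτ => ?_)))
    (hm 2 t) (fun τ hτ s hs => ?_) ((hi 2 two_pos).const_mul _) fun τ hτ s hs =>
      (hasDerivAt_bInt_Phi hδ hδ1 hH hH0 hHb ha hlam hτ hs.1).const_mul _
  · rw [norm_mul, Real.norm_eq_abs, Real.norm_eq_abs, abs_of_nonneg (rKer_nonneg hr hτ)]
    refine (mul_le_mul_of_nonneg_left (h₁ _ τ t t hτ ht.le le_rfl)
      (rKer_nonneg hr hτ)).trans_eq (by ring)
  · rw [abs_mul, abs_of_nonneg (rKer_nonneg hr hτ)]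
    refine (mul_le_mul_of_nonneg_left (h₂ _ τ s _ hτ hs.1.le hs.2.le)
      (rKer_nonneg hr hτ)).trans_eq (by ring)

include hδ hδ1 hH hH0 hHb ha hlam hν in
/-- The Caputo derivative acts on the innermost profile. -/
lemma caputo_subord_Phi {r z t : ℝ} (hr : 0 < r) (ht : 0 < t) :
    caputo δ (fun t => subord ν a lam α (fun σ => Phi δ 1 H σ t) r z) t =
      subord ν a lam α (fun σ => Phi δ (1 + δ) H σ t) r z := by
  obtain ⟨C₂, hC₂, h₂⟩ := exists_abs_bInt_Phi_le hδ hδ1 hHb ha hlam two_pos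
  obtain ⟨C₃, hC₃, h₃⟩ := exists_abs_Phi_shift_le hδ hδ1 hHb two_pos
  have e1 : ∫ s in (0 : ℝ)..t,
      deriv (fun t => subord ν a lam α (fun σ => Phi δ 1 H σ t) r z) s * (t - s) ^ (-δ) =
      ∫ s in (0 : ℝ)..t, subord ν a lam α (fun σ => Phi δ 2 H σ s) r z * (t - s) ^ (-δ) := by
    refine intervalIntegral.integral_congr_ae (Eventually.of_forall fun s hs => ?_)
    rw [uIoc_of_le ht.le] at hs
    rw [(hasDerivAt_subord_Phi hδ hδ1 hH hH0 hHb ha hlam hν hr hs.1).deriv]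
  have hΓ : Real.Gamma (1 - δ) ≠ 0 := (Real.Gamma_pos_of_pos (by linarith)).ne'
  unfold caputo
  rw [e1]
  simp only [subord]
  rw [integral_mul_rpow_swap hδ1 ht (m := fun τ => C₂ * t * (rKer ν r τ * τ ^ (-(2 / δ))))
    (measurable_rKer ν r) (measurable_bInt_Phi hH hH0 δ 2 z α) (fun τ hτ s hs => ?_)
    ((integrableOn_rKer_mul_rpow hν hr (q := 2 / δ) (by positivity)).const_mul _),
    ← integral_const_mul]
  · refine setIntegral_congr_fun measurableSet_Ioi fun τ hτ => ?_
    have hP := (measurable_Phi (δ := δ) (γ := 2) hH hH0).comp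
      (by fun_prop : Measurable fun q : ℝ × ℝ => (τ + q.1, q.2))
    simp only [bInt]
    rw [integral_mul_rpow_swap hδ1 ht (K := fp a lam (z + α * τ))
      (Ψ := fun w s => Phi δ 2 H (τ + w) s)
      (m := fun w => |fp a lam (z + α * τ) w| * (C₃ * t * τ ^ (-(2 / δ))))
      (measurable_fp.comp measurable_prodMk_left)
      hP
      (fun w hw s hs => ?_) ((integrableOn_fp ha hlam _).1.abs.mul_const _), mul_left_comm,
      ← integral_const_mul]
    · congr 1
      refine setIntegral_congr_fun measurableSet_Ioi fun w hw => ?_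
      rw [mul_left_comm, caputo_Phi hδ hδ1 hH hHb (add_pos hτ hw) ht]
    · rw [abs_mul]
      exact mul_le_mul_of_nonneg_left (h₃ τ w s t hτ hw hs.1.le hs.2) (abs_nonneg _)
  · rw [abs_mul, abs_of_nonneg (rKer_nonneg hr hτ)]
    refine (mul_le_mul_of_nonneg_left (h₂ _ τ s t hτ hs.1.le hs.2)
      (rKer_nonneg hr hτ)).trans_eq (by ring)

end

lemma W_one_eq_Mwr {δ τ s : ℝ} (hδ : 0 < δ) (hδ1 : δ < 1) (hτ : 0 < τ) (hs : 0 < s) :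
    W δ 1 τ s = δ * τ / s ^ (δ + 1) * Mwr (τ / s ^ δ) δ := by
  have hp : 0 < s ^ δ := rpow_pos_of_pos hs _
  rw [W_one_eq hδ hδ1 hτ hs, ← W_eq_Mwr hδ hδ1 (div_pos hτ hp).le, W_of_pos hs, W_of_pos one_pos,
    rayInt_scale hs, Complex.im_ofReal_mul, rpow_neg hs.le, rpow_add_one hs.ne']
  field_simp

lemma exp_mul_kernel_eq {a lam β x w s : ℝ} (ha : 0 < a) (hβ : 0 < β) (hβ1 : β < 1 / 2)
    (hw : 0 < w) (hs : 0 < s) :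
    exp (lam * x / (2 * a ^ 2)) * (β * x / (a * √π * s ^ (2 * β + 1)) *
      (w ^ (-(1 / 2 : ℝ)) * exp (-x ^ 2 / (4 * a ^ 2 * w) - lam ^ 2 * w / (4 * a ^ 2)) *
        Mwr (w / s ^ (2 * β)) (2 * β))) = fp a lam x w * W (2 * β) 1 w s := by
  have e1 : exp (-((x - lam * w) ^ 2 / (4 * a ^ 2 * w))) = exp (lam * x / (2 * a ^ 2)) *
      exp (-x ^ 2 / (4 * a ^ 2 * w) - lam ^ 2 * w / (4 * a ^ 2)) := by
    rw [← exp_add]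
    congr 1
    field_simp
    ring
  have e2 : w ^ (-(1 / 2 : ℝ)) = w ^ (-(3 / 2 : ℝ)) * w := by
    rw [← rpow_add_one hw.ne']
    norm_num
  rw [W_one_eq_Mwr (by linarith) (by linarith) hw hs, fp, fpKer, e1, e2]
  have hp : 0 < s ^ (2 * β + 1) := rpow_pos_of_pos hs _
  have hpi : 0 < √π := sqrt_pos.2 pi_pos
  generalize Mwr (w / s ^ (2 * β)) (2 * β) = m
  generalize exp (lam * x / (2 * a ^ 2)) = A
  generalize exp (-x ^ 2 / (4 * a ^ 2 * w) - lam ^ 2 * w / (4 * a ^ 2)) = A'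
  generalize w ^ (-(3 / 2 : ℝ)) = v
  field_simp

lemma integrableOn_rpow_mul_fp {a lam : ℝ} (ha : 0 < a) (hlam : 0 < lam) (x : ℝ) {p : ℝ}
    (hp : p < 1 / 2) : IntegrableOn (fun w => |fp a lam x w| * w ^ p) (Ioi 0) := by
  rcases eq_or_ne x 0 with rfl | hx
  · simp [fp]
  have hx' : 0 < |x| := abs_pos.2 hx
  refine ((integrableOn_rpow_mul_fpKer ha hlam hx' hp).const_mul |x|).mono' ?_ ?_
  · have h := (measurable_fpKer_right (a := a) (lam := lam) x).const_mul x
    exact Measurable.aestronglyMeasurable (h.abs.mul (by fun_prop))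
  · refine (ae_restrict_iff' measurableSet_Ioi).2 (Eventually.of_forall fun w hw => ?_)
    have h1 : 0 ≤ w ^ p := rpow_nonneg (le_of_lt hw) _
    rw [norm_mul, Real.norm_eq_abs, abs_abs, Real.norm_eq_abs, abs_of_nonneg h1]
    refine (mul_le_mul_of_nonneg_right (abs_fp_le_abs_fp_abs ha hlam hw) h1).trans_eq ?_
    rw [fp, abs_mul, abs_abs, abs_of_nonneg (fpKer_nonneg ha hw)]
    ring

section
variable {δ : ℝ} (hδ : 0 < δ) (hδ1 : δ < 1) {H : ℝ → ℝ} {B : ℝ} (hH : Continuous H)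
  (hH0 : ∀ s ≤ 0, H s = 0) (hHb : ∀ s, |H s| ≤ B) {a lam : ℝ} (ha : 0 < a) (hlam : 0 < lam)

include hδ hδ1 hH hH0 hHb ha hlam in
lemma lconv_Phi_integral_fp {x τ t : ℝ} (hτ : 0 < τ) (ht : 0 < t) :
    lconv (Phi δ 1 H τ) (fun s => ∫ w in Ioi (0 : ℝ), fp a lam x w * W δ 1 w s) t =
      bInt (fp a lam) (fun σ => Phi δ 1 H σ t) x τ := by
  obtain ⟨C, hC, hP⟩ := exists_abs_Phi_one_le (H := H) hδ hδ1 hH0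
  obtain ⟨D, hD, hW⟩ := exists_abs_W_le_const hδ hδ1 one_pos
  have hB : 0 ≤ B := (abs_nonneg _).trans (hHb 0)
  have hinteg : Integrable (fun q : ℝ × ℝ => Phi δ 1 H τ (t - q.1) * (fp a lam x q.2 * W δ 1 q.2 q.1))
      ((volume.restrict (Ioc 0 t)).prod (volume.restrict (Ioi 0))) := by
    have hi := (integrableOn_rpow_mul_fp ha hlam x (p := -(1 / δ))
      (by have : 0 < 1 / δ := by positivity
          linarith)).const_mul (C * B * D)
    have h1 : IntegrableOn (fun _ : ℝ => (1 : ℝ)) (Ioc 0 t) := integrable_const _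
    refine (h1.mul_prod hi).mono' ?_ ?_
    · have m1 := (measurable_Phi (δ := δ) (γ := 1) hH hH0).comp
        (by fun_prop : Measurable fun q : ℝ × ℝ => (τ, t - q.1))
      have m2 := (measurable_fp (a := a) (lam := lam)).comp
        (by fun_prop : Measurable fun q : ℝ × ℝ => (x, q.2))
      have m3 := (measurable_W δ 1).comp measurable_swap
      exact (m1.mul (m2.mul m3)).aestronglyMeasurable
    · rw [Measure.prod_restrict]
      refine (ae_restrict_iff' (measurableSet_Ioc.prod measurableSet_Ioi)).2
        (Eventually.of_forall fun q hq => ?_)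
      have hq2 : 0 < q.2 := hq.2
      have b1 := hP τ (t - q.1) B hτ fun s _ => hHb s
      have b2 := hW q.2 q.1 hq2
      have h3 : 0 ≤ q.2 ^ (-(1 / δ)) := rpow_nonneg hq2.le _
      simp only [norm_mul, Real.norm_eq_abs]
      calc _ ≤ C * B * (|fp a lam x q.2| * (D * q.2 ^ (-(1 / δ)))) := by gcongr
        _ = _ := by ring
  rw [lconv, intervalIntegral.integral_of_le ht.le]
  simp only [← integral_const_mul]
  rw [integral_integral_swap hinteg, bInt]
  refine setIntegral_congr_fun measurableSet_Ioi fun w hw => ?_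
  rw [← lconv_Phi_W hδ hδ1 hH hHb hτ hw ht, lconv, intervalIntegral.integral_of_le ht.le,
    ← integral_const_mul]
  congr 1
  funext s
  ring
end

lemma lconv_congr {f f' g g' : ℝ → ℝ} {t : ℝ} (ht : 0 ≤ t) (hf : ∀ s ≥ 0, f s = f' s)
    (hg : ∀ s > 0, g s = g' s) : lconv f g t = lconv f' g' t := by
  rw [lconv, lconv, intervalIntegral.integral_of_le ht, intervalIntegral.integral_of_le ht]
  refine setIntegral_congr_fun measurableSet_Ioc fun s hs => ?_
  rw [hf _ (by linarith [hs.2]), hg _ hs.1]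

lemma integral_rKer_mul {ν r : ℝ} (hr : 0 < r) (b : ℝ → ℝ) :
    ∫ τ in Ioi (0 : ℝ), rKer ν r τ * b τ = ∫ v in Ioi (0 : ℝ), rKer ν 1 v * b (r ^ 2 * v) := by
  have hr2 : 0 < r ^ 2 := by positivity
  have h := integral_comp_mul_left_Ioi' (fun τ => rKer ν r τ * b τ) 0 hr2
  rw [mul_zero] at h
  rw [← h, smul_eq_mul, ← integral_const_mul]
  refine setIntegral_congr_fun measurableSet_Ioi fun v hv => ?_
  have hv' : 0 < v := hv
  simp only [rKer]
  have e1 : (r ^ 2 * v) ^ (-(ν + 1)) = r ^ (-(2 * ν)) * (r ^ 2)⁻¹ * v ^ (-(ν + 1)) := by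
    rw [mul_rpow hr2.le hv'.le, ← rpow_natCast, ← rpow_mul hr.le, ← rpow_neg hr.le,
      ← rpow_add hr]
    congr 2
    push_cast
    ring
  have e2 : (r / 2) ^ (2 * ν) = r ^ (2 * ν) * (1 / 2) ^ (2 * ν) := by
    rw [← mul_rpow hr.le (by norm_num)]
    ring_nf
  have e3 : r ^ (-(2 * ν)) * r ^ (2 * ν) = 1 := by
    rw [← rpow_add hr]; simp
  have e4 : -r ^ 2 / (4 * (r ^ 2 * v)) = -1 ^ 2 / (4 * v) := by field_simp
  rw [e1, e2, e4]
  have e5 : r ^ 2 * (r ^ 2)⁻¹ = 1 := mul_inv_cancel₀ hr2.ne'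
  linear_combination (v ^ (-(ν + 1)) * (1 / 2) ^ (2 * ν) * rexp (-1 ^ 2 / (4 * v)) *
    b (r ^ 2 * v)) * (r ^ 2 * (r ^ 2)⁻¹ * e3 + e5)

lemma integral_rKer_one {ν : ℝ} (hν : 0 < ν) :
    ∫ v in Ioi (0 : ℝ), rKer ν 1 v = Real.Gamma ν := by
  have h := integral_comp_rpow_Ioi (fun y : ℝ => y ^ (ν - 1) * exp (-(1 / 4 * y)))
    (p := -1) (by norm_num)
  rw [integral_rpow_mul_exp_neg_mul_Ioi hν (by norm_num)] at h
  have e0 : (1 / 2 : ℝ) ^ (2 * ν) * (1 / (1 / 4)) ^ ν = 1 := by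
    rw [rpow_mul (by norm_num), ← mul_rpow (by positivity) (by positivity)]
    norm_num
  calc _ = ∫ x in Ioi (0 : ℝ), (1 / 2) ^ (2 * ν) *
        ((|(-1 : ℝ)| * x ^ ((-1 : ℝ) - 1)) • ((x ^ (-1 : ℝ)) ^ (ν - 1) *
          exp (-(1 / 4 * x ^ (-1 : ℝ))))) := by
        refine setIntegral_congr_fun measurableSet_Ioi fun x hx => ?_
        have hx' : 0 < x := hx
        have e1 : x ^ (-(ν + 1)) = x ^ ((-1 : ℝ) - 1) * (x ^ (-1 : ℝ)) ^ (ν - 1) := by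
          rw [← rpow_mul hx'.le, ← rpow_add hx']
          congr 1
          ring
        have e2 : -1 ^ 2 / (4 * x) = -(1 / 4 * x ^ (-1 : ℝ)) := by
          rw [rpow_neg_one]
          field_simp
        simp only [rKer, smul_eq_mul, abs_neg, abs_one]
        rw [e1, e2]
        ring
    _ = _ := by
        rw [integral_const_mul, h, ← mul_assoc, e0, one_mul]

section
variable {a lam : ℝ} (ha : 0 < a) (hlam : 0 < lam) {φ : ℝ → ℝ} (hφ : Measurable φ)
  {ν α : ℝ} (hν : 0 < ν) (hα : 0 < α)

include ha hlam hφ in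
lemma tendsto_bInt_fp {C L : ℝ} (hC : ∀ σ > 0, |φ σ| ≤ C)
    (hL : Tendsto φ (nhdsWithin 0 (Ioi 0)) (nhds L)) :
    Tendsto (fun q : ℝ × ℝ => bInt (fp a lam) φ q.1 q.2)
      (nhdsWithin (0, 0) (Ioi (0 : ℝ) ×ˢ Ioi (0 : ℝ))) (nhds L) := by
  have hpi : 0 < √π := sqrt_pos.2 pi_pos
  have hgauss : ∫ y in Ioi (0 : ℝ), exp (-(1 / (4 * a ^ 2)) * y ^ 2) = a * √π := by
    rw [integral_gaussian_Ioi, show π / (1 / (4 * a ^ 2)) = (2 * a) ^ 2 * π by field_simp; ring,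
      sqrt_mul (by positivity), sqrt_sq (by positivity)]
    ring
  have hmem : ∀ᶠ q : ℝ × ℝ in nhdsWithin (0, 0) (Ioi (0 : ℝ) ×ˢ Ioi (0 : ℝ)),
      (0 < q.1 ∧ 0 < q.2) ∧ q.1 < 1 := by
    refine (eventually_mem_nhdsWithin.mono fun q hq => ⟨hq.1, hq.2⟩).and ?_
    refine nhdsWithin_le_nhds ?_
    exact (continuous_fst.tendsto ((0, 0) : ℝ × ℝ)).eventually_lt_const zero_lt_one
  have hc : Tendsto (fun q : ℝ × ℝ => q) (nhdsWithin (0, 0) (Ioi (0 : ℝ) ×ˢ Ioi (0 : ℝ)))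
      (nhds (0, 0)) := tendsto_id.mono_left nhdsWithin_le_nhds
  have key : Tendsto (fun q : ℝ × ℝ => ∫ y in Ioi (0 : ℝ),
      exp (-((y - lam * q.1 / y) ^ 2 / (4 * a ^ 2))) * φ (q.2 + q.1 ^ 2 / y ^ 2))
      (nhdsWithin (0, 0) (Ioi (0 : ℝ) ×ˢ Ioi (0 : ℝ)))
      (nhds (∫ y in Ioi (0 : ℝ), exp (-(1 / (4 * a ^ 2)) * y ^ 2) * L)) := by
    refine tendsto_integral_filter_of_dominated_convergence
      (fun y => exp (lam / (2 * a ^ 2)) * exp (-(1 / (4 * a ^ 2)) * y ^ 2) * C) ?_ ?_ ?_ ?_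
    · refine Eventually.of_forall fun q => Measurable.aestronglyMeasurable ?_
      exact Measurable.mul (by fun_prop) (hφ.comp (by fun_prop))
    · filter_upwards [hmem] with q hq
      refine (ae_restrict_iff' measurableSet_Ioi).2 (Eventually.of_forall fun y hy => ?_)
      have hy' : 0 < y := hy
      have hq1 := hq.1.1
      rw [norm_mul, Real.norm_eq_abs, Real.norm_eq_abs, abs_of_pos (exp_pos _)]
      refine mul_le_mul ?_ (hC _ (by have := hq.1.2; positivity)) (abs_nonneg _) (by positivity)
      rw [← exp_add]
      refine exp_le_exp.2 ?_
      have e : (y - lam * q.1 / y) ^ 2 = y ^ 2 - 2 * lam * q.1 + (lam * q.1 / y) ^ 2 := by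
        field_simp
        ring
      rw [show lam / (2 * a ^ 2) + -(1 / (4 * a ^ 2)) * y ^ 2 = (2 * lam - y ^ 2) / (4 * a ^ 2) by
        field_simp; ring, ← neg_div]
      refine div_le_div_of_nonneg_right ?_ (by positivity)
      rw [e]
      nlinarith [sq_nonneg (lam * q.1 / y), mul_le_mul_of_nonneg_left hq.2.le hlam.le]
    · exact ((integrable_exp_neg_mul_sq (by positivity)).integrableOn.const_mul _).mul_const _
    · refine (ae_restrict_iff' measurableSet_Ioi).2 (Eventually.of_forall fun y hy => ?_)
      have hy' : 0 < y := hy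
      refine Tendsto.mul ?_ (hL.comp ?_)
      · have : Continuous fun q : ℝ × ℝ => exp (-((y - lam * q.1 / y) ^ 2 / (4 * a ^ 2))) := by
          fun_prop
        convert (this.tendsto (0, 0)).mono_left nhdsWithin_le_nhds using 3
        simp
        ring
      · refine tendsto_nhdsWithin_iff.2 ⟨?_, ?_⟩
        · have : Continuous fun q : ℝ × ℝ => q.2 + q.1 ^ 2 / y ^ 2 := by fun_prop
          convert (this.tendsto (0, 0)).mono_left nhdsWithin_le_nhds using 2
          simp
        · filter_upwards [hmem] with q hq
          have h1 := hq.1.1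
          have h2 := hq.1.2
          exact mem_Ioi.2 (by positivity)
  rw [integral_mul_const, hgauss] at key
  have key2 := key.const_mul (1 / (a * √π))
  rw [← mul_assoc, one_div_mul_cancel (by positivity), one_mul] at key2
  refine key2.congr' ?_
  filter_upwards [hmem] with q hq
  exact (integral_mul_fpKer ha hq.1.1 fun w => φ (q.2 + w)).symm

include ha hlam hφ hν hα in
lemma tendsto_subord_zero {C L : ℝ} (hC : ∀ σ > 0, |φ σ| ≤ C)
    (hL : Tendsto φ (nhdsWithin 0 (Ioi 0)) (nhds L)) :
    Tendsto (fun q : ℝ × ℝ => subord ν a lam α φ q.1 q.2)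
      (nhdsWithin (0, 0) (Ioi (0 : ℝ) ×ˢ Ioi (0 : ℝ))) (nhds (Real.Gamma ν * L)) := by
  obtain ⟨M, hM, hb⟩ := exists_abs_bInt_le ha hlam
  have hmem : ∀ᶠ q : ℝ × ℝ in nhdsWithin (0, 0) (Ioi (0 : ℝ) ×ˢ Ioi (0 : ℝ)),
      0 < q.1 ∧ 0 < q.2 := eventually_mem_nhdsWithin.mono fun q hq => ⟨hq.1, hq.2⟩
  have key : Tendsto (fun q : ℝ × ℝ => ∫ v in Ioi (0 : ℝ), rKer ν 1 v *
        bInt (fp a lam) φ (q.2 + α * (q.1 ^ 2 * v)) (q.1 ^ 2 * v))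
      (nhdsWithin (0, 0) (Ioi (0 : ℝ) ×ˢ Ioi (0 : ℝ)))
      (nhds (∫ v in Ioi (0 : ℝ), rKer ν 1 v * L)) := by
    refine tendsto_integral_filter_of_dominated_convergence
      (fun v => rKer ν 1 v * (M * C)) ?_ ?_ ?_ ?_
    · refine Eventually.of_forall fun q => Measurable.aestronglyMeasurable ?_
      have h := (measurable_bInt (measurable_fp (a := a) (lam := lam)) hφ).comp
        (by fun_prop : Measurable fun v : ℝ => (q.2 + α * (q.1 ^ 2 * v), q.1 ^ 2 * v))
      exact (measurable_rKer ν 1).mul h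
    · filter_upwards [hmem] with q hq
      refine (ae_restrict_iff' measurableSet_Ioi).2 (Eventually.of_forall fun v hv => ?_)
      have hv' : 0 < v := hv
      have h1 := hq.1
      have h0 := rKer_nonneg (ν := ν) one_pos hv'
      rw [norm_mul, Real.norm_eq_abs, Real.norm_eq_abs, abs_of_nonneg h0]
      exact mul_le_mul_of_nonneg_left (hb _ _ _ _ fun w hw => hC _ (by positivity)) h0
    · exact (integrableOn_rKer hν one_pos).mul_const _
    · refine (ae_restrict_iff' measurableSet_Ioi).2 (Eventually.of_forall fun v hv => ?_)
      have hv' : 0 < v := hv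
      refine ((tendsto_bInt_fp ha hlam hφ hC hL).comp
        (f := fun q : ℝ × ℝ => (q.2 + α * (q.1 ^ 2 * v), q.1 ^ 2 * v)) ?_).const_mul _
      refine tendsto_nhdsWithin_iff.2 ⟨?_, ?_⟩
      · have : Continuous fun q : ℝ × ℝ => (q.2 + α * (q.1 ^ 2 * v), q.1 ^ 2 * v) := by fun_prop
        convert (this.tendsto (0, 0)).mono_left nhdsWithin_le_nhds using 2
        simp
      · filter_upwards [hmem] with q hq
        have h1 := hq.1
        have h2 := hq.2
        exact ⟨mem_Ioi.2 (by positivity), mem_Ioi.2 (by positivity)⟩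
  rw [integral_mul_const, integral_rKer_one hν] at key
  refine key.congr' ?_
  filter_upwards [hmem] with q hq
  exact (integral_rKer_mul hq.1 fun τ => bInt (fp a lam) φ (q.2 + α * τ) τ).symm

end

section
variable {a lam : ℝ} (ha : 0 < a) (hlam : 0 < lam) {ν α : ℝ} (hν : 0 < ν)

lemma abs_subord_le_integral {φ m : ℝ → ℝ} {r z : ℝ} (hr : 0 < r)
    (hm : IntegrableOn (fun τ => rKer ν r τ * m τ) (Ioi 0))
    (hb : ∀ τ > 0, |bInt (fp a lam) φ (z + α * τ) τ| ≤ m τ) :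
    |subord ν a lam α φ r z| ≤ ∫ τ in Ioi (0 : ℝ), rKer ν r τ * m τ := by
  rw [subord, ← Real.norm_eq_abs]
  refine norm_integral_le_of_norm_le hm
    ((ae_restrict_iff' measurableSet_Ioi).2 (Eventually.of_forall fun τ hτ => ?_))
  have h0 := rKer_nonneg (ν := ν) hr hτ
  rw [norm_mul, Real.norm_eq_abs, Real.norm_eq_abs, abs_of_nonneg h0]
  exact mul_le_mul_of_nonneg_left (hb τ hτ) h0

include hν in
lemma abs_subord_le_of_bound {φ : ℝ → ℝ} {r z D : ℝ} (hr : 0 < r)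
    (hb : ∀ τ > 0, |bInt (fp a lam) φ (z + α * τ) τ| ≤ D) :
    |subord ν a lam α φ r z| ≤ Real.Gamma ν * D := by
  refine (abs_subord_le_integral (m := fun _ => D) hr
    ((integrableOn_rKer hν hr).mul_const D) hb).trans_eq ?_
  rw [integral_rKer_mul hr, integral_mul_const, integral_rKer_one hν]

include ha hlam hν in
lemma exists_abs_subord_le : ∃ K, 0 ≤ K ∧ ∀ (φ : ℝ → ℝ) (r z D : ℝ), 0 < r →
    (∀ σ > 0, |φ σ| ≤ D) → |subord ν a lam α φ r z| ≤ K * D := by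
  obtain ⟨M, hM, hb⟩ := exists_abs_bInt_le ha hlam
  have hG := (Real.Gamma_pos_of_pos hν).le
  refine ⟨Real.Gamma ν * M, by positivity, fun φ r z D hr hD => ?_⟩
  rw [mul_assoc]
  refine abs_subord_le_of_bound hν hr fun τ hτ => ?_
  exact hb _ _ _ _ fun w hw => hD _ (add_pos hτ hw)

include ha hlam in
lemma exists_abs_bInt_le_div : ∃ K, 0 ≤ K ∧ ∀ (φ : ℝ → ℝ) (x τ D : ℝ), 1 ≤ x → 0 < τ → 0 ≤ D →
    (∀ σ > 0, |φ σ| ≤ D * σ⁻¹) → |bInt (fp a lam) φ x τ| ≤ K * D / x := by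
  obtain ⟨C, hC, h⟩ := exists_integral_zpow_mul_fpKer_le ha hlam 1
  refine ⟨2 * C, by positivity, fun φ x τ D hx hτ hD0 hD => ?_⟩
  have hx0 : 0 < x := by linarith
  have hi := (integrableOn_fp_mul_inv_pow ha hlam hx0 1).mul_const D
  rw [bInt, ← Real.norm_eq_abs]
  refine (norm_integral_le_of_norm_le hi
    ((ae_restrict_iff' measurableSet_Ioi).2 (Eventually.of_forall fun w hw => ?_))).trans ?_
  · have hw' : 0 < w := hw
    have h0 : 0 ≤ fp a lam x w := mul_nonneg hx0.le (fpKer_nonneg ha hw)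
    rw [norm_mul, Real.norm_eq_abs, Real.norm_eq_abs, abs_of_nonneg h0, mul_assoc, pow_one]
    refine mul_le_mul_of_nonneg_left ((hD _ (add_pos hτ hw)).trans ?_) h0
    rw [mul_comm]
    have : (τ + w)⁻¹ ≤ w⁻¹ := inv_anti₀ hw' (by linarith)
    gcongr
  · rw [integral_mul_const]
    have h1 := h x hx0
    have h2 : C * (1 + x ^ 1) / x ^ (2 * 1) ≤ 2 * C / x := by
      rw [div_le_div_iff₀ (by positivity) hx0]
      have : C * (1 + x) * x ≤ C * (x + x) * x := by gcongr
      rw [pow_one, mul_one]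
      linarith
    calc _ ≤ 2 * C / x * D := mul_le_mul_of_nonneg_right (h1.trans h2) hD0
      _ = _ := by ring

include ha hlam hν in
lemma tendsto_subord_atTop (hα : 0 < α) {φ : ℝ → ℝ} {D : ℝ} (hD : ∀ σ > 0, |φ σ| ≤ D * σ⁻¹) :
    Tendsto (fun q : ℝ × ℝ => subord ν a lam α φ q.1 q.2)
      ((comap (fun w : ℝ × ℝ => w.1 ^ 2 + w.2 ^ 2) atTop) ⊓
          𝓟 (Ioi (0 : ℝ) ×ˢ Ioi (0 : ℝ))) (nhds 0) := by
  obtain ⟨M, hM, hb⟩ := exists_abs_bInt_le ha hlam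
  obtain ⟨K, hK, hk⟩ := exists_abs_bInt_le_div ha hlam
  have hD0 : 0 ≤ D := by
    have := (abs_nonneg _).trans (hD 1 one_pos)
    simpa using this
  have hG := (Real.Gamma_pos_of_pos hν).le
  set I := ∫ v in Ioi (0 : ℝ), rKer ν 1 v * v⁻¹ with hI
  have hI0 : 0 ≤ I := setIntegral_nonneg measurableSet_Ioi fun v hv =>
    mul_nonneg (rKer_nonneg one_pos hv) (inv_nonneg.2 (le_of_lt hv))
  have hradial : ∀ r z : ℝ, 0 < r → |subord ν a lam α φ r z| ≤ M * D * I * (r ^ 2)⁻¹ := by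
    intro r z hr
    have hi := (integrableOn_rKer_mul_inv hν hr).const_mul (M * D)
    refine (abs_subord_le_integral (m := fun τ => M * D * τ⁻¹) hr
      (hi.congr (Eventually.of_forall fun τ => by ring)) fun τ hτ => ?_).trans_eq ?_
    · rw [mul_assoc]
      refine hb _ _ _ _ fun w hw => (hD _ (add_pos hτ hw)).trans ?_
      have : (τ + w)⁻¹ ≤ τ⁻¹ := inv_anti₀ hτ (by linarith)
      gcongr
    · rw [integral_rKer_mul hr, hI, ← integral_const_mul, ← integral_mul_const]
      refine setIntegral_congr_fun measurableSet_Ioi fun v hv => ?_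
      simp only [mul_inv]
      ring
  have haxial : ∀ r z : ℝ, 0 < r → 1 ≤ z →
      |subord ν a lam α φ r z| ≤ Real.Gamma ν * (K * D) * z⁻¹ := by
    intro r z hr hz
    rw [mul_assoc]
    refine abs_subord_le_of_bound hν hr fun τ hτ => ?_
    have h1 : z ≤ z + α * τ := by have := mul_pos hα hτ; linarith
    refine (hk φ _ τ D (hz.trans h1) hτ hD0 hD).trans ?_
    rw [div_eq_mul_inv]
    have : (z + α * τ)⁻¹ ≤ z⁻¹ := inv_anti₀ (by linarith) h1
    gcongr
  set E := M * D * I + Real.Gamma ν * (K * D) with hE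
  have hE1 : M * D * I ≤ E := by rw [hE]; have : 0 ≤ Real.Gamma ν * (K * D) := by positivity
                                 linarith
  have hE2 : Real.Gamma ν * (K * D) ≤ E := by rw [hE]; have : 0 ≤ M * D * I := by positivity
                                              linarith
  have hlim : Tendsto (fun N : ℝ => E * (2 / N + √(2 / N))) atTop (nhds 0) := by
    have h1 : Tendsto (fun N : ℝ => 2 / N) atTop (nhds 0) := tendsto_const_nhds.div_atTop tendsto_id
    have h2 := (h1.add ((continuous_sqrt.tendsto 0).comp h1)).const_mul E
    simpa using h2
  have hN : Tendsto (fun w : ℝ × ℝ => w.1 ^ 2 + w.2 ^ 2)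
      ((comap (fun w : ℝ × ℝ => w.1 ^ 2 + w.2 ^ 2) atTop) ⊓ 𝓟 (Ioi (0 : ℝ) ×ˢ Ioi (0 : ℝ)))
      atTop := tendsto_comap.mono_left inf_le_left
  refine squeeze_zero_norm' ?_ (hlim.comp hN)
  filter_upwards [hN.eventually_ge_atTop 2,
    (eventually_principal.2 fun q hq => hq : ∀ᶠ q in 𝓟 (Ioi (0 : ℝ) ×ˢ Ioi (0 : ℝ)),
      q ∈ Ioi (0 : ℝ) ×ˢ Ioi (0 : ℝ)).filter_mono inf_le_right] with q hq2 hq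
  have hr : 0 < q.1 := hq.1
  have hz : 0 < q.2 := hq.2
  have hN0 : 0 < q.1 ^ 2 + q.2 ^ 2 := by positivity
  have hE0 : 0 ≤ E := by positivity
  rw [Real.norm_eq_abs, Function.comp_apply]
  rcases le_total (q.2 ^ 2) (q.1 ^ 2) with hle | hle
  · have h1 : (q.1 ^ 2)⁻¹ ≤ 2 / (q.1 ^ 2 + q.2 ^ 2) := by
      rw [inv_eq_one_div, div_le_div_iff₀ (by positivity) hN0]
      linarith
    calc _ ≤ M * D * I * (q.1 ^ 2)⁻¹ := hradial _ _ hr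
      _ ≤ E * (2 / (q.1 ^ 2 + q.2 ^ 2)) := by gcongr
      _ ≤ _ := by
        refine mul_le_mul_of_nonneg_left ?_ hE0
        linarith [sqrt_nonneg (2 / (q.1 ^ 2 + q.2 ^ 2))]
  · have h1 : (q.2)⁻¹ ≤ √(2 / (q.1 ^ 2 + q.2 ^ 2)) := by
      refine le_sqrt_of_sq_le ?_
      rw [inv_pow, inv_eq_one_div, div_le_div_iff₀ (by positivity) hN0]
      linarith
    have hz1 : 1 ≤ q.2 := by nlinarith
    calc _ ≤ Real.Gamma ν * (K * D) * (q.2)⁻¹ := haxial _ _ hr hz1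
      _ ≤ E * √(2 / (q.1 ^ 2 + q.2 ^ 2)) := by gcongr
      _ ≤ _ := by
        refine mul_le_mul_of_nonneg_left ?_ hE0
        have : 0 ≤ 2 / (q.1 ^ 2 + q.2 ^ 2) := by positivity
        linarith
end

lemma subord_neg (ν a lam α : ℝ) (φ : ℝ → ℝ) (r z : ℝ) :
    subord ν a lam α (fun σ => -φ σ) r z = -subord ν a lam α φ r z := by
  simp only [subord, bInt, mul_neg, integral_neg]

section
variable {δ : ℝ} (hδ : 0 < δ) (hδ1 : δ < 1) {H : ℝ → ℝ} {B : ℝ} (hH : Continuous H)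
  (hH0 : ∀ s ≤ 0, H s = 0) (hHb : ∀ s, |H s| ≤ B)

include hδ hδ1 hH hH0 hHb in
lemma exists_profile_Phi {t : ℝ} (ht : 0 < t) : ∃ C k,
    Profile (fun σ => Phi δ 1 H σ t) (fun σ => -Phi δ (1 + δ) H σ t) C k := by
  obtain ⟨C₁, hC₁, h₁⟩ := exists_abs_Phi_one_le (H := H) hδ hδ1 hH0
  obtain ⟨C₂, hC₂, h₂⟩ := exists_abs_Phi_le hδ hδ1 hHb (by linarith : 0 < 1 + δ)
  have hB : 0 ≤ B := (abs_nonneg _).trans (hHb 0)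
  refine ⟨C₁ * B + C₂ * t, (1 + δ) / δ, measurable_Phi_left hH hH0 δ 1 t,
    (measurable_Phi_left hH hH0 δ (1 + δ) t).neg, by positivity, by positivity,
    fun σ hσ => hasDerivAt_Phi_sigma hδ hδ1 hH hHb one_pos hσ t, fun σ hσ => ?_, fun σ hσ => ?_⟩
  · refine (h₁ σ t B hσ fun s _ => hHb s).trans ?_
    have : 0 ≤ C₂ * t := by positivity
    linarith
  · rw [abs_neg]
    refine (h₂ σ t hσ ht.le).trans (mul_le_mul_of_nonneg_right ?_ (rpow_nonneg (le_of_lt hσ) _))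
    have : 0 ≤ C₁ * B := by positivity
    linarith

include hδ hδ1 hH0 hHb in
lemma exists_abs_Phi_one_le_inv {t : ℝ} (ht : 0 < t) :
    ∃ D, ∀ σ > 0, |Phi δ 1 H σ t| ≤ D * σ⁻¹ := by
  obtain ⟨C₁, hC₁, h₁⟩ := exists_abs_Phi_one_le (H := H) hδ hδ1 hH0
  obtain ⟨C₂, hC₂, h₂⟩ := exists_abs_Phi_le hδ hδ1 hHb one_pos
  have hB : 0 ≤ B := (abs_nonneg _).trans (hHb 0)
  have p1 : 0 ≤ C₁ * B := by positivity
  have p2 : 0 ≤ C₂ * t := by positivity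
  refine ⟨C₁ * B + C₂ * t, fun σ hσ => ?_⟩
  have hσ' : 0 < σ⁻¹ := inv_pos.2 hσ
  rcases le_total σ 1 with h | h
  · refine (h₁ σ t B hσ fun s _ => hHb s).trans ?_
    have : 1 ≤ σ⁻¹ := (one_le_inv₀ hσ).2 h
    nlinarith
  · refine (h₂ σ t hσ ht.le).trans ?_
    have : σ ^ (-(1 / δ)) ≤ σ⁻¹ := by
      rw [← rpow_neg_one]
      refine rpow_le_rpow_of_exponent_le h (neg_le_neg ?_)
      rw [le_div_iff₀ hδ]
      linarith
    calc _ ≤ C₂ * t * σ⁻¹ := by gcongr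
      _ ≤ _ := by gcongr; linarith

include hδ hδ1 hH hH0 in
lemma tendsto_subord_Phi_zero {a lam ν α : ℝ} (ha : 0 < a) (hlam : 0 < lam) (hν : 0 < ν) {r z : ℝ}
    (hr : 0 < r) :
    Tendsto (fun t => subord ν a lam α (fun σ => Phi δ 1 H σ t) r z) (nhdsWithin 0 (Ioi 0))
      (nhds 0) := by
  obtain ⟨C, hC, h⟩ := exists_abs_Phi_one_le (H := H) hδ hδ1 hH0
  obtain ⟨K, hK, hk⟩ := exists_abs_subord_le (α := α) ha hlam hν
  rw [Metric.tendsto_nhdsWithin_nhds]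
  intro ε hε
  obtain ⟨d, hd, hd'⟩ := Metric.continuous_iff.1 hH 0 (ε / (K * C + 1)) (by positivity)
  refine ⟨d, hd, fun t ht htd => ?_⟩
  rw [dist_zero_right, Real.norm_eq_abs] at htd ⊢
  have ht' : 0 < t := ht
  rw [abs_of_pos ht'] at htd
  have hs : ∀ s ≤ t, |H s| ≤ ε / (K * C + 1) := by
    intro s hs
    rcases le_total s 0 with h0 | h0
    · rw [hH0 s h0, abs_zero]
      positivity
    · have := hd' s (by rw [dist_zero_right, Real.norm_eq_abs, abs_of_nonneg h0]; linarith)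
      rw [hH0 0 le_rfl, dist_zero_right, Real.norm_eq_abs] at this
      exact this.le
  refine (hk (fun σ => Phi δ 1 H σ t) r z (C * (ε / (K * C + 1))) hr fun σ hσ =>
    h σ t _ hσ hs).trans_lt ?_
  rw [← mul_assoc, ← mul_div_assoc, div_lt_iff₀ (by positivity)]
  nlinarith
end

lemma caputo_congr {δ t : ℝ} {v v' : ℝ → ℝ} (ht : 0 < t) (h : ∀ s > 0, v s = v' s) :
    caputo δ v t = caputo δ v' t := by
  rw [caputo, caputo, intervalIntegral.integral_of_le ht.le, intervalIntegral.integral_of_le ht.le]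
  congr 1
  refine setIntegral_congr_fun measurableSet_Ioc fun s hs => ?_
  have : v =ᶠ[nhds s] v' := (eventually_gt_nhds hs.1).mono h
  simp only [this.deriv_eq]

lemma caputo_const_mul (δ c : ℝ) (v : ℝ → ℝ) (t : ℝ) :
    caputo δ (fun s => c * v s) t = c * caputo δ v t := by
  simp only [caputo, deriv_const_mul_field, mul_assoc, intervalIntegral.integral_const_mul]
  ring

end WrightRadial

/-- Theorem 3: the fractional incomplete lumped formulation in the radial case.
The function `u(r,z,t) = (A/Γ(ν)) ∫_0^∞ τ^{−(ν+1)} (r/2)^{2ν} e^{−r²/(4τ)}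
e^{λ(z+ατ)/(2a²)} g₁(t,τ,z) dτ`, with `g₁ = f₁ ⋆ h ⋆ f₂` a double Laplace
convolution, solves the radial boundary value problem (1.5), (1.9), (1.10). -/
theorem fractional_incomplete_lumped_radial
    (a lam α A ν β : ℝ) (ha : 0 < a) (hlam : 0 < lam) (hα : 0 < α) (hA : 0 < A)
    (hν : 0 < ν) (hβ₁ : 0 < β) (hβ₂ : β < 1 / 2)
    (h : ℝ → ℝ) (hcont : ContinuousOn h (Ici 0))
    (hbdd : ∃ Cb : ℝ, ∀ t : ℝ, 0 ≤ t → |h t| ≤ Cb) (h0 : h 0 = 0)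
    (f₁ : ℝ → ℝ → ℝ)
    (hf₁ : ∀ τ s : ℝ, f₁ τ s =
      (2 * β * τ / s ^ (2 * β + 1)) * Mwr (τ / s ^ (2 * β)) (2 * β))
    (f₂ : ℝ → ℝ → ℝ → ℝ)
    (hf₂ : ∀ τ z s : ℝ, f₂ τ z s =
      (β * (z + α * τ) / (a * Real.sqrt π * s ^ (2 * β + 1))) *
        ∫ w in Ioi (0 : ℝ), w ^ (-(1 / 2 : ℝ)) *
          Real.exp (-(z + α * τ) ^ 2 / (4 * a ^ 2 * w) - lam ^ 2 * w / (4 * a ^ 2)) *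
          Mwr (w / s ^ (2 * β)) (2 * β))
    (g₁ : ℝ → ℝ → ℝ → ℝ)
    (hg₁ : ∀ t τ z : ℝ, g₁ t τ z = lconv (lconv (f₁ τ) h) (f₂ τ z) t)
    (u : ℝ → ℝ → ℝ → ℝ)
    (hu : ∀ r z t : ℝ, u r z t =
      (A / Real.Gamma ν) *
        ∫ τ in Ioi (0 : ℝ), τ ^ (-(ν + 1)) * (r / 2) ^ (2 * ν) *
          Real.exp (-r ^ 2 / (4 * τ)) *
          Real.exp (lam * (z + α * τ) / (2 * a ^ 2)) * g₁ t τ z) :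
    -- (i) the fractional heat equation for `r, z, t > 0`
    (∀ r z t : ℝ, 0 < r → 0 < z → 0 < t →
      caputo (2 * β) (fun t' => u r z t') t =
        a ^ 2 * iteratedDeriv 2 (fun z' => u r z' t) z -
          lam * deriv (fun z' => u r z' t) z) ∧
    -- (ii) the boundary condition at `z = 0`
    (∀ r t : ℝ, 0 < r → 0 < t →
      caputo (2 * β) (fun t' => u r 0 t') t =
        iteratedDeriv 2 (fun r' => u r' 0 t) r +
          ((1 - 2 * ν) / r) * deriv (fun r' => u r' 0 t) r +
          α * deriv (fun z' => u r z' t) 0) ∧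
    -- (iii) `u → A h(t)` as `(r,z) → (0,0)`
    (∀ t : ℝ, 0 < t →
      Tendsto (fun w : ℝ × ℝ => u w.1 w.2 t)
        (nhdsWithin (0, 0) (Ioi (0 : ℝ) ×ˢ Ioi (0 : ℝ))) (nhds (A * h t))) ∧
    -- (iv) `u → 0` as `r² + z² → ∞`
    (∀ t : ℝ, 0 < t →
      Tendsto (fun w : ℝ × ℝ => u w.1 w.2 t)
        ((comap (fun w : ℝ × ℝ => w.1 ^ 2 + w.2 ^ 2) atTop) ⊓
          𝓟 (Ioi (0 : ℝ) ×ˢ Ioi (0 : ℝ))) (nhds 0)) ∧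
    -- (v) `u → 0` as `t → 0⁺`
    (∀ r z : ℝ, 0 < r → 0 < z →
      Tendsto (fun t => u r z t) (nhdsWithin 0 (Ioi 0)) (nhds 0)) := by
  obtain ⟨Cb, hCb⟩ := hbdd
  have hδ : 0 < 2 * β := by linarith
  have hδ1 : 2 * β < 1 := by linarith
  set H : ℝ → ℝ := fun s => h (max s 0) with hHdef
  have hH : Continuous H :=
    hcont.comp_continuous (by fun_prop) fun s => mem_Ici.2 (le_max_right s 0)
  have hH0 : ∀ s ≤ 0, H s = 0 := fun s hs => by simp only [hHdef, max_eq_right hs, h0]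
  have hHb : ∀ s, |H s| ≤ Cb := fun s => hCb _ (le_max_right s 0)
  have hHh : ∀ s > 0, h s = H s := fun s hs => by simp only [hHdef, max_eq_left (le_of_lt hs)]
  have hfW : ∀ τ > 0, ∀ s ≥ 0, f₁ τ s = WrightRadial.W (2 * β) 1 τ s := by
    intro τ hτ s hs
    rw [hf₁]
    rcases eq_or_lt_of_le hs with rfl | hs'
    · rw [WrightRadial.W_of_nonpos le_rfl, zero_rpow (by linarith), div_zero, zero_mul]
    · exact (WrightRadial.W_one_eq_Mwr hδ hδ1 hτ hs').symm
  have hsub : ∀ r z t : ℝ, 0 < t → u r z t = A / Real.Gamma ν *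
      WrightRadial.subord ν a lam α (fun σ => WrightRadial.Phi (2 * β) 1 H σ t) r z := by
    intro r z t ht
    rw [hu]
    congr 1
    refine setIntegral_congr_fun measurableSet_Ioi fun τ hτ => ?_
    rw [mul_assoc, WrightRadial.rKer]
    congr 1
    rw [hg₁, ← WrightRadial.lconv_Phi_integral_fp hδ hδ1 hH hH0 hHb ha hlam hτ ht]
    have hF : ∀ s ≥ 0, lconv (f₁ τ) h s = WrightRadial.Phi (2 * β) 1 H τ s :=
      fun s hs => WrightRadial.lconv_congr hs (hfW τ hτ) hHh
    have hK : ∀ s > 0, ∫ w in Ioi (0 : ℝ), WrightRadial.fp a lam (z + α * τ) w *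
        WrightRadial.W (2 * β) 1 w s = exp (lam * (z + α * τ) / (2 * a ^ 2)) * f₂ τ z s := by
      intro s hs
      rw [hf₂, ← integral_const_mul, ← integral_const_mul]
      exact setIntegral_congr_fun measurableSet_Ioi fun w hw =>
        (WrightRadial.exp_mul_kernel_eq ha hβ₁ hβ₂ hw hs).symm
    rw [WrightRadial.lconv_congr ht.le (fun s hs => (hF s hs).symm) hK, lconv, lconv,
      ← intervalIntegral.integral_const_mul]
    congr 1
    funext s
    ring
  have hi : ∀ r z t : ℝ, 0 < r → 0 < t → caputo (2 * β) (fun t' => u r z t') t =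
      A / Real.Gamma ν *
        WrightRadial.subord ν a lam α (fun σ => WrightRadial.Phi (2 * β) (1 + 2 * β) H σ t) r z :=
    fun r z t hr ht => by
      rw [WrightRadial.caputo_congr ht fun s hs => hsub r z s hs, WrightRadial.caputo_const_mul,
        WrightRadial.caputo_subord_Phi hδ hδ1 hH hH0 hHb ha hlam hν hr ht]
  refine ⟨fun r z t hr hz ht => ?_, fun r t hr ht => ?_, fun t ht => ?_, fun t ht => ?_,
    fun r z hr hz => ?_⟩
  · obtain ⟨C, k, hP⟩ := WrightRadial.exists_profile_Phi hδ hδ1 hH hH0 hHb ht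
    have key := WrightRadial.heat_subord ha hlam hP hν hα hr hz
    rw [WrightRadial.subord_neg, neg_neg] at key
    simp only [hi r z t hr ht, hsub _ _ t ht, iteratedDeriv_const_mul_field, deriv_const_mul_field,
      ← key]
    ring
  · obtain ⟨C, k, hP⟩ := WrightRadial.exists_profile_Phi hδ hδ1 hH hH0 hHb ht
    have key := WrightRadial.boundary_subord ha hlam hP hν hα hr
    rw [WrightRadial.subord_neg, neg_neg] at key
    simp only [hi r 0 t hr ht, hsub _ _ t ht, iteratedDeriv_const_mul_field, deriv_const_mul_field,
      ← key]
    ring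
  · obtain ⟨C, k, hP⟩ := WrightRadial.exists_profile_Phi hδ hδ1 hH hH0 hHb ht
    have key := (WrightRadial.tendsto_subord_zero ha hlam hP.meas hν hα hP.bound
      (WrightRadial.tendsto_Phi_one hδ hδ1 hH hH0 hHb t)).const_mul (A / Real.Gamma ν)
    rw [← mul_assoc, div_mul_cancel₀ _ (Real.Gamma_pos_of_pos hν).ne', ← hHh t ht] at key
    simpa only [hsub _ _ t ht] using key
  · obtain ⟨D, hD⟩ := WrightRadial.exists_abs_Phi_one_le_inv hδ hδ1 hH0 hHb ht
    have key := (WrightRadial.tendsto_subord_atTop ha hlam hν hα hD).const_mul (A / Real.Gamma ν)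
    rw [mul_zero] at key
    simpa only [hsub _ _ t ht] using key
  · have key := (WrightRadial.tendsto_subord_Phi_zero (α := α) (z := z) hδ hδ1 hH hH0 ha hlam hν
      hr).const_mul (A / Real.Gamma ν)
    rw [mul_zero] at key
    refine key.congr' (eventually_mem_nhdsWithin.mono fun t ht => (hsub r z t ht).symm)
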